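/- Let Ω ⊂ ℝ be an open bounded interval, let f satisfy hypothesis (F), and let the data satisfy hypothesis (I). Then for each T > 0, the initial-boundary value problem (P) admits at most one weak solution (u,Θ) on Ω×(0,T) which belongs to the regularity class (R_T). -/

import Mathlib

open MeasureTheory Filter Set Function

noncomputable section

/-- Integral over `Ω = (a,b)`. -/
def intOm (a b : ℝ) (g : ℝ → ℝ) : ℝ := ∫ x in Ioo a b, g x

/-- Double integral over `Ω × (0,T)`. -/
def intOmT (a b T : ℝ) (F : ℝ → ℝ → ℝ) : ℝ :=
  ∫ p in (Ioo a b) ×ˢ (Ioo 0 T), F p.1 p.2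

/-- Squared `L²(Ω)` integral of `g`. -/
def sqOm (a b : ℝ) (g : ℝ → ℝ) : ℝ := ∫ x in Ioo a b, (g x) ^ 2

/-- `L²(Ω)` norm. -/
def nrmL2 (a b : ℝ) (g : ℝ → ℝ) : ℝ := (∫ x in Ioo a b, (g x) ^ 2) ^ (1 / 2 : ℝ)

/-- `L¹(Ω)` norm. -/
def nrmL1 (a b : ℝ) (g : ℝ → ℝ) : ℝ := ∫ x in Ioo a b, |g x|

/-- Membership in `L²(Ω)`. -/
def MemL2 (a b : ℝ) (g : ℝ → ℝ) : Prop :=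
  AEStronglyMeasurable g (volume.restrict (Ioo a b)) ∧
    IntegrableOn (fun x => (g x) ^ 2) (Ioo a b)

/-- Zero-trace weak derivative on `(a,b)`: `g ∈ W₀^{1,1}(a,b)` with weak derivative `g'`
(integration by parts against all smooth test functions, with no boundary terms). -/
def WeakDerivZ (a b : ℝ) (g g' : ℝ → ℝ) : Prop :=
  ∀ ψ : ℝ → ℝ, ContDiff ℝ (⊤ : ℕ∞) ψ →
    ∫ x in Ioo a b, g x * deriv ψ x = - ∫ x in Ioo a b, g' x * ψ x

/-- Interior weak derivative on `(a,b)`: `g ∈ W^{1,1}(a,b)` with weak derivative `g'`. -/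
def WeakDerivI (a b : ℝ) (g g' : ℝ → ℝ) : Prop :=
  ∀ ψ : ℝ → ℝ, ContDiff ℝ (⊤ : ℕ∞) ψ → tsupport ψ ⊆ Ioo a b →
    ∫ x in Ioo a b, g x * deriv ψ x = - ∫ x in Ioo a b, g' x * ψ x

/-- Hypothesis (F) on the nonlinearity `f`, where `f'`, `f''` denote its first and second
derivatives on `[0,∞)`: `f ∈ C²([0,∞))`, `f(0)=0`, `f' > 0` on `[0,∞)`,
and `f' ∈ W^{1,∞}((0,∞))` (i.e. `f'` and `f''` are bounded). -/
structure HypF (f f' f'' : ℝ → ℝ) : Prop where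
  hasDeriv₁ : ∀ x ∈ Ici (0 : ℝ), HasDerivWithinAt f (f' x) (Ici 0) x
  hasDeriv₂ : ∀ x ∈ Ici (0 : ℝ), HasDerivWithinAt f' (f'' x) (Ici 0) x
  cont₂ : ContinuousOn f'' (Ici 0)
  zero : f 0 = 0
  pos : ∀ x ∈ Ici (0 : ℝ), 0 < f' x
  bdd : ∃ M : ℝ, ∀ x ∈ Ici (0 : ℝ), |f' x| ≤ M ∧ |f'' x| ≤ M

/-- Partial derivative in the first (spatial) variable. -/
def pdx (w : ℝ → ℝ → ℝ) : ℝ → ℝ → ℝ := fun x t => deriv (fun y => w y t) x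

/-- Partial derivative in the second (time) variable. -/
def pdt (w : ℝ → ℝ → ℝ) : ℝ → ℝ → ℝ := fun x t => deriv (fun s => w x s) t

/-- Test functions in `C₀^∞(Ω × [0,T))`. -/
structure TestU (a b T : ℝ) (φ : ℝ → ℝ → ℝ) : Prop where
  smooth : ContDiff ℝ (⊤ : ℕ∞) (uncurry φ)
  suppx : ∃ K : Set ℝ, IsCompact K ∧ K ⊆ Ioo a b ∧ ∀ x t, x ∉ K → φ x t = 0
  suppt : ∃ T' : ℝ, T' < T ∧ ∀ x t, T' ≤ t → φ x t = 0

/-- Test functions in `C^∞(Ω̄ × [0,T))`, compactly supported in time. -/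
structure TestT (T : ℝ) (φ : ℝ → ℝ → ℝ) : Prop where
  smooth : ContDiff ℝ (⊤ : ℕ∞) (uncurry φ)
  suppt : ∃ T' : ℝ, T' < T ∧ ∀ x t, T' ≤ t → φ x t = 0

/-- Test functions in `C₀^∞(Ω × (0,T))`. -/
structure TestInt (a b T : ℝ) (φ : ℝ → ℝ → ℝ) : Prop where
  smooth : ContDiff ℝ (⊤ : ℕ∞) (uncurry φ)
  suppx : ∃ K : Set ℝ, IsCompact K ∧ K ⊆ Ioo a b ∧ ∀ x t, x ∉ K → φ x t = 0
  supptime : ∃ K : Set ℝ, IsCompact K ∧ K ⊆ Ioo 0 T ∧ ∀ x t, t ∉ K → φ x t = 0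

/-- Definition (W): weak solution of (P) on `Ω × (0,T)`.  Here `ut`, `ux`, `Θx` denote
the weak derivatives of `u` (in time and space) and of `Θ` (in space). -/
structure IsWeakSol (a b T : ℝ) (f f' : ℝ → ℝ) (u0 u0t Θ0 : ℝ → ℝ)
    (u ut ux Θ Θx : ℝ → ℝ → ℝ) : Prop where
  u_sliceL1 : ∀ t ∈ Icc 0 T, IntegrableOn (fun x => u x t) (Ioo a b)
  u_contL1 : ∀ t₀ ∈ Icc 0 T,
    Tendsto (fun t => ∫ x in Ioo a b, |u x t - u x t₀|) (nhdsWithin t₀ (Icc 0 T)) (nhds 0)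
  u_int : IntegrableOn (fun p : ℝ × ℝ => u p.1 p.2) ((Ioo a b) ×ˢ (Ioo 0 T))
  ux_int : IntegrableOn (fun p : ℝ × ℝ => ux p.1 p.2) ((Ioo a b) ×ˢ (Ioo 0 T))
  u_W0 : ∀ᵐ t ∂volume.restrict (Ioo 0 T), WeakDerivZ a b (fun x => u x t) (fun x => ux x t)
  Θ_int : IntegrableOn (fun p : ℝ × ℝ => Θ p.1 p.2) ((Ioo a b) ×ˢ (Ioo 0 T))
  Θx_int : IntegrableOn (fun p : ℝ × ℝ => Θx p.1 p.2) ((Ioo a b) ×ˢ (Ioo 0 T))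
  Θ_W : ∀ᵐ t ∂volume.restrict (Ioo 0 T), WeakDerivI a b (fun x => Θ x t) (fun x => Θx x t)
  Θ_nonneg : ∀ᵐ p ∂volume.restrict ((Ioo a b) ×ˢ (Ioo 0 T)), 0 ≤ Θ p.1 p.2
  ut_weak : ∀ φ : ℝ → ℝ → ℝ, TestInt a b T φ →
    intOmT a b T (fun x t => u x t * pdt φ x t) = - intOmT a b T (fun x t => ut x t * φ x t)
  ut_int : IntegrableOn (fun p : ℝ × ℝ => ut p.1 p.2) ((Ioo a b) ×ˢ (Ioo 0 T))
  g1_int : IntegrableOn (fun p : ℝ × ℝ => f' (Θ p.1 p.2) * Θx p.1 p.2)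
    ((Ioo a b) ×ˢ (Ioo 0 T))
  g2_int : IntegrableOn (fun p : ℝ × ℝ => f' (Θ p.1 p.2) * Θx p.1 p.2 * ut p.1 p.2)
    ((Ioo a b) ×ˢ (Ioo 0 T))
  g3_int : IntegrableOn (fun p : ℝ × ℝ => f (Θ p.1 p.2) * ut p.1 p.2)
    ((Ioo a b) ×ˢ (Ioo 0 T))
  weak_u : ∀ φ : ℝ → ℝ → ℝ, TestU a b T φ →
    intOmT a b T (fun x t => u x t * pdt (pdt φ) x t)
        - intOm a b (fun x => u0t x * φ x 0) + intOm a b (fun x => u0 x * pdt φ x 0)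
      = - intOmT a b T (fun x t => ux x t * pdx φ x t)
        - intOmT a b T (fun x t => f' (Θ x t) * Θx x t * φ x t)
  weak_Θ : ∀ φ : ℝ → ℝ → ℝ, TestT T φ →
    - intOmT a b T (fun x t => Θ x t * pdt φ x t) - intOm a b (fun x => Θ0 x * φ x 0)
      = - intOmT a b T (fun x t => Θx x t * pdx φ x t)
        + intOmT a b T (fun x t => f' (Θ x t) * Θx x t * ut x t * φ x t)
        + intOmT a b T (fun x t => f (Θ x t) * ut x t * pdx φ x t)

/-- Continuity of `t ↦ w(·,t)` as a map `J → L²(Ω)` (with slices in `L²(Ω)`). -/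
def ContL2 (a b : ℝ) (J : Set ℝ) (w : ℝ → ℝ → ℝ) : Prop :=
  (∀ t ∈ J, MemL2 a b (fun x => w x t)) ∧
    ∀ t₀ ∈ J, Tendsto (fun t => ∫ x in Ioo a b, (w x t - w x t₀) ^ 2)
      (nhdsWithin t₀ J) (nhds 0)

/-- The regularity class (R_T):  `u ∈ C⁰([0,T];W₀^{1,2})`, `u_t ∈ C⁰([0,T];L²)`,
`Θ ∈ C⁰([0,T];L²) ∩ L²((0,T);W^{1,2})`. -/
structure RegT (a b T : ℝ) (u ut ux Θ Θx : ℝ → ℝ → ℝ) : Prop where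
  u_cont : ContL2 a b (Icc 0 T) u
  ux_cont : ContL2 a b (Icc 0 T) ux
  u_W0 : ∀ t ∈ Icc (0 : ℝ) T, WeakDerivZ a b (fun x => u x t) (fun x => ux x t)
  ut_cont : ContL2 a b (Icc 0 T) ut
  Θ_cont : ContL2 a b (Icc 0 T) Θ
  Θ_sq_int : IntegrableOn (fun p : ℝ × ℝ => (Θ p.1 p.2) ^ 2) ((Ioo a b) ×ˢ (Ioo 0 T))
  Θx_sq_int : IntegrableOn (fun p : ℝ × ℝ => (Θx p.1 p.2) ^ 2) ((Ioo a b) ×ˢ (Ioo 0 T))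

/-- Data hypothesis (I), with `u0x` the weak derivative of `u0 ∈ W₀^{1,2}(Ω)`. -/
structure DataI (a b : ℝ) (u0 u0x u0t Θ0 : ℝ → ℝ) : Prop where
  u0_L2 : MemL2 a b u0
  u0x_L2 : MemL2 a b u0x
  u0_W0 : WeakDerivZ a b u0 u0x
  u0t_L2 : MemL2 a b u0t
  Θ0_L2 : MemL2 a b Θ0
  Θ0_nonneg : ∀ᵐ x ∂volume.restrict (Ioo a b), 0 ≤ Θ0 x

/-- Smooth-data hypothesis (I∞). -/
structure SmoothData (a b : ℝ) (v0 u0 Θ0 : ℝ → ℝ) : Prop where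
  v0_smooth : ContDiff ℝ (⊤ : ℕ∞) v0
  v0_supp : ∃ K : Set ℝ, IsCompact K ∧ K ⊆ Ioo a b ∧ ∀ x, x ∉ K → v0 x = 0
  u0_smooth : ContDiff ℝ (⊤ : ℕ∞) u0
  u0_supp : ∃ K : Set ℝ, IsCompact K ∧ K ⊆ Ioo a b ∧ ∀ x, x ∉ K → u0 x = 0
  Θ0_smooth : ContDiff ℝ (⊤ : ℕ∞) Θ0
  Θ0_pos : ∀ x ∈ Icc a b, 0 < Θ0 x
  Θ0x_supp : ∃ K : Set ℝ, IsCompact K ∧ K ⊆ Ioo a b ∧ ∀ x, x ∉ K → deriv Θ0 x = 0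

/-- Classical solution of the regularized problem (P_ε), of class
`C^{4,1} × C^{2,1} × C^{2,1}(Ω̄ × [0,∞))`, with positive temperature. -/
structure IsClassicalSolEps (a b : ℝ) (f : ℝ → ℝ) (ε : ℝ) (v0 u0 Θ0 : ℝ → ℝ)
    (v u Θ : ℝ → ℝ → ℝ) : Prop where
  diffx_v : ∀ k < 4, ∀ x ∈ Icc a b, ∀ t ∈ Ici (0 : ℝ),
    DifferentiableAt ℝ (fun y => pdx^[k] v y t) x
  difft_v : ∀ x ∈ Icc a b, ∀ t ∈ Ici (0 : ℝ), DifferentiableAt ℝ (fun s => v x s) t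
  cont_v : ∀ k ≤ 4, ContinuousOn (uncurry (pdx^[k] v)) ((Icc a b) ×ˢ (Ici 0))
  contt_v : ContinuousOn (uncurry (pdt v)) ((Icc a b) ×ˢ (Ici 0))
  diffx_u : ∀ k < 2, ∀ x ∈ Icc a b, ∀ t ∈ Ici (0 : ℝ),
    DifferentiableAt ℝ (fun y => pdx^[k] u y t) x
  difft_u : ∀ x ∈ Icc a b, ∀ t ∈ Ici (0 : ℝ), DifferentiableAt ℝ (fun s => u x s) t
  cont_u : ∀ k ≤ 2, ContinuousOn (uncurry (pdx^[k] u)) ((Icc a b) ×ˢ (Ici 0))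
  contt_u : ContinuousOn (uncurry (pdt u)) ((Icc a b) ×ˢ (Ici 0))
  diffx_Θ : ∀ k < 2, ∀ x ∈ Icc a b, ∀ t ∈ Ici (0 : ℝ),
    DifferentiableAt ℝ (fun y => pdx^[k] Θ y t) x
  difft_Θ : ∀ x ∈ Icc a b, ∀ t ∈ Ici (0 : ℝ), DifferentiableAt ℝ (fun s => Θ x s) t
  cont_Θ : ∀ k ≤ 2, ContinuousOn (uncurry (pdx^[k] Θ)) ((Icc a b) ×ˢ (Ici 0))
  contt_Θ : ContinuousOn (uncurry (pdt Θ)) ((Icc a b) ×ˢ (Ici 0))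
  Θ_pos : ∀ x ∈ Icc a b, ∀ t ∈ Ici (0 : ℝ), 0 < Θ x t
  eq_v : ∀ x ∈ Ioo a b, ∀ t ∈ Ioi (0 : ℝ),
    pdt v x t = -ε * pdx^[4] v x t + pdx^[2] u x t - pdx (fun y s => f (Θ y s)) x t
  eq_u : ∀ x ∈ Ioo a b, ∀ t ∈ Ioi (0 : ℝ), pdt u x t = ε * pdx^[2] u x t + v x t
  eq_Θ : ∀ x ∈ Ioo a b, ∀ t ∈ Ioi (0 : ℝ),
    pdt Θ x t = pdx^[2] Θ x t - f (Θ x t) * pdx v x t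
  bc_v : ∀ t ∈ Ioi (0 : ℝ),
    v a t = 0 ∧ v b t = 0 ∧ pdx^[2] v a t = 0 ∧ pdx^[2] v b t = 0
  bc_u : ∀ t ∈ Ioi (0 : ℝ), u a t = 0 ∧ u b t = 0
  bc_Θ : ∀ t ∈ Ioi (0 : ℝ), pdx Θ a t = 0 ∧ pdx Θ b t = 0
  init : ∀ x ∈ Icc a b, v x 0 = v0 x ∧ u x 0 = u0 x ∧ Θ x 0 = Θ0 x

/-- Weak convergence in `L²_loc(Ω̄ × [0,∞))`. -/
def WkL2loc (a b : ℝ) (wj : ℕ → ℝ → ℝ → ℝ) (w : ℝ → ℝ → ℝ) : Prop :=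
  ∀ T > (0 : ℝ), ∀ ψ : ℝ → ℝ → ℝ,
    AEStronglyMeasurable (fun p : ℝ × ℝ => ψ p.1 p.2)
      (volume.restrict ((Icc a b) ×ˢ (Icc 0 T))) →
    IntegrableOn (fun p : ℝ × ℝ => (ψ p.1 p.2) ^ 2) ((Icc a b) ×ˢ (Icc 0 T)) →
    Tendsto (fun j => ∫ p in (Icc a b) ×ˢ (Icc 0 T), wj j p.1 p.2 * ψ p.1 p.2) atTop
      (nhds (∫ p in (Icc a b) ×ˢ (Icc 0 T), w p.1 p.2 * ψ p.1 p.2))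

/-- The square of a primitive of an integrable function. -/
theorem sq_primitive {g : ℝ → ℝ} {a b c x : ℝ} (hg : IntervalIntegrable g volume a b)
    (hx : x ∈ uIcc a b) :
    (c + ∫ s in a..x, g s) ^ 2 = c ^ 2 + 2 * ∫ s in a..x, (c + ∫ r in a..s, g r) * g s := by
  have hsub : uIcc a x ⊆ uIcc a b := uIcc_subset_uIcc_left hx
  have hgx : IntervalIntegrable g volume a x := hg.mono_set hsub
  have hac : AbsolutelyContinuousOnInterval (fun y => c + ∫ r in a..y, g r) a x := by
    have h1 := hgx.absolutelyContinuousOnInterval_intervalIntegral (c := a) (by simp)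
    have h0 : AbsolutelyContinuousOnInterval (fun _ : ℝ => c) a x :=
      (LipschitzOnWith.of_dist_le_mul (K := 0) (by simp)).absolutelyContinuousOnInterval
    exact h0.add h1
  have h := hac.integral_deriv_mul_eq_sub hac
  have he : ∫ y in a..x, (deriv (fun y => c + ∫ r in a..y, g r) y * (c + ∫ r in a..y, g r)
      + (c + ∫ r in a..y, g r) * deriv (fun y => c + ∫ r in a..y, g r) y)
      = ∫ y in a..x, 2 * ((c + ∫ r in a..y, g r) * g y) := by
    apply intervalIntegral.integral_congr_ae
    filter_upwards [hgx.ae_hasDerivAt_integral] with y hy hy'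
    have := ((hy (uIoc_subset_uIcc hy') a (by simp)).const_add c).deriv
    rw [this]; ring
  rw [he, intervalIntegral.integral_const_mul] at h
  simp at h
  linarith

/-- Integration by parts of a primitive against a smooth function. -/
theorem primitive_ibp {g η : ℝ → ℝ} {a b : ℝ} (hg : IntervalIntegrable g volume a b)
    (hη : ContDiff ℝ 1 η) :
    ∫ s in a..b, g s * η s
      = (∫ s in a..b, g s) * η b - ∫ s in a..b, (∫ r in a..s, g r) * deriv η s := by
  have h1 := hg.absolutelyContinuousOnInterval_intervalIntegral (c := a) (by simp)
  have h2 : AbsolutelyContinuousOnInterval η a b := by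
    obtain ⟨K, hK⟩ := hη.contDiffOn.exists_lipschitzOnWith one_ne_zero (convex_uIcc a b)
      isCompact_uIcc
    exact hK.absolutelyContinuousOnInterval
  rw [h1.integral_mul_deriv_eq_deriv_mul h2]
  have he : ∫ y in a..b, deriv (fun y => ∫ r in a..y, g r) y * η y = ∫ y in a..b, g y * η y := by
    apply intervalIntegral.integral_congr_ae
    filter_upwards [hg.ae_hasDerivAt_integral] with y hy hy'
    rw [(hy (uIoc_subset_uIcc hy') a (by simp)).deriv]
  rw [he]; simp

theorem contDiff_primitive {ρ : ℝ → ℝ} (hρ : ContDiff ℝ (⊤ : ℕ∞) ρ) (c : ℝ) :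
    ContDiff ℝ (⊤ : ℕ∞) (fun t => ∫ s in c..t, ρ s) ∧
      deriv (fun t => ∫ s in c..t, ρ s) = ρ := by
  have hd : ∀ t, HasDerivAt (fun t => ∫ s in c..t, ρ s) (ρ t) t := fun t =>
    intervalIntegral.integral_hasDerivAt_right (hρ.continuous.intervalIntegrable _ _)
      (hρ.continuous.stronglyMeasurableAtFilter _ _) hρ.continuous.continuousAt
  have hde : deriv (fun t => ∫ s in c..t, ρ s) = ρ := funext fun t => (hd t).deriv
  refine ⟨contDiff_infty_iff_deriv.2 ⟨fun t => (hd t).differentiableAt, ?_⟩, hde⟩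
  rw [hde]; exact hρ

/-- Smooth functions of time vanishing near the final time `T` and afterwards. -/
def VanishLate (T : ℝ) (η : ℝ → ℝ) : Prop :=
  ContDiff ℝ (⊤ : ℕ∞) η ∧ ∃ T' < T, ∀ t, T' ≤ t → η t = 0

theorem VanishLate.primitive {T : ℝ} {ρ : ℝ → ℝ} (hρ : VanishLate T ρ) :
    VanishLate T (fun t => ∫ s in T..t, ρ s) := by
  obtain ⟨hs, T', hT', h0⟩ := hρ
  refine ⟨(contDiff_primitive hs T).1, T', hT', fun t ht => ?_⟩
  have : ∫ s in T..t, ρ s = ∫ s in T..t, (0 : ℝ) := by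
    apply intervalIntegral.integral_congr
    intro s hs
    refine h0 s ?_
    have := hs.1
    exact (le_min hT'.le ht).trans this
  simp [this]

theorem vanishLate_of_compactSupport {T : ℝ} (hT : 0 < T) {ρ : ℝ → ℝ}
    (hρ : ContDiff ℝ (⊤ : ℕ∞) ρ)
    (hc : HasCompactSupport ρ) (hs : tsupport ρ ⊆ Ioo 0 T) : VanishLate T ρ := by
  refine ⟨hρ, ?_⟩
  rcases (tsupport ρ).eq_empty_or_nonempty with he | hne
  · refine ⟨0, hT, fun t _ => image_eq_zero_of_notMem_tsupport (by simp [he])⟩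
  · have hm := hs (hc.isCompact.sSup_mem hne)
    refine ⟨(sSup (tsupport ρ) + T) / 2, by linarith [hm.2], fun t ht => ?_⟩
    apply image_eq_zero_of_notMem_tsupport
    intro h
    have := le_csSup hc.isCompact.bddAbove h
    linarith [hm.2]

theorem intervalIntegrable_of_Ioo {g : ℝ → ℝ} {a b : ℝ} (hab : a ≤ b)
    (hg : IntegrableOn g (Ioo a b)) : IntervalIntegrable g volume a b :=
  (intervalIntegrable_iff_integrableOn_Ioo_of_le hab).2 hg

theorem integral_Ioo_eq {g : ℝ → ℝ} {a b : ℝ} (hab : a ≤ b) :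
    ∫ s in Ioo a b, g s = ∫ s in a..b, g s := by
  rw [intervalIntegral.integral_of_le hab, integral_Ioc_eq_integral_Ioo]

theorem integral_mul_vanishLate {T : ℝ} (hT : 0 < T) {h ξ : ℝ → ℝ}
    (hh : IntegrableOn h (Ioo 0 T)) (hξ : VanishLate T ξ) :
    ∫ t in Ioo 0 T, h t * ξ t = - ∫ t in Ioo 0 T, (∫ s in (0 : ℝ)..t, h s) * deriv ξ t := by
  rw [integral_Ioo_eq hT.le, integral_Ioo_eq hT.le,
    primitive_ibp (intervalIntegrable_of_Ioo hT.le hh) (hξ.1.of_le (by norm_cast))]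
  obtain ⟨T', hT', h0⟩ := hξ.2
  rw [h0 T hT'.le]; ring

theorem continuousOn_primitive {T : ℝ} (hT : 0 < T) {h : ℝ → ℝ}
    (hh : IntegrableOn h (Ioo 0 T)) :
    ContinuousOn (fun t => ∫ s in (0 : ℝ)..t, h s) (Icc 0 T) := by
  have := intervalIntegral.continuousOn_primitive_interval'
    (intervalIntegrable_of_Ioo hT.le hh) (a := 0) (by simp)
  rwa [uIcc_of_le hT.le] at this

theorem ContinuousOn.integrableOn_Ioo {T : ℝ} {g : ℝ → ℝ} (hg : ContinuousOn g (Icc 0 T)) :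
    IntegrableOn g (Ioo 0 T) :=
  (hg.integrableOn_Icc).mono_set Ioo_subset_Icc_self

theorem ae_eq_zero_of_forall_test {T : ℝ} {g : ℝ → ℝ} (hg : IntegrableOn g (Ioo 0 T))
    (h : ∀ ρ : ℝ → ℝ, ContDiff ℝ (⊤ : ℕ∞) ρ → HasCompactSupport ρ → tsupport ρ ⊆ Ioo 0 T →
      ∫ t in Ioo 0 T, g t * ρ t = 0) :
    g =ᵐ[volume.restrict (Ioo 0 T)] 0 := by
  have := isOpen_Ioo.ae_eq_zero_of_integral_contDiff_smul_eq_zero (μ := volume)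
    hg.locallyIntegrableOn (fun ρ h1 h2 h3 => by
      have := h ρ h1 h2 h3
      rw [setIntegral_eq_integral_of_forall_compl_eq_zero] at this
      · simpa [mul_comm] using this
      · intro x hx
        rw [image_eq_zero_of_notMem_tsupport (fun h' => hx (h3 h')), mul_zero])
  exact (ae_restrict_iff' measurableSet_Ioo).2 this

/-- Two continuous functions with the same action on test functions coincide. -/
theorem eqOn_of_forall_test {T : ℝ} (hT : 0 < T) {g h : ℝ → ℝ} (hg : ContinuousOn g (Icc 0 T))
    (hh : ContinuousOn h (Icc 0 T))
    (H : ∀ ρ : ℝ → ℝ, ContDiff ℝ (⊤ : ℕ∞) ρ → HasCompactSupport ρ → tsupport ρ ⊆ Ioo 0 T →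
      ∫ t in Ioo 0 T, g t * ρ t = ∫ t in Ioo 0 T, h t * ρ t) :
    EqOn g h (Icc 0 T) := by
  have h1 : (fun t => g t - h t) =ᵐ[volume.restrict (Ioo 0 T)] 0 := by
    apply ae_eq_zero_of_forall_test (hg.sub hh).integrableOn_Ioo
    intro ρ h1 h2 h3
    change ∫ t in Ioo 0 T, (g t - h t) * ρ t = 0
    simp only [sub_mul]
    rw [integral_sub, H ρ h1 h2 h3, sub_self]
    · exact (hg.mul h1.continuous.continuousOn).integrableOn_Ioo
    · exact (hh.mul h1.continuous.continuousOn).integrableOn_Ioo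
  apply Measure.eqOn_Icc_of_ae_eq volume hT.ne _ hg hh
  rw [restrict_Ioo_eq_restrict_Icc] at h1
  filter_upwards [h1] with t ht
  simpa [sub_eq_zero] using ht

/-- Du Bois-Reymond lemma with zero initial value. -/
theorem eq_primitive_of_weak {T : ℝ} (hT : 0 < T) {g h : ℝ → ℝ} (hg : ContinuousOn g (Icc 0 T))
    (hh : IntegrableOn h (Ioo 0 T))
    (H : ∀ η, VanishLate T η →
      ∫ t in Ioo 0 T, g t * deriv η t = - ∫ t in Ioo 0 T, h t * η t) :
    ∀ t ∈ Icc 0 T, g t = ∫ s in (0 : ℝ)..t, h s := by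
  apply eqOn_of_forall_test hT hg (continuousOn_primitive hT hh)
  intro ρ h1 h2 h3
  have hv := vanishLate_of_compactSupport hT h1 h2 h3
  have := H _ hv.primitive
  rw [integral_mul_vanishLate hT hh hv.primitive, (contDiff_primitive h1 T).2, neg_neg] at this
  exact this

theorem hasSum_parseval {μ : Measure ℝ} {e : ℕ → ℝ → ℝ} (he : ∀ n, MemLp (e n) 2 μ)
    (ho : ∀ m n, ∫ x, e m x * e n x ∂μ = if m = n then 1 else 0)
    (hc : ∀ h : ℝ → ℝ, MemLp h 2 μ → (∀ n, ∫ x, h x * e n x ∂μ = 0) → h =ᵐ[μ] 0)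
    {p q : ℝ → ℝ} (hp : MemLp p 2 μ) (hq : MemLp q 2 μ) :
    HasSum (fun n => (∫ x, p x * e n x ∂μ) * (∫ x, q x * e n x ∂μ)) (∫ x, p x * q x ∂μ) := by
  have hinner : ∀ {f g : ℝ → ℝ} (hf : MemLp f 2 μ) (hg : MemLp g 2 μ),
      inner ℝ (hf.toLp f) (hg.toLp g) = ∫ x, f x * g x ∂μ := by
    intro f g hf hg
    rw [L2.inner_def]
    apply integral_congr_ae
    filter_upwards [hf.coeFn_toLp, hg.coeFn_toLp] with x h1 h2
    simp [h1, h2, mul_comm]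
  have hor : Orthonormal ℝ (fun n => (he n).toLp (e n)) := by
    rw [orthonormal_iff_ite]
    intro m n
    rw [hinner, ho]
  have hbot : (Submodule.span ℝ (Set.range (fun n => (he n).toLp (e n))))ᗮ = ⊥ := by
    rw [Submodule.eq_bot_iff]
    intro h hh
    have h1 : ∀ n, ∫ x, h x * e n x ∂μ = 0 := by
      intro n
      have := (Submodule.mem_orthogonal' _ _).1 hh _ (Submodule.subset_span ⟨n, rfl⟩)
      rw [← this, L2.inner_def]
      apply integral_congr_ae
      filter_upwards [(he n).coeFn_toLp] with x h2
      simp [h2, mul_comm]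
    have h2 := hc h (Lp.memLp h) h1
    exact (Lp.eq_zero_iff_ae_eq_zero).2 h2
  have := (HilbertBasis.mkOfOrthogonalEqBot hor hbot).hasSum_inner_mul_inner (hp.toLp p) (hq.toLp q)
  simp only [HilbertBasis.coe_mkOfOrthogonalEqBot, hinner] at this
  have hcomm : ∀ n, ∫ x, q x * e n x ∂μ = ∫ x, e n x * q x ∂μ := fun n => by
    simp only [mul_comm]
  simp only [hcomm]
  exact this

/-- Angular frequency of the `n`-th mode on `(a,b)`. -/
def frq (a b : ℝ) (n : ℕ) : ℝ := n * (Real.pi / (b - a))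

/-- Normalized Neumann modes on `(a,b)`. -/
def cosB (a b : ℝ) (n : ℕ) (x : ℝ) : ℝ :=
  (if n = 0 then √(1 / (b - a)) else √(2 / (b - a))) * Real.cos (frq a b n * (x - a))

/-- Normalized Dirichlet modes on `(a,b)`. -/
def sinB (a b : ℝ) (n : ℕ) (x : ℝ) : ℝ :=
  √(2 / (b - a)) * Real.sin (frq a b n * (x - a))

theorem contDiff_cosB (a b : ℝ) (n : ℕ) : ContDiff ℝ (⊤ : ℕ∞) (cosB a b n) := by
  unfold cosB; fun_prop

theorem contDiff_sinB (a b : ℝ) (n : ℕ) : ContDiff ℝ (⊤ : ℕ∞) (sinB a b n) := by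
  unfold sinB; fun_prop

theorem hasDerivAt_phase (a w x : ℝ) : HasDerivAt (fun x : ℝ => w * (x - a)) w x := by
  simpa using ((hasDerivAt_id x).sub_const a).const_mul w

theorem deriv_cosB (a b : ℝ) (n : ℕ) (x : ℝ) :
    deriv (cosB a b n) x = - frq a b n * sinB a b n x := by
  have h := ((hasDerivAt_phase a (frq a b n) x).cos.const_mul
    (if n = 0 then √(1 / (b - a)) else √(2 / (b - a)))).deriv
  have : deriv (cosB a b n) x = _ := h
  rw [this]
  unfold sinB
  rcases eq_or_ne n 0 with rfl | hn
  · simp [frq]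
  · simp only [hn, if_false]; ring

theorem deriv_sinB (a b : ℝ) (n : ℕ) (x : ℝ) :
    deriv (sinB a b n) x = frq a b n * cosB a b n x := by
  have h := ((hasDerivAt_phase a (frq a b n) x).sin.const_mul √(2 / (b - a))).deriv
  have : deriv (sinB a b n) x = _ := h
  rw [this]
  unfold cosB
  rcases eq_or_ne n 0 with rfl | hn
  · simp [frq]
  · simp only [hn, if_false]; ring

theorem abs_cosB_le {a b : ℝ} (hab : a < b) (n : ℕ) (x : ℝ) : |cosB a b n x| ≤ √(2 / (b - a)) := by
  have hL : 0 < b - a := sub_pos.2 hab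
  unfold cosB
  rw [abs_mul]
  have h1 : |(if n = 0 then √(1 / (b - a)) else √(2 / (b - a)))| ≤ √(2 / (b - a)) := by
    split_ifs
    · rw [abs_of_nonneg (Real.sqrt_nonneg _)]; gcongr; norm_num
    · rw [abs_of_nonneg (Real.sqrt_nonneg _)]
  calc _ ≤ √(2 / (b - a)) * 1 := by
        gcongr; exact Real.abs_cos_le_one _
    _ = _ := mul_one _

theorem sinB_left (a b : ℝ) (n : ℕ) : sinB a b n a = 0 := by simp [sinB]

theorem sinB_right {a b : ℝ} (hab : a < b) (n : ℕ) : sinB a b n b = 0 := by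
  have hL : b - a ≠ 0 := (sub_pos.2 hab).ne'
  have : frq a b n * (b - a) = n * Real.pi := by unfold frq; field_simp
  simp [sinB, this]

theorem integral_cos_mode {a b : ℝ} (hab : a < b) (m : ℤ) :
    ∫ x in Ioo a b, Real.cos (m * (Real.pi / (b - a)) * (x - a)) = if m = 0 then b - a else 0 := by
  have hL : b - a ≠ 0 := (sub_pos.2 hab).ne'
  rw [integral_Ioo_eq hab.le]
  split_ifs with h
  · simp [h]
  · have hw : (m : ℝ) * (Real.pi / (b - a)) ≠ 0 := by
      have : (m : ℝ) ≠ 0 := by exact_mod_cast h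
      have := Real.pi_ne_zero
      positivity
    have hd : ∀ x ∈ uIcc a b, HasDerivAt
        (fun x => Real.sin (m * (Real.pi / (b - a)) * (x - a)) / (m * (Real.pi / (b - a))))
        (Real.cos (m * (Real.pi / (b - a)) * (x - a))) x := by
      intro x _
      have := ((hasDerivAt_phase a (m * (Real.pi / (b - a))) x).sin).div_const
        (m * (Real.pi / (b - a)))
      rwa [mul_div_assoc, div_self hw, mul_one] at this
    rw [intervalIntegral.integral_eq_sub_of_hasDerivAt hd]
    · have : (m : ℝ) * (Real.pi / (b - a)) * (b - a) = m * Real.pi := by field_simp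
      simp [this]
    · exact Continuous.intervalIntegrable (by fun_prop) _ _

theorem Continuous.integrable_Ioo {g : ℝ → ℝ} (hg : Continuous g) (a b : ℝ) :
    Integrable g (volume.restrict (Ioo a b)) :=
  (hg.integrableOn_Icc (a := a) (b := b)).mono_set Ioo_subset_Icc_self

theorem Continuous.memLp_Ioo {g : ℝ → ℝ} (hg : Continuous g) (a b : ℝ) :
    MemLp g 2 (volume.restrict (Ioo a b)) := by
  rw [memLp_two_iff_integrable_sq hg.aestronglyMeasurable]
  exact (hg.pow 2).integrable_Ioo a b

theorem orthonormal_cosB {a b : ℝ} (hab : a < b) (m n : ℕ) :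
    ∫ x in Ioo a b, cosB a b m x * cosB a b n x = if m = n then 1 else 0 := by
  have hL : 0 < b - a := sub_pos.2 hab
  have h1 := integral_cos_mode hab ((m : ℤ) - n)
  have h2 := integral_cos_mode hab ((m : ℤ) + n)
  push_cast at h1 h2
  set A := (if m = 0 then √(1 / (b - a)) else √(2 / (b - a)))
  set B := (if n = 0 then √(1 / (b - a)) else √(2 / (b - a)))
  have he : ∀ x, cosB a b m x * cosB a b n x
      = A * B / 2 * Real.cos (((m : ℝ) - n) * (Real.pi / (b - a)) * (x - a))
        + A * B / 2 * Real.cos (((m : ℝ) + n) * (Real.pi / (b - a)) * (x - a)) := by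
    intro x
    have e1 : ((m : ℝ) - n) * (Real.pi / (b - a)) * (x - a)
      = frq a b m * (x - a) - frq a b n * (x - a) := by unfold frq; ring
    have e2 : ((m : ℝ) + n) * (Real.pi / (b - a)) * (x - a)
      = frq a b m * (x - a) + frq a b n * (x - a) := by unfold frq; ring
    rw [e1, e2, Real.cos_add, Real.cos_sub]
    unfold cosB; ring
  simp only [he]
  rw [integral_add, integral_const_mul, integral_const_mul, h1, h2]
  · rcases eq_or_ne m n with rfl | hmn
    · rcases eq_or_ne m 0 with rfl | hm
      · simp only [A, B, if_true]
        simp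
        rw [← mul_inv, Real.mul_self_sqrt hL.le]; field_simp; norm_num
      · have : ¬ ((m : ℤ) + m = 0) := by omega
        simp only [A, B, if_true, hm, if_false, this, sub_self]
        rw [Real.mul_self_sqrt (by positivity)]
        field_simp; norm_num
    · have t1 : ¬ ((m : ℤ) - n = 0) := by omega
      have t2 : ¬ ((m : ℤ) + n = 0) := by omega
      simp [hmn, t1, t2]
  · exact Continuous.integrable_Ioo (by fun_prop) _ _
  · exact Continuous.integrable_Ioo (by fun_prop) _ _

theorem orthonormal_sinB {a b : ℝ} (hab : a < b) (m n : ℕ) :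
    ∫ x in Ioo a b, sinB a b (m + 1) x * sinB a b (n + 1) x = if m = n then 1 else 0 := by
  have hL : 0 < b - a := sub_pos.2 hab
  have h1 := integral_cos_mode hab (((m + 1 : ℕ) : ℤ) - (n + 1 : ℕ))
  have h2 := integral_cos_mode hab (((m + 1 : ℕ) : ℤ) + (n + 1 : ℕ))
  rw [Int.cast_sub, Int.cast_natCast, Int.cast_natCast] at h1
  rw [Int.cast_add, Int.cast_natCast, Int.cast_natCast] at h2
  have he : ∀ x, sinB a b (m + 1) x * sinB a b (n + 1) x
      = 1 / (b - a) *
          Real.cos ((((m + 1 : ℕ) : ℝ) - (n + 1 : ℕ)) * (Real.pi / (b - a)) * (x - a))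
        - 1 / (b - a) *
          Real.cos ((((m + 1 : ℕ) : ℝ) + (n + 1 : ℕ)) * (Real.pi / (b - a)) * (x - a)) := by
    intro x
    have e1 : (((m + 1 : ℕ) : ℝ) - (n + 1 : ℕ)) * (Real.pi / (b - a)) * (x - a)
      = frq a b (m + 1) * (x - a) - frq a b (n + 1) * (x - a) := by unfold frq; ring
    have e2 : (((m + 1 : ℕ) : ℝ) + (n + 1 : ℕ)) * (Real.pi / (b - a)) * (x - a)
      = frq a b (m + 1) * (x - a) + frq a b (n + 1) * (x - a) := by unfold frq; ring
    rw [e1, e2, Real.cos_add, Real.cos_sub]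
    have : √(2 / (b - a)) * √(2 / (b - a)) = 2 / (b - a) := Real.mul_self_sqrt (by positivity)
    unfold sinB
    linear_combination (Real.sin (frq a b (m + 1) * (x - a)) *
      Real.sin (frq a b (n + 1) * (x - a))) * this
  simp only [he]
  rw [integral_sub, integral_const_mul, integral_const_mul, h1, h2]
  · have t2 : ¬ (((m + 1 : ℕ) : ℤ) + (n + 1 : ℕ) = 0) := by omega
    rcases eq_or_ne m n with rfl | hmn
    · simp only [t2, if_false, if_true, sub_self]
      field_simp; norm_num
    · have t1 : ¬ (((m + 1 : ℕ) : ℤ) - (n + 1 : ℕ) = 0) := by omega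
      simp only [t1, t2, hmn, if_false]; simp
  · exact Continuous.integrable_Ioo (by fun_prop) _ _
  · exact Continuous.integrable_Ioo (by fun_prop) _ _

theorem Integrable.mul_continuous_Ioo {h g : ℝ → ℝ} {a b : ℝ}
    (hh : Integrable h (volume.restrict (Ioo a b))) (hg : Continuous g) :
    Integrable (fun x => h x * g x) (volume.restrict (Ioo a b)) := by
  obtain ⟨C, hC⟩ := isCompact_Icc.exists_bound_of_continuousOn (s := Icc a b) hg.continuousOn
  refine hh.mul_bdd (c := C) hg.aestronglyMeasurable ?_
  filter_upwards [ae_restrict_mem measurableSet_Ioo] with x hx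
  exact hC x (Ioo_subset_Icc_self hx)

theorem complete_cos {a b : ℝ} (hab : a < b) {h : ℝ → ℝ}
    (hh : Integrable h (volume.restrict (Ioo a b)))
    (h0 : ∀ n : ℕ, ∫ x in Ioo a b, h x * Real.cos (frq a b n * (x - a)) = 0) :
    h =ᵐ[volume.restrict (Ioo a b)] 0 := by
  have hL : 0 < b - a := sub_pos.2 hab
  set w := Real.pi / (b - a) with hw
  have hw0 : 0 < w := by have := Real.pi_pos; positivity
  have hpow : ∀ (k n : ℕ), ∫ x in Ioo a b,
      h x * (Real.cos (w * (x - a)) ^ k * Real.cos (frq a b n * (x - a))) = 0 := by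
    intro k
    induction k with
    | zero => intro n; simpa using h0 n
    | succ k ih =>
      intro n
      rcases n with _ | n
      · have := ih 1
        rw [← this]
        congr 1; ext x
        simp [frq, ← hw]; left; ring
      · have he : ∀ x, h x * (Real.cos (w * (x - a)) ^ (k + 1) *
            Real.cos (frq a b (n + 1) * (x - a)))
            = (1 / 2) * (h x * (Real.cos (w * (x - a)) ^ k *
                Real.cos (frq a b (n + 2) * (x - a))))
              + (1 / 2) * (h x * (Real.cos (w * (x - a)) ^ k *
                Real.cos (frq a b n * (x - a)))) := by
          intro x
          have e1 : frq a b (n + 2) * (x - a) = frq a b (n + 1) * (x - a) + w * (x - a) := by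
            unfold frq; push_cast; ring
          have e2 : frq a b n * (x - a) = frq a b (n + 1) * (x - a) - w * (x - a) := by
            unfold frq; push_cast; ring
          rw [e1, e2, Real.cos_add, Real.cos_sub]; ring
        simp only [he]
        rw [integral_add, integral_const_mul, integral_const_mul, ih, ih]
        · simp
        · exact (Integrable.mul_continuous_Ioo hh (by fun_prop)).const_mul _
        · exact (Integrable.mul_continuous_Ioo hh (by fun_prop)).const_mul _
  have hpoly : ∀ p : Polynomial ℝ, ∫ x in Ioo a b, h x * p.eval (Real.cos (w * (x - a))) = 0 := by
    intro p
    simp only [Polynomial.eval_eq_sum_range, Finset.mul_sum]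
    rw [integral_finsetSum]
    · apply Finset.sum_eq_zero
      intro k _
      have := hpow k 0
      simp only [frq, Nat.cast_zero, zero_mul, Real.cos_zero, mul_one] at this
      have e : ∀ x, h x * (p.coeff k * Real.cos (w * (x - a)) ^ k)
        = p.coeff k * (h x * Real.cos (w * (x - a)) ^ k) := fun x => by ring
      simp only [e]
      rw [integral_const_mul, this, mul_zero]
    · intro k _
      exact Integrable.mul_continuous_Ioo hh (by fun_prop)
  have hcont : ∀ ψ : ℝ → ℝ, Continuous ψ → ∫ x in Ioo a b, h x * ψ x = 0 := by
    intro ψ hψ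
    by_contra hne
    set I := ∫ x in Ioo a b, h x * ψ x
    set N := ∫ x in Ioo a b, |h x|
    have hN : 0 ≤ N := integral_nonneg fun x => abs_nonneg _
    obtain ⟨p, hp⟩ := exists_polynomial_near_of_continuousOn (-1) 1
      (fun y => ψ (a + Real.arccos y / w)) (by fun_prop) (|I| / (N + 1)) (by positivity)
    have hle : |I| ≤ N * (|I| / (N + 1)) := by
      have : I = ∫ x in Ioo a b, h x * (ψ x - p.eval (Real.cos (w * (x - a)))) := by
        have e : ∀ x, h x * (ψ x - p.eval (Real.cos (w * (x - a))))
          = h x * ψ x - h x * p.eval (Real.cos (w * (x - a))) := fun x => mul_sub _ _ _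
        simp only [e]
        rw [integral_sub, hpoly, sub_zero]
        · exact Integrable.mul_continuous_Ioo hh hψ
        · exact Integrable.mul_continuous_Ioo hh (by fun_prop)
      rw [this, ← integral_mul_const]
      refine (abs_integral_le_integral_abs).trans ?_
      rw [← this]
      apply integral_mono_ae
      · exact (Integrable.mul_continuous_Ioo hh (by fun_prop)).abs
      · exact hh.abs.mul_const _
      · filter_upwards [ae_restrict_mem measurableSet_Ioo] with x hx
        rw [abs_mul]
        gcongr
        have := hp (Real.cos (w * (x - a))) ⟨Real.neg_one_le_cos _, Real.cos_le_one _⟩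
        have e : Real.arccos (Real.cos (w * (x - a))) = w * (x - a) := by
          apply Real.arccos_cos
          · have := hx.1; have : 0 < x - a := by linarith
            positivity
          · calc w * (x - a) ≤ w * (b - a) := by gcongr; exact hx.2.le
              _ = Real.pi := by rw [hw]; field_simp
        rw [e, mul_div_cancel_left₀ _ hw0.ne', add_sub_cancel] at this
        rw [abs_sub_comm]; exact this.le
    have hI : 0 < |I| := abs_pos.2 hne
    have : N * (|I| / (N + 1)) < |I| := by
      rw [mul_div_assoc', div_lt_iff₀ (by positivity)]; nlinarith
    linarith
  have := isOpen_Ioo.ae_eq_zero_of_integral_contDiff_smul_eq_zero (μ := volume)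
    (IntegrableOn.locallyIntegrableOn hh) (fun ρ h1 h2 h3 => by
      have := hcont ρ h1.continuous
      rw [setIntegral_eq_integral_of_forall_compl_eq_zero] at this
      · simpa [mul_comm] using this
      · intro x hx
        rw [image_eq_zero_of_notMem_tsupport (fun h' => hx (h3 h')), mul_zero])
  exact (ae_restrict_iff' measurableSet_Ioo).2 this

theorem complete_cosB {a b : ℝ} (hab : a < b) {h : ℝ → ℝ}
    (hh : Integrable h (volume.restrict (Ioo a b)))
    (h0 : ∀ n : ℕ, ∫ x in Ioo a b, h x * cosB a b n x = 0) :
    h =ᵐ[volume.restrict (Ioo a b)] 0 := by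
  have hL : 0 < b - a := sub_pos.2 hab
  apply complete_cos hab hh
  intro n
  have := h0 n
  have e : ∀ x, h x * cosB a b n x = (if n = 0 then √(1 / (b - a)) else √(2 / (b - a))) *
    (h x * Real.cos (frq a b n * (x - a))) := fun x => by unfold cosB; ring
  simp only [e] at this
  rw [integral_const_mul] at this
  refine (mul_eq_zero.1 this).resolve_left ?_
  split_ifs <;> positivity

theorem complete_sinB {a b : ℝ} (hab : a < b) {h : ℝ → ℝ}
    (hh : Integrable h (volume.restrict (Ioo a b)))
    (h0 : ∀ n : ℕ, ∫ x in Ioo a b, h x * sinB a b (n + 1) x = 0) :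
    h =ᵐ[volume.restrict (Ioo a b)] 0 := by
  have hL : 0 < b - a := sub_pos.2 hab
  set w := Real.pi / (b - a) with hw
  have hw0 : 0 < w := by have := Real.pi_pos; positivity
  have h1 : ∀ n : ℕ, ∫ x in Ioo a b, h x * Real.sin (frq a b n * (x - a)) = 0 := by
    intro n
    rcases n with _ | n
    · simp [frq]
    · have := h0 n
      have e : ∀ x, h x * sinB a b (n + 1) x = √(2 / (b - a)) *
        (h x * Real.sin (frq a b (n + 1) * (x - a))) := fun x => by unfold sinB; ring
      simp only [e] at this
      rw [integral_const_mul] at this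
      exact (mul_eq_zero.1 this).resolve_left (by positivity)
  have h2 : (fun x => h x * Real.sin (w * (x - a))) =ᵐ[volume.restrict (Ioo a b)] 0 := by
    apply complete_cos hab (Integrable.mul_continuous_Ioo hh (by fun_prop))
    intro n
    rcases n with _ | n
    · have := h1 1
      simpa [frq, ← hw] using this
    · have he : ∀ x, h x * Real.sin (w * (x - a)) * Real.cos (frq a b (n + 1) * (x - a))
          = (1 / 2) * (h x * Real.sin (frq a b (n + 2) * (x - a)))
            - (1 / 2) * (h x * Real.sin (frq a b n * (x - a))) := by
        intro x
        have e1 : frq a b (n + 2) * (x - a) = frq a b (n + 1) * (x - a) + w * (x - a) := by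
          unfold frq; push_cast; ring
        have e2 : frq a b n * (x - a) = frq a b (n + 1) * (x - a) - w * (x - a) := by
          unfold frq; push_cast; ring
        rw [e1, e2, Real.sin_add, Real.sin_sub]; ring
      simp only [he]
      rw [integral_sub, integral_const_mul, integral_const_mul, h1, h1]
      · simp
      · exact (Integrable.mul_continuous_Ioo hh (by fun_prop)).const_mul _
      · exact (Integrable.mul_continuous_Ioo hh (by fun_prop)).const_mul _
  filter_upwards [h2, ae_restrict_mem measurableSet_Ioo] with x hx hm
  have hs : 0 < Real.sin (w * (x - a)) := by
    apply Real.sin_pos_of_pos_of_lt_pi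
    · have : 0 < x - a := sub_pos.2 hm.1
      positivity
    · calc w * (x - a) < w * (b - a) := by gcongr; exact hm.2
        _ = Real.pi := by rw [hw]; field_simp
  exact (mul_eq_zero.1 hx).resolve_right hs.ne'

theorem MemLp.integrable_two {p : ℝ → ℝ} {a b : ℝ} (hp : MemLp p 2 (volume.restrict (Ioo a b))) :
    Integrable p (volume.restrict (Ioo a b)) := hp.integrable (by norm_num)

theorem parseval_cosB {a b : ℝ} (hab : a < b) {p q : ℝ → ℝ}
    (hp : MemLp p 2 (volume.restrict (Ioo a b))) (hq : MemLp q 2 (volume.restrict (Ioo a b))) :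
    HasSum (fun n => (∫ x in Ioo a b, p x * cosB a b n x) * (∫ x in Ioo a b, q x * cosB a b n x))
      (∫ x in Ioo a b, p x * q x) :=
  hasSum_parseval (fun n => (contDiff_cosB a b n).continuous.memLp_Ioo a b)
    (orthonormal_cosB hab) (fun _ hh h0 => complete_cosB hab (MemLp.integrable_two hh) h0) hp hq

theorem parseval_sinB {a b : ℝ} (hab : a < b) {p q : ℝ → ℝ}
    (hp : MemLp p 2 (volume.restrict (Ioo a b))) (hq : MemLp q 2 (volume.restrict (Ioo a b))) :
    HasSum (fun n => (∫ x in Ioo a b, p x * sinB a b n x) * (∫ x in Ioo a b, q x * sinB a b n x))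
      (∫ x in Ioo a b, p x * q x) := by
  have := hasSum_parseval (fun n => (contDiff_sinB a b (n + 1)).continuous.memLp_Ioo a b)
    (orthonormal_sinB hab) (fun _ hh h0 => complete_sinB hab (MemLp.integrable_two hh) h0) hp hq
  rw [hasSum_nat_add_iff (f := fun n => (∫ x in Ioo a b, p x * sinB a b n x) *
    (∫ x in Ioo a b, q x * sinB a b n x)) 1] at this
  simpa [sinB, frq] using this

/-- A weak identity against compactly supported test functions extends to smooth functions
vanishing at the end points. -/
theorem weak_extend {a b : ℝ} (hab : a < b) {h₁ h₂ s : ℝ → ℝ}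
    (hh₁ : Integrable h₁ (volume.restrict (Ioo a b)))
    (hh₂ : Integrable h₂ (volume.restrict (Ioo a b)))
    (H : ∀ ψ : ℝ → ℝ, ContDiff ℝ (⊤ : ℕ∞) ψ →
      (∃ K : Set ℝ, IsCompact K ∧ K ⊆ Ioo a b ∧ ∀ x ∉ K, ψ x = 0) →
      ∫ x in Ioo a b, h₁ x * deriv ψ x = ∫ x in Ioo a b, h₂ x * ψ x)
    (hs : ContDiff ℝ (⊤ : ℕ∞) s) (hsa : s a = 0) (hsb : s b = 0) :
    ∫ x in Ioo a b, h₁ x * deriv s x = ∫ x in Ioo a b, h₂ x * s x := by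
  have hL : 0 < b - a := sub_pos.2 hab
  set d : ℝ → ℝ := fun x => (x - a) * (b - x) with hd
  set χ : ℝ → ℝ := fun y => Real.smoothTransition (y - 1) with hχ
  have hχs : ContDiff ℝ (⊤ : ℕ∞) χ := Real.smoothTransition.contDiff.comp (by fun_prop)
  have hχ' : Continuous (deriv χ) := hχs.continuous_deriv (by norm_cast)
  have hs' : Continuous (deriv s) := hs.continuous_deriv (by norm_cast)
  obtain ⟨C, hC⟩ := isCompact_Icc.exists_bound_of_continuousOn (s := Icc (0 : ℝ) 2)
    hχ'.continuousOn
  obtain ⟨S, hS⟩ := isCompact_Icc.exists_bound_of_continuousOn (s := Icc a b)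
    hs.continuous.continuousOn
  obtain ⟨S', hS'⟩ := isCompact_Icc.exists_bound_of_continuousOn (s := Icc a b) hs'.continuousOn
  have hC0 : 0 ≤ C := (norm_nonneg _).trans (hC 0 (by simp))
  have hS0 : 0 ≤ S' := (norm_nonneg _).trans (hS' a (by simp [hab.le]))
  have hlip : ∀ x ∈ Icc a b, ∀ y ∈ Icc a b, |s x - s y| ≤ S' * |x - y| := by
    intro x hx y hy
    exact (convex_Icc a b).norm_image_sub_le_of_norm_deriv_le
      (fun z _ => (hs.differentiable (by simp)).differentiableAt) hS' hy hx
  have hsd : ∀ x ∈ Ioo a b, |s x| ≤ 2 * S' / (b - a) * d x := by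
    intro x hx
    have h1 := hlip x (Ioo_subset_Icc_self hx) a (by simp [hab.le])
    have h2 := hlip x (Ioo_subset_Icc_self hx) b (by simp [hab.le])
    rw [hsa, sub_zero, abs_of_pos (sub_pos.2 hx.1)] at h1
    rw [hsb, sub_zero, abs_of_neg (sub_neg.2 hx.2)] at h2
    have p1 : 0 < x - a := sub_pos.2 hx.1
    have p2 : 0 < b - x := sub_pos.2 hx.2
    rw [div_mul_eq_mul_div, le_div_iff₀ hL]
    have q1 := mul_le_mul_of_nonneg_right h1 p2.le
    have q2 := mul_le_mul_of_nonneg_right h2 p1.le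
    simp only [hd]
    nlinarith
  set ψ : ℕ → ℝ → ℝ := fun n x => χ (n * d x) * s x with hψ
  have hψs : ∀ n, ContDiff ℝ (⊤ : ℕ∞) (ψ n) := fun n =>
    (hχs.comp (by fun_prop)).mul hs
  have hdpos : ∀ x ∈ Ioo a b, 0 < d x := fun x hx =>
    mul_pos (sub_pos.2 hx.1) (sub_pos.2 hx.2)
  have hψd : ∀ n x, deriv (ψ n) x
      = deriv χ (n * d x) * (n * ((b - x) - (x - a))) * s x + χ (n * d x) * deriv s x := by
    intro n x
    have hdd : HasDerivAt (fun x => (n : ℝ) * d x) (n * ((b - x) - (x - a))) x := by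
      have := (((hasDerivAt_id x).sub_const a).mul ((hasDerivAt_id x).const_sub b)).const_mul
        (n : ℝ)
      exact this.congr_deriv (by simp only [id]; ring)
    have h1 : HasDerivAt χ (deriv χ (n * d x)) (n * d x) :=
      (hχs.differentiable (by simp)).differentiableAt.hasDerivAt
    have h2 : HasDerivAt s (deriv s x) x :=
      (hs.differentiable (by simp)).differentiableAt.hasDerivAt
    exact ((h1.comp x hdd).mul h2).deriv
  have hχ1 : ∀ y, |χ y| ≤ 1 := fun y => by
    rw [abs_of_nonneg (Real.smoothTransition.nonneg _)]
    exact Real.smoothTransition.le_one _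
  have hχbig : ∀ y, 2 < y → χ y = 1 ∧ deriv χ y = 0 := by
    intro y hy
    refine ⟨Real.smoothTransition.one_of_one_le (by linarith), ?_⟩
    have : χ =ᶠ[nhds y] fun _ => 1 := by
      filter_upwards [lt_mem_nhds hy] with z hz
      exact Real.smoothTransition.one_of_one_le (by linarith)
    rw [this.deriv_eq]; simp
  have hψsupp : ∀ n, ∃ K : Set ℝ, IsCompact K ∧ K ⊆ Ioo a b ∧ ∀ x ∉ K, ψ n x = 0 := by
    intro n
    refine ⟨Icc a b ∩ {x | 1 ≤ n * d x}, ?_, ?_, ?_⟩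
    · exact isCompact_Icc.inter_right (isClosed_le continuous_const (by fun_prop))
    · rintro x ⟨hx, hx'⟩
      have hne : d x ≠ 0 := by
        intro h; simp [h] at hx'; linarith
      have : x - a ≠ 0 ∧ b - x ≠ 0 := by simpa [hd] using hne
      exact ⟨lt_of_le_of_ne hx.1 fun h => this.1 (by simp [h]),
        lt_of_le_of_ne hx.2 fun h => this.2 (by simp [h])⟩
    · intro x hx
      have hlt : n * d x < 1 := by
        by_contra hge
        push Not at hge
        apply hx
        refine ⟨?_, hge⟩
        have hdp : 0 < d x := by
          by_contra h
          have : (n : ℝ) * d x ≤ 0 := mul_nonpos_of_nonneg_of_nonpos (by positivity) (not_lt.1 h)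
          linarith
        by_contra hm
        rw [mem_Icc, not_and_or, not_le, not_le] at hm
        rcases hm with hm | hm
        · have : (x - a) * (b - x) ≤ 0 :=
            mul_nonpos_of_nonpos_of_nonneg (by linarith) (by linarith)
          simp only [hd] at hdp; linarith
        · have : (x - a) * (b - x) ≤ 0 :=
            mul_nonpos_of_nonneg_of_nonpos (by linarith) (by linarith)
          simp only [hd] at hdp; linarith
      simp only [hψ, hχ]
      rw [Real.smoothTransition.zero_of_nonpos (by linarith), zero_mul]
  have hev : ∀ x ∈ Ioo a b, ∀ᶠ n : ℕ in atTop, 2 < n * d x := fun x hx =>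
    (tendsto_natCast_atTop_atTop.atTop_mul_const (hdpos x hx)).eventually_gt_atTop 2
  have hbd : ∀ n, ∀ x ∈ Ioo a b, |deriv (ψ n) x| ≤ C * (2 * (2 * S' / (b - a))) * (b - a) + S' := by
    intro n x hx
    rw [hψd]
    have hsx := hS' x (Ioo_subset_Icc_self hx)
    have hpart : |χ (n * d x) * deriv s x| ≤ S' := by
      rw [abs_mul]
      calc _ ≤ 1 * S' := by
            gcongr
            · exact hχ1 _
            · exact hsx
        _ = S' := one_mul _
    refine (abs_add_le _ _).trans (add_le_add ?_ hpart)
    rcases lt_or_ge 2 ((n : ℝ) * d x) with hlt | hle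
    · rw [(hχbig _ hlt).2]; simp; positivity
    · have hnd : 0 ≤ (n : ℝ) * d x := mul_nonneg (by positivity) (hdpos x hx).le
      have h1 := hC _ ⟨hnd, hle⟩
      have h2 : |(b - x) - (x - a)| ≤ b - a := by
        rw [abs_le]; constructor <;> linarith [hx.1, hx.2]
      have h3 : n * |s x| ≤ 2 * (2 * S' / (b - a)) := by
        calc n * |s x| ≤ n * (2 * S' / (b - a) * d x) := by gcongr; exact hsd x hx
          _ = (n * d x) * (2 * S' / (b - a)) := by ring
          _ ≤ _ := by gcongr
      calc _ = |deriv χ (n * d x)| * (n * |s x|) * |(b - x) - (x - a)| := by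
            rw [abs_mul, abs_mul, abs_mul, Nat.abs_cast]; ring
        _ ≤ _ := by gcongr; exact h1
  have t1 : Tendsto (fun n => ∫ x in Ioo a b, h₁ x * deriv (ψ n) x) atTop
      (nhds (∫ x in Ioo a b, h₁ x * deriv s x)) := by
    apply tendsto_integral_of_dominated_convergence
      (fun x => |h₁ x| * (C * (2 * (2 * S' / (b - a))) * (b - a) + S'))
    · intro n
      exact (Integrable.mul_continuous_Ioo hh₁
        ((hψs n).continuous_deriv (by norm_cast))).aestronglyMeasurable
    · exact hh₁.abs.mul_const _
    · intro n
      filter_upwards [ae_restrict_mem measurableSet_Ioo] with x hx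
      rw [Real.norm_eq_abs, abs_mul]
      gcongr
      exact hbd n x hx
    · filter_upwards [ae_restrict_mem measurableSet_Ioo] with x hx
      apply tendsto_const_nhds.congr'
      filter_upwards [hev x hx] with n hn
      rw [hψd, (hχbig _ hn).1, (hχbig _ hn).2]; simp
  have t2 : Tendsto (fun n => ∫ x in Ioo a b, h₂ x * ψ n x) atTop
      (nhds (∫ x in Ioo a b, h₂ x * s x)) := by
    apply tendsto_integral_of_dominated_convergence (fun x => |h₂ x| * (1 * S))
    · intro n
      exact (Integrable.mul_continuous_Ioo hh₂ (hψs n).continuous).aestronglyMeasurable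
    · exact hh₂.abs.mul_const _
    · intro n
      filter_upwards [ae_restrict_mem measurableSet_Ioo] with x hx
      rw [Real.norm_eq_abs, abs_mul]
      simp only [hψ, abs_mul]
      gcongr
      · exact hχ1 _
      · exact hS x (Ioo_subset_Icc_self hx)
    · filter_upwards [ae_restrict_mem measurableSet_Ioo] with x hx
      apply tendsto_const_nhds.congr'
      filter_upwards [hev x hx] with n hn
      simp only [hψ, (hχbig _ hn).1, one_mul]
  exact tendsto_nhds_unique (t1.congr fun n => H _ (hψs n) (hψsupp n)) t2

theorem cauchySchwarz_abs {μ : Measure ℝ} {p q : ℝ → ℝ} (hp : MemLp p 2 μ) (hq : MemLp q 2 μ) :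
    ∫ x, |p x| * |q x| ∂μ ≤ √(∫ x, p x ^ 2 ∂μ) * √(∫ x, q x ^ 2 ∂μ) := by
  have := integral_mul_norm_le_Lp_mul_Lq (μ := μ) (f := p) (g := q) Real.HolderConjugate.two_two
    (by simpa using hp) (by simpa using hq)
  simpa [Real.sqrt_eq_rpow] using this

theorem cauchySchwarz {μ : Measure ℝ} {p q : ℝ → ℝ} (hp : MemLp p 2 μ) (hq : MemLp q 2 μ) :
    |∫ x, p x * q x ∂μ| ≤ √(∫ x, p x ^ 2 ∂μ) * √(∫ x, q x ^ 2 ∂μ) := by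
  refine abs_integral_le_integral_abs.trans ?_
  simp only [abs_mul]
  exact cauchySchwarz_abs hp hq

theorem MemLp.integrable_mul_two {μ : Measure ℝ} {p q : ℝ → ℝ} (hp : MemLp p 2 μ)
    (hq : MemLp q 2 μ) : Integrable (fun x => p x * q x) μ :=
  MemLp.integrable_mul hp hq

theorem weakDerivI_sinB {a b : ℝ} (hab : a < b) {z zx : ℝ → ℝ}
    (hz : Integrable z (volume.restrict (Ioo a b)))
    (hzx : Integrable zx (volume.restrict (Ioo a b))) (h : WeakDerivI a b z zx) (n : ℕ) :
    frq a b n * ∫ x in Ioo a b, z x * cosB a b n x = - ∫ x in Ioo a b, zx x * sinB a b n x := by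
  have := weak_extend hab hz hzx.neg (s := sinB a b n) (fun ψ hψ ⟨K, hK, hKs, hK0⟩ => by
    rw [h ψ hψ ?_]
    · simp only [Pi.neg_apply, neg_mul, integral_neg]
    · refine (closure_minimal ?_ hK.isClosed).trans hKs
      intro x hx
      by_contra hxK
      exact hx (hK0 x hxK)) (contDiff_sinB a b n) (sinB_left a b n) (sinB_right hab n)
  simp only [Pi.neg_apply, neg_mul, integral_neg] at this
  rw [← this, ← integral_const_mul]
  congr 1; ext x; rw [deriv_sinB]; ring

theorem weakDerivI_primitive {a b : ℝ} (hab : a < b) {z zx : ℝ → ℝ}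
    (hz : Integrable z (volume.restrict (Ioo a b)))
    (hzx : Integrable zx (volume.restrict (Ioo a b))) (h : WeakDerivI a b z zx) :
    ∃ c, z =ᵐ[volume.restrict (Ioo a b)] fun x => c + ∫ y in a..x, zx y := by
  have hL : 0 < b - a := sub_pos.2 hab
  have hi : IntervalIntegrable zx volume a b := intervalIntegrable_of_Ioo hab.le hzx
  set Z : ℝ → ℝ := fun x => ∫ y in a..x, zx y with hZ
  have hZc : ContinuousOn Z (Icc a b) := by
    have := intervalIntegral.continuousOn_primitive_interval' hi (a := a) (by simp)
    rwa [uIcc_of_le hab.le] at this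
  have hZi : Integrable Z (volume.restrict (Ioo a b)) :=
    hZc.integrableOn_Icc.mono_set Ioo_subset_Icc_self
  set A := ∫ x in Ioo a b, (z x - Z x) * cosB a b 0 x with hA
  have hcos : ∀ n, Continuous (cosB a b n) := fun n => (contDiff_cosB a b n).continuous
  have hzZ : Integrable (fun x => z x - Z x) (volume.restrict (Ioo a b)) := hz.sub hZi
  have hI : Integrable (fun x => z x - Z x - A * cosB a b 0 x) (volume.restrict (Ioo a b)) :=
    hzZ.sub (((hcos 0).integrable_Ioo a b).const_mul A)
  have hcoef : ∀ n, ∫ x in Ioo a b, (z x - Z x - A * cosB a b 0 x) * cosB a b n x = 0 := by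
    intro n
    have e : ∀ x, (z x - Z x - A * cosB a b 0 x) * cosB a b n x
        = (z x - Z x) * cosB a b n x - A * (cosB a b 0 x * cosB a b n x) := fun x => by ring
    have hcc : Integrable (fun x => cosB a b 0 x * cosB a b n x) (volume.restrict (Ioo a b)) :=
      ((hcos 0).mul (hcos n)).integrable_Ioo a b
    simp only [e]
    rw [integral_sub (Integrable.mul_continuous_Ioo hzZ (hcos n)) (hcc.const_mul A),
      integral_const_mul, orthonormal_cosB hab]
    rcases eq_or_ne n 0 with rfl | hn
    · simp [hA]
    · simp only [hn.symm, if_false, mul_zero, sub_zero]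
      have h1 := weakDerivI_sinB hab hz hzx h n
      have h2 : ∫ x in Ioo a b, zx x * sinB a b n x
          = - (frq a b n * ∫ x in Ioo a b, Z x * cosB a b n x) := by
        rw [integral_Ioo_eq hab.le, primitive_ibp hi ((contDiff_sinB a b n).of_le (by norm_cast)),
          sinB_right hab, ← integral_const_mul, integral_Ioo_eq hab.le]
        simp only [deriv_sinB, mul_zero, zero_sub]
        congr 2; ext x; ring
      simp only [sub_mul]
      rw [integral_sub (Integrable.mul_continuous_Ioo hz (hcos n))
        (Integrable.mul_continuous_Ioo hZi (hcos n))]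
      have hw : frq a b n ≠ 0 := by
        unfold frq
        have := Real.pi_pos
        have : (n : ℝ) ≠ 0 := by exact_mod_cast hn
        positivity
      apply mul_left_cancel₀ hw
      linarith
  have := complete_cosB hab hI hcoef
  refine ⟨A * √(1 / (b - a)), ?_⟩
  filter_upwards [this] with x hx
  have e : cosB a b 0 x = √(1 / (b - a)) := by simp [cosB, frq]
  simp only [Pi.zero_apply, e] at hx
  linarith

/-- Gagliardo–Nirenberg interpolation on an interval. -/
theorem sq_le_of_weakDerivI {a b : ℝ} (hab : a < b) {z zx : ℝ → ℝ}
    (hz : MemLp z 2 (volume.restrict (Ioo a b))) (hzx : MemLp zx 2 (volume.restrict (Ioo a b)))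
    (h : WeakDerivI a b z zx) :
    ∀ᵐ x ∂volume.restrict (Ioo a b), z x ^ 2 ≤ (∫ y in Ioo a b, z y ^ 2) / (b - a)
      + 2 * (√(∫ y in Ioo a b, z y ^ 2) * √(∫ y in Ioo a b, zx y ^ 2)) := by
  have hL : 0 < b - a := sub_pos.2 hab
  have hzx1 := MemLp.integrable_two hzx
  obtain ⟨c, hc⟩ := weakDerivI_primitive hab (MemLp.integrable_two hz) hzx1 h
  have hi : IntervalIntegrable zx volume a b := intervalIntegrable_of_Ioo hab.le hzx1
  set G : ℝ → ℝ := fun x => c + ∫ y in a..x, zx y with hG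
  set P := √(∫ y in Ioo a b, z y ^ 2) * √(∫ y in Ioo a b, zx y ^ 2) with hP
  have hGzx : ∫ y in Ioo a b, |G y * zx y| ≤ P := by
    have : ∫ y in Ioo a b, |G y * zx y| = ∫ y in Ioo a b, |z y| * |zx y| := by
      apply integral_congr_ae
      filter_upwards [hc] with y hy
      rw [← hy, abs_mul]
    rw [this]
    exact cauchySchwarz_abs hz hzx
  have hGi : IntegrableOn (fun y => G y * zx y) (Ioo a b) := by
    refine (MemLp.integrable_mul_two hz hzx).congr ?_
    filter_upwards [hc] with y hy
    rw [← hy]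
  have hGint : IntervalIntegrable (fun y => G y * zx y) volume a b :=
    intervalIntegrable_of_Ioo hab.le hGi
  have hpt : ∀ x ∈ Ioo a b, ∀ y ∈ Ioo a b, G x ^ 2 ≤ G y ^ 2 + 2 * P := by
    intro x hx y hy
    have hx' : x ∈ uIcc a b := by rw [uIcc_of_le hab.le]; exact Ioo_subset_Icc_self hx
    have hy' : y ∈ uIcc a b := by rw [uIcc_of_le hab.le]; exact Ioo_subset_Icc_self hy
    have e1 : G x ^ 2 = _ := sq_primitive (c := c) hi hx'
    have e2 : G y ^ 2 = _ := sq_primitive (c := c) hi hy'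
    have e3 : (∫ s in a..x, G s * zx s) - ∫ s in a..y, G s * zx s = ∫ s in y..x, G s * zx s :=
      intervalIntegral.integral_interval_sub_left (hGint.mono_set (uIcc_subset_uIcc_left hx'))
        (hGint.mono_set (uIcc_subset_uIcc_left hy'))
    have e4 : |∫ s in y..x, G s * zx s| ≤ P := by
      refine (intervalIntegral.norm_integral_le_integral_norm_uIoc (f := fun s => G s * zx s)
        (a := y) (b := x) (μ := volume)).trans (le_trans ?_ hGzx)
      apply setIntegral_mono_set hGi.abs
      · exact Eventually.of_forall fun s => abs_nonneg _
      · apply LE.le.eventuallyLE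
        intro s hs
        rw [uIoc, mem_Ioc] at hs
        exact ⟨lt_of_lt_of_le' hs.1 (le_min hy.1.le hx.1.le), hs.2.trans_lt (max_lt hy.2 hx.2)⟩
    have := (abs_le.1 e4).2
    rw [e1, e2]
    simp only [hG] at e3 this
    linarith
  filter_upwards [hc, ae_restrict_mem measurableSet_Ioo] with x hx hm
  rw [hx]
  have hzsq : Integrable (fun y => z y ^ 2) (volume.restrict (Ioo a b)) := hz.integrable_sq
  have hvol : (volume.restrict (Ioo a b)).real univ = b - a := by
    simp [measureReal_def, hL.le]
  have hint : ∫ y in Ioo a b, G x ^ 2 ≤ ∫ y in Ioo a b, (z y ^ 2 + 2 * P) := by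
    apply integral_mono_ae (integrable_const _) (hzsq.add (integrable_const _))
    filter_upwards [hc, ae_restrict_mem measurableSet_Ioo] with y hy hym
    change G x ^ 2 ≤ z y ^ 2 + 2 * P
    rw [hy]
    exact hpt x hm y hym
  rw [integral_add hzsq (integrable_const _), integral_const, integral_const, hvol, smul_eq_mul,
    smul_eq_mul] at hint
  have : G x ^ 2 = ((b - a) * G x ^ 2) / (b - a) := by field_simp
  change G x ^ 2 ≤ _
  rw [this, div_add' _ _ _ hL.ne']
  gcongr
  linarith

theorem frq_nonneg {a b : ℝ} (hab : a < b) (n : ℕ) : 0 ≤ frq a b n := by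
  have := Real.pi_pos
  have : 0 < b - a := sub_pos.2 hab
  unfold frq; positivity

theorem summable_inv_one_add_frq {a b : ℝ} (hab : a < b) :
    Summable fun n : ℕ => ((1 + frq a b n)⁻¹) ^ 2 := by
  have hL : 0 < b - a := sub_pos.2 hab
  set c := Real.pi / (b - a) with hc
  have hc0 : 0 < c := div_pos Real.pi_pos hL
  have h0 : Summable fun n : ℕ => 1 / ((n : ℝ) ^ 2) := Real.summable_one_div_nat_pow.2 one_lt_two
  rw [← summable_nat_add_iff 1] at h0 ⊢
  refine (h0.mul_left ((c⁻¹) ^ 2)).of_nonneg_of_le (fun n => sq_nonneg _) fun n => ?_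
  have hn : (0 : ℝ) < ((n + 1 : ℕ) : ℝ) := by positivity
  rw [one_div, ← inv_pow, ← mul_pow, ← mul_inv]
  have : c * ((n + 1 : ℕ) : ℝ) ≤ 1 + frq a b (n + 1) := by
    unfold frq; rw [mul_comm]; linarith
  have := inv_anti₀ (by positivity) this
  have : 0 ≤ (1 + frq a b (n + 1))⁻¹ := by have := frq_nonneg hab (n + 1); positivity
  gcongr

theorem sum_sq_cosB_le {a b : ℝ} (hab : a < b) {z : ℝ → ℝ}
    (hz : MemLp z 2 (volume.restrict (Ioo a b))) (s : Finset ℕ) :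
    ∑ n ∈ s, (∫ x in Ioo a b, z x * cosB a b n x) ^ 2 ≤ ∫ x in Ioo a b, z x ^ 2 := by
  have := parseval_cosB hab hz hz
  simp only [← pow_two] at this
  exact sum_le_hasSum _ (fun _ _ => sq_nonneg _) this

theorem sum_sq_sinB_le {a b : ℝ} (hab : a < b) {z : ℝ → ℝ}
    (hz : MemLp z 2 (volume.restrict (Ioo a b))) (s : Finset ℕ) :
    ∑ n ∈ s, (∫ x in Ioo a b, z x * sinB a b n x) ^ 2 ≤ ∫ x in Ioo a b, z x ^ 2 := by
  have := parseval_sinB hab hz hz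
  simp only [← pow_two] at this
  exact sum_le_hasSum _ (fun _ _ => sq_nonneg _) this

/-- The `ℓ²` norm of the weights `(1 + ω_n)⁻¹`. -/
def wgt (a b : ℝ) : ℝ := √(∑' n : ℕ, ((1 + frq a b n)⁻¹) ^ 2)

theorem sum_abs_cosB_le {a b : ℝ} (hab : a < b) {z zx : ℝ → ℝ}
    (hz : MemLp z 2 (volume.restrict (Ioo a b))) (hzx : MemLp zx 2 (volume.restrict (Ioo a b)))
    (h : WeakDerivI a b z zx) (s : Finset ℕ) :
    ∑ n ∈ s, |∫ x in Ioo a b, z x * cosB a b n x| ≤ wgt a b *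
      (√(∫ x in Ioo a b, z x ^ 2) + √(∫ x in Ioo a b, zx x ^ 2)) := by
  have key : ∀ c : ℕ → ℝ, ∀ E, ∑ n ∈ s, c n ^ 2 ≤ E →
      ∑ n ∈ s, (1 + frq a b n)⁻¹ * |c n| ≤ wgt a b * √E := by
    intro c E hE
    refine (Real.sum_mul_le_sqrt_mul_sqrt s _ _).trans ?_
    simp only [sq_abs]
    unfold wgt
    gcongr
    exact (summable_inv_one_add_frq hab).sum_le_tsum _ (fun _ _ => sq_nonneg _)
  rw [mul_add]
  refine le_trans (le_of_eq ?_) (add_le_add (key _ _ (sum_sq_cosB_le hab hz s))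
    (key _ _ (sum_sq_sinB_le hab hzx s)))
  rw [← Finset.sum_add_distrib]
  refine Finset.sum_congr rfl fun n _ => ?_
  have := frq_nonneg hab n
  have e := congrArg abs (weakDerivI_sinB hab (MemLp.integrable_two hz)
    (MemLp.integrable_two hzx) h n)
  rw [abs_neg, abs_mul, abs_of_nonneg this] at e
  rw [← e, ← mul_add]
  field_simp

theorem summable_abs_cosB {a b : ℝ} (hab : a < b) {z zx : ℝ → ℝ}
    (hz : MemLp z 2 (volume.restrict (Ioo a b))) (hzx : MemLp zx 2 (volume.restrict (Ioo a b)))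
    (h : WeakDerivI a b z zx) : Summable fun n => |∫ x in Ioo a b, z x * cosB a b n x| :=
  summable_of_sum_le (fun _ => abs_nonneg _) (sum_abs_cosB_le hab hz hzx h)

theorem hasSum_integral_cosB {a b : ℝ} (hab : a < b) {c : ℕ → ℝ} (hc : Summable fun n => |c n|)
    {G : ℝ → ℝ} (hG : Integrable G (volume.restrict (Ioo a b))) :
    HasSum (fun n => (∫ x in Ioo a b, G x * cosB a b n x) * c n)
      (∫ x in Ioo a b, G x * ∑' n, c n * cosB a b n x) := by
  have hcos : ∀ n, Continuous (cosB a b n) := fun n => (contDiff_cosB a b n).continuous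
  have hi : ∀ n, Integrable (fun x => G x * (c n * cosB a b n x)) (volume.restrict (Ioo a b)) :=
    fun n => Integrable.mul_continuous_Ioo hG (continuous_const.mul (hcos n))
  have := hasSum_integral_of_summable_integral_norm hi ?_
  · simp only [tsum_mul_left] at this
    have e : ∀ n, (∫ x in Ioo a b, G x * cosB a b n x) * c n
        = ∫ x in Ioo a b, G x * (c n * cosB a b n x) := fun n => by
      rw [← integral_mul_const]
      congr 1; ext x; ring
    simp only [e]
    exact this
  · refine (hc.mul_left (√(2 / (b - a)) * ∫ x in Ioo a b, |G x|)).of_nonneg_of_le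
      (fun n => integral_nonneg fun x => norm_nonneg _) fun n => ?_
    rw [mul_right_comm, mul_comm, ← integral_mul_const]
    apply integral_mono (hi n).norm (hG.abs.mul_const _)
    intro x
    simp only [Real.norm_eq_abs, abs_mul]
    have := abs_cosB_le hab n x
    rw [mul_comm (√_)]
    gcongr

/-- Parseval's identity for an integrable function against a `W^{1,2}` function. -/
theorem hasSum_cosB_of_weakDerivI {a b : ℝ} (hab : a < b) {z zx : ℝ → ℝ}
    (hz : MemLp z 2 (volume.restrict (Ioo a b))) (hzx : MemLp zx 2 (volume.restrict (Ioo a b)))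
    (h : WeakDerivI a b z zx) {G : ℝ → ℝ} (hG : Integrable G (volume.restrict (Ioo a b))) :
    HasSum (fun n => (∫ x in Ioo a b, G x * cosB a b n x) * ∫ x in Ioo a b, z x * cosB a b n x)
      (∫ x in Ioo a b, G x * z x) := by
  have hcos : ∀ n, Continuous (cosB a b n) := fun n => (contDiff_cosB a b n).continuous
  have hs := summable_abs_cosB hab hz hzx h
  set c : ℕ → ℝ := fun n => ∫ x in Ioo a b, z x * cosB a b n x with hc
  set Z : ℝ → ℝ := fun x => ∑' n, c n * cosB a b n x with hZ
  have hZc : Continuous Z := by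
    refine continuous_tsum (fun n => continuous_const.mul (hcos n))
      (hs.mul_right (√(2 / (b - a)))) fun n x => ?_
    rw [Real.norm_eq_abs, abs_mul]
    gcongr
    exact abs_cosB_le hab n x
  have hzi := MemLp.integrable_two hz
  have hZi := hZc.integrable_Ioo a b
  have hzZ : z =ᵐ[volume.restrict (Ioo a b)] Z := by
    have : (fun x => z x - Z x) =ᵐ[volume.restrict (Ioo a b)] 0 := by
      refine complete_cosB hab (hzi.sub hZi) fun m => ?_
      have h1 := hasSum_integral_cosB hab hs ((hcos m).integrable_Ioo a b)
      have h2 : HasSum (fun n => (∫ x in Ioo a b, cosB a b m x * cosB a b n x) * c n) (c m) := by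
        simp only [orthonormal_cosB hab]
        convert hasSum_ite_eq m (c m) using 2 with n
        by_cases hmn : m = n <;> simp [hmn, eq_comm]
      have h3 := h1.unique h2
      simp only [sub_mul]
      rw [integral_sub (Integrable.mul_continuous_Ioo hzi (hcos m))
        (Integrable.mul_continuous_Ioo hZi (hcos m)), sub_eq_zero]
      change c m = _
      rw [← h3]
      congr 1; ext x; ring
    filter_upwards [this] with x hx
    simpa [sub_eq_zero] using hx
  convert hasSum_integral_cosB hab hs hG using 1
  apply integral_congr_ae
  filter_upwards [hzZ] with x hx
  rw [hx]

theorem abs_sum_cosB_le {a b : ℝ} (hab : a < b) {z zx : ℝ → ℝ}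
    (hz : MemLp z 2 (volume.restrict (Ioo a b))) (hzx : MemLp zx 2 (volume.restrict (Ioo a b)))
    (h : WeakDerivI a b z zx) {G : ℝ → ℝ} (hG : Integrable G (volume.restrict (Ioo a b)))
    (s : Finset ℕ) :
    |∑ n ∈ s, (∫ x in Ioo a b, G x * cosB a b n x) * ∫ x in Ioo a b, z x * cosB a b n x|
      ≤ √(2 / (b - a)) * wgt a b * (∫ x in Ioo a b, |G x|) *
      (√(∫ x in Ioo a b, z x ^ 2) + √(∫ x in Ioo a b, zx x ^ 2)) := by
  have hcos : ∀ n, Continuous (cosB a b n) := fun n => (contDiff_cosB a b n).continuous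
  have hGn : ∀ n, |∫ x in Ioo a b, G x * cosB a b n x|
      ≤ √(2 / (b - a)) * ∫ x in Ioo a b, |G x| := by
    intro n
    refine abs_integral_le_integral_abs.trans ?_
    rw [← integral_const_mul]
    apply integral_mono (Integrable.mul_continuous_Ioo hG (hcos n)).abs (hG.abs.const_mul _)
    intro x
    simp only [abs_mul]
    rw [mul_comm]
    gcongr
    exact abs_cosB_le hab n x
  calc _ ≤ ∑ n ∈ s, (√(2 / (b - a)) * ∫ x in Ioo a b, |G x|) *
        |∫ x in Ioo a b, z x * cosB a b n x| := by
        refine (Finset.abs_sum_le_sum_abs _ _).trans (Finset.sum_le_sum fun n _ => ?_)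
        rw [abs_mul]
        gcongr
        exact hGn n
    _ ≤ _ := by
        rw [← Finset.mul_sum]
        have := sum_abs_cosB_le hab hz hzx h s
        have h0 : 0 ≤ √(2 / (b - a)) * ∫ x in Ioo a b, |G x| := by positivity
        calc _ ≤ _ := mul_le_mul_of_nonneg_left this h0
          _ = _ := by ring

theorem restrict_prod_Ioo (a b T : ℝ) : (volume : Measure (ℝ × ℝ)).restrict (Ioo a b ×ˢ Ioo 0 T)
    = (volume.restrict (Ioo a b)).prod (volume.restrict (Ioo 0 T)) := by
  rw [Measure.prod_restrict, Measure.volume_eq_prod]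

/-- Time slices of an almost everywhere property on the space-time cylinder. -/
theorem ae_time_of_ae {a b T : ℝ} {P : ℝ → ℝ → Prop}
    (h : ∀ᵐ p : ℝ × ℝ ∂volume.restrict (Ioo a b ×ˢ Ioo 0 T), P p.1 p.2) :
    ∀ᵐ t ∂volume.restrict (Ioo 0 T), ∀ᵐ x ∂volume.restrict (Ioo a b), P x t := by
  rw [restrict_prod_Ioo] at h
  have := Measure.measurePreserving_swap (μ := volume.restrict (Ioo 0 T))
    (ν := volume.restrict (Ioo a b)) |>.quasiMeasurePreserving.ae h
  exact Measure.ae_ae_of_ae_prod this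

theorem aesm_time {a b T : ℝ} {h : ℝ → ℝ → ℝ}
    (hh : AEStronglyMeasurable (fun p : ℝ × ℝ => h p.1 p.2)
      (volume.restrict (Ioo a b ×ˢ Ioo 0 T))) :
    ∀ᵐ t ∂volume.restrict (Ioo 0 T),
      AEStronglyMeasurable (fun x => h x t) (volume.restrict (Ioo a b)) := by
  rw [restrict_prod_Ioo] at hh
  exact hh.prod_swap.prodMk_left

theorem aesm_time_integral {a b T : ℝ} {h : ℝ → ℝ → ℝ}
    (hh : AEStronglyMeasurable (fun p : ℝ × ℝ => h p.1 p.2)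
      (volume.restrict (Ioo a b ×ˢ Ioo 0 T))) :
    AEStronglyMeasurable (fun t => ∫ x in Ioo a b, h x t) (volume.restrict (Ioo 0 T)) := by
  rw [restrict_prod_Ioo] at hh
  exact hh.prod_swap.integral_prod_right'

theorem integrable_time_slice {a b T : ℝ} {h : ℝ → ℝ → ℝ}
    (hh : IntegrableOn (fun p : ℝ × ℝ => h p.1 p.2) (Ioo a b ×ˢ Ioo 0 T)) :
    ∀ᵐ t ∂volume.restrict (Ioo 0 T),
      Integrable (fun x => h x t) (volume.restrict (Ioo a b)) := by
  rw [IntegrableOn, restrict_prod_Ioo] at hh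
  exact hh.prod_left_ae

theorem integrable_time_integral {a b T : ℝ} {h : ℝ → ℝ → ℝ}
    (hh : IntegrableOn (fun p : ℝ × ℝ => h p.1 p.2) (Ioo a b ×ˢ Ioo 0 T)) :
    IntegrableOn (fun t => ∫ x in Ioo a b, h x t) (Ioo 0 T) := by
  rw [IntegrableOn, restrict_prod_Ioo] at hh
  exact hh.integral_prod_right

theorem integrable_space_integral {a b T : ℝ} {h : ℝ → ℝ → ℝ}
    (hh : IntegrableOn (fun p : ℝ × ℝ => h p.1 p.2) (Ioo a b ×ˢ Ioo 0 T)) :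
    Integrable (fun x => ∫ t in Ioo 0 T, h x t) (volume.restrict (Ioo a b)) := by
  rw [IntegrableOn, restrict_prod_Ioo] at hh
  exact hh.integral_prod_left

theorem integrable_mul_tensor {a b T : ℝ} {h : ℝ → ℝ → ℝ} {ψ η : ℝ → ℝ}
    (hh : IntegrableOn (fun p : ℝ × ℝ => h p.1 p.2) (Ioo a b ×ˢ Ioo 0 T))
    (hψ : Continuous ψ) (hη : Continuous η) :
    IntegrableOn (fun p : ℝ × ℝ => h p.1 p.2 * (ψ p.1 * η p.2)) (Ioo a b ×ˢ Ioo 0 T) := by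
  have hc : Continuous fun p : ℝ × ℝ => ψ p.1 * η p.2 := by fun_prop
  obtain ⟨C, hC⟩ := (isCompact_Icc.prod isCompact_Icc).exists_bound_of_continuousOn
    (s := Icc a b ×ˢ Icc 0 T) hc.continuousOn
  refine Integrable.mul_bdd (c := C) hh hc.aestronglyMeasurable ?_
  filter_upwards [ae_restrict_mem (measurableSet_Ioo.prod measurableSet_Ioo)] with p hp
  exact hC p ⟨Ioo_subset_Icc_self hp.1, Ioo_subset_Icc_self hp.2⟩

/-- Pairing of a space-time function with a tensor product. -/
def tpair (a b T : ℝ) (h : ℝ → ℝ → ℝ) (ψ η : ℝ → ℝ) : ℝ :=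
  ∫ p in Ioo a b ×ˢ Ioo 0 T, h p.1 p.2 * (ψ p.1 * η p.2)

/-- Pairing of the time slices with a spatial function. -/
def md (a b : ℝ) (s : ℝ → ℝ) (h : ℝ → ℝ → ℝ) (t : ℝ) : ℝ := ∫ x in Ioo a b, h x t * s x

section
variable {a b T : ℝ} {h h' : ℝ → ℝ → ℝ} {ψ η : ℝ → ℝ}

theorem tpair_sub (hh : IntegrableOn (fun p : ℝ × ℝ => h p.1 p.2) (Ioo a b ×ˢ Ioo 0 T))
    (hh' : IntegrableOn (fun p : ℝ × ℝ => h' p.1 p.2) (Ioo a b ×ˢ Ioo 0 T))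
    (hψ : Continuous ψ) (hη : Continuous η) :
    tpair a b T (fun x t => h x t - h' x t) ψ η = tpair a b T h ψ η - tpair a b T h' ψ η := by
  unfold tpair
  rw [← integral_sub (integrable_mul_tensor hh hψ hη) (integrable_mul_tensor hh' hψ hη)]
  simp only [sub_mul]

theorem tpair_eq_time (hh : IntegrableOn (fun p : ℝ × ℝ => h p.1 p.2) (Ioo a b ×ˢ Ioo 0 T))
    (hψ : Continuous ψ) (hη : Continuous η) :
    tpair a b T h ψ η = ∫ t in Ioo 0 T, md a b ψ h t * η t := by
  have := integrable_mul_tensor hh hψ hη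
  rw [IntegrableOn, restrict_prod_Ioo] at this
  unfold tpair md
  rw [restrict_prod_Ioo, integral_prod_symm _ this]
  congr 1; ext t
  rw [← integral_mul_const]
  simp only [mul_assoc]

theorem tpair_eq_space (hh : IntegrableOn (fun p : ℝ × ℝ => h p.1 p.2) (Ioo a b ×ˢ Ioo 0 T))
    (hψ : Continuous ψ) (hη : Continuous η) :
    tpair a b T h ψ η = ∫ x in Ioo a b, (∫ t in Ioo 0 T, h x t * η t) * ψ x := by
  have := integrable_mul_tensor hh hψ hη
  rw [IntegrableOn, restrict_prod_Ioo] at this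
  unfold tpair
  rw [restrict_prod_Ioo, integral_prod _ this]
  congr 1; ext t
  rw [← integral_mul_const]
  congr 1; ext x
  ring

theorem integrableOn_md (hh : IntegrableOn (fun p : ℝ × ℝ => h p.1 p.2) (Ioo a b ×ˢ Ioo 0 T))
    (hψ : Continuous ψ) : IntegrableOn (md a b ψ h) (Ioo 0 T) := by
  refine integrable_time_integral (h := fun x t => h x t * ψ x) ?_
  simpa using integrable_mul_tensor hh hψ (continuous_const (y := (1 : ℝ)))

theorem integrable_space_mul
    (hh : IntegrableOn (fun p : ℝ × ℝ => h p.1 p.2) (Ioo a b ×ˢ Ioo 0 T)) (hη : Continuous η) :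
    Integrable (fun x => ∫ t in Ioo 0 T, h x t * η t) (volume.restrict (Ioo a b)) := by
  refine integrable_space_integral (h := fun x t => h x t * η t) ?_
  simpa using integrable_mul_tensor hh (continuous_const (y := (1 : ℝ))) hη

end

section
variable {a b : ℝ} {J : Set ℝ} {w w' : ℝ → ℝ → ℝ}

theorem MemL2.memLp {g : ℝ → ℝ} (hg : MemL2 a b g) : MemLp g 2 (volume.restrict (Ioo a b)) :=
  (memLp_two_iff_integrable_sq hg.1).2 hg.2

theorem memL2_of_memLp {g : ℝ → ℝ} (hg : MemLp g 2 (volume.restrict (Ioo a b))) : MemL2 a b g :=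
  ⟨hg.1, hg.integrable_sq⟩

theorem ContL2.sub (hw : ContL2 a b J w) (hw' : ContL2 a b J w') :
    ContL2 a b J fun x t => w x t - w' x t := by
  refine ⟨fun t ht => memL2_of_memLp ((hw.1 t ht).memLp.sub (hw'.1 t ht).memLp), fun t₀ h₀ => ?_⟩
  have := ((hw.2 t₀ h₀).const_mul 2).add ((hw'.2 t₀ h₀).const_mul 2)
  simp only [mul_zero, add_zero] at this
  refine tendsto_of_tendsto_of_tendsto_of_le_of_le' tendsto_const_nhds this
    (Eventually.of_forall fun t => integral_nonneg fun x => sq_nonneg _) ?_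
  filter_upwards [self_mem_nhdsWithin] with t ht
  have i1 : Integrable (fun x => (w x t - w x t₀) ^ 2) (volume.restrict (Ioo a b)) :=
    ((hw.1 t ht).memLp.sub (hw.1 t₀ h₀).memLp).integrable_sq
  have i2 : Integrable (fun x => (w' x t - w' x t₀) ^ 2) (volume.restrict (Ioo a b)) :=
    ((hw'.1 t ht).memLp.sub (hw'.1 t₀ h₀).memLp).integrable_sq
  rw [← integral_const_mul, ← integral_const_mul, ← integral_add (i1.const_mul _) (i2.const_mul _)]
  refine integral_mono_of_nonneg (Eventually.of_forall fun x => sq_nonneg _)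
    ((i1.const_mul _).add (i2.const_mul _)) (Eventually.of_forall fun x => ?_)
  nlinarith [sq_nonneg ((w x t - w x t₀) + (w' x t - w' x t₀))]

theorem ContL2.continuousOn_md (hw : ContL2 a b J w) {s : ℝ → ℝ}
    (hs : MemLp s 2 (volume.restrict (Ioo a b))) : ContinuousOn (md a b s w) J := by
  intro t₀ h₀
  rw [ContinuousWithinAt, tendsto_iff_dist_tendsto_zero]
  have := ((Real.continuous_sqrt.tendsto 0).comp (hw.2 t₀ h₀)).mul_const
    (√(∫ x in Ioo a b, s x ^ 2))
  simp only [Real.sqrt_zero, zero_mul] at this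
  refine tendsto_of_tendsto_of_tendsto_of_le_of_le' tendsto_const_nhds this
    (Eventually.of_forall fun t => dist_nonneg) ?_
  filter_upwards [self_mem_nhdsWithin] with t ht
  rw [Real.dist_eq]
  unfold md
  rw [← integral_sub (MemLp.integrable_mul_two (hw.1 t ht).memLp hs)
    (MemLp.integrable_mul_two (hw.1 t₀ h₀).memLp hs)]
  simp only [← sub_mul]
  exact cauchySchwarz ((hw.1 t ht).memLp.sub (hw.1 t₀ h₀).memLp) hs

theorem ContL2.continuousOn_sq (hw : ContL2 a b J w) :
    ContinuousOn (fun t => ∫ x in Ioo a b, w x t ^ 2) J := by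
  intro t₀ h₀
  have h1 := hw.continuousOn_md (hw.1 t₀ h₀).memLp t₀ h₀
  have h2 := (hw.2 t₀ h₀).add ((h1.sub_const (md a b (fun x => w x t₀) w t₀)).const_mul 2)
  have h3 := h2.add_const (∫ x in Ioo a b, w x t₀ ^ 2)
  simp only [sub_self, mul_zero, zero_add] at h3
  refine h3.congr' ?_
  filter_upwards [self_mem_nhdsWithin] with t ht
  have m := (hw.1 t ht).memLp
  have m0 := (hw.1 t₀ h₀).memLp
  have i0 := MemLp.integrable_mul_two m0 m0
  have i1 := MemLp.integrable_mul_two m m0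
  have i2 : Integrable (fun x => (w x t - w x t₀) ^ 2) (volume.restrict (Ioo a b)) :=
    (m.sub m0).integrable_sq
  have i3 : Integrable (fun x => w x t₀ ^ 2) (volume.restrict (Ioo a b)) := m0.integrable_sq
  have i4 : Integrable (fun x => 2 * (w x t * w x t₀ - w x t₀ * w x t₀))
    (volume.restrict (Ioo a b)) := (i1.sub i0).const_mul 2
  have i5 : Integrable (fun x => (w x t - w x t₀) ^ 2
    + 2 * (w x t * w x t₀ - w x t₀ * w x t₀)) (volume.restrict (Ioo a b)) := i2.add i4
  unfold md
  rw [← integral_sub i1 i0, ← integral_const_mul, ← integral_add i2 i4, ← integral_add i5 i3]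
  congr 1; ext x
  ring

end

/-- Functions of class `L²` on the space-time cylinder, described by their time slices. -/
structure L2T (a b T : ℝ) (h : ℝ → ℝ → ℝ) : Prop where
  int : IntegrableOn (fun p : ℝ × ℝ => h p.1 p.2) (Ioo a b ×ˢ Ioo 0 T)
  slice : ∀ᵐ t ∂volume.restrict (Ioo 0 T), MemLp (fun x => h x t) 2 (volume.restrict (Ioo a b))
  sq : IntegrableOn (fun t => ∫ x in Ioo a b, h x t ^ 2) (Ioo 0 T)

section
variable {a b T : ℝ} {h h' w : ℝ → ℝ → ℝ}

theorem L2T.of_sq_int (h1 : IntegrableOn (fun p : ℝ × ℝ => h p.1 p.2) (Ioo a b ×ˢ Ioo 0 T))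
    (h2 : IntegrableOn (fun p : ℝ × ℝ => h p.1 p.2 ^ 2) (Ioo a b ×ˢ Ioo 0 T)) : L2T a b T h := by
  refine ⟨h1, ?_, integrable_time_integral (h := fun x t => h x t ^ 2) h2⟩
  filter_upwards [aesm_time h1.1, integrable_time_slice (h := fun x t => h x t ^ 2) h2] with t m i
  exact (memLp_two_iff_integrable_sq m).2 i

theorem L2T.of_contL2 (hw : ContL2 a b (Icc 0 T) w)
    (h1 : IntegrableOn (fun p : ℝ × ℝ => w p.1 p.2) (Ioo a b ×ˢ Ioo 0 T)) : L2T a b T w := by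
  refine ⟨h1, ?_, hw.continuousOn_sq.integrableOn_Ioo⟩
  filter_upwards [ae_restrict_mem measurableSet_Ioo] with t ht
  exact (hw.1 t (Ioo_subset_Icc_self ht)).memLp

theorem L2T.of_le (h1 : IntegrableOn (fun p : ℝ × ℝ => h p.1 p.2) (Ioo a b ×ˢ Ioo 0 T))
    (hs : ∀ᵐ t ∂volume.restrict (Ioo 0 T), MemLp (fun x => h x t) 2 (volume.restrict (Ioo a b)))
    {g : ℝ → ℝ} (hg : IntegrableOn g (Ioo 0 T))
    (hle : ∀ᵐ t ∂volume.restrict (Ioo 0 T), ∫ x in Ioo a b, h x t ^ 2 ≤ g t) : L2T a b T h := by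
  refine ⟨h1, hs, hg.mono' (aesm_time_integral (h := fun x t => h x t ^ 2) (h1.1.pow 2)) ?_⟩
  filter_upwards [hle] with t ht
  rwa [Real.norm_eq_abs, abs_of_nonneg (integral_nonneg fun x => sq_nonneg _)]

theorem L2T.sub (hh : L2T a b T h) (hh' : L2T a b T h') :
    L2T a b T fun x t => h x t - h' x t := by
  refine L2T.of_le (hh.int.sub hh'.int) ?_ ((hh.sq.const_mul 2).add (hh'.sq.const_mul 2)) ?_
  · filter_upwards [hh.slice, hh'.slice] with t m m'
    exact m.sub m'
  · filter_upwards [hh.slice, hh'.slice] with t m m'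
    have i1 := m.integrable_sq
    have i2 := m'.integrable_sq
    simp only [Pi.add_apply]
    rw [← integral_const_mul, ← integral_const_mul,
      ← integral_add (i1.const_mul _) (i2.const_mul _)]
    refine integral_mono_of_nonneg (Eventually.of_forall fun x => sq_nonneg _)
      ((i1.const_mul _).add (i2.const_mul _)) (Eventually.of_forall fun x => ?_)
    nlinarith [sq_nonneg (h x t + h' x t)]

end

theorem ContDiff.smooth_deriv {g : ℝ → ℝ} (hg : ContDiff ℝ (⊤ : ℕ∞) g) :
    ContDiff ℝ (⊤ : ℕ∞) (deriv g) :=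
  (contDiff_infty_iff_deriv.1 hg).2

theorem memLp_sinB (a b : ℝ) (n : ℕ) : MemLp (sinB a b n) 2 (volume.restrict (Ioo a b)) :=
  (contDiff_sinB a b n).continuous.memLp_Ioo a b

theorem memLp_cosB (a b : ℝ) (n : ℕ) : MemLp (cosB a b n) 2 (volume.restrict (Ioo a b)) :=
  (contDiff_cosB a b n).continuous.memLp_Ioo a b

theorem md_sinB_of_weakDerivZ {a b : ℝ} {w wx : ℝ → ℝ → ℝ} {t : ℝ}
    (h : WeakDerivZ a b (fun x => w x t) (fun x => wx x t)) (n : ℕ) :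
    md a b (deriv (sinB a b n)) wx t = frq a b n ^ 2 * md a b (sinB a b n) w t := by
  have h1 := h (deriv (sinB a b n)) (contDiff_sinB a b n).smooth_deriv
  have e : deriv (deriv (sinB a b n)) = fun x => -(frq a b n ^ 2 * sinB a b n x) := by
    have : deriv (sinB a b n) = fun x => frq a b n * cosB a b n x := by
      ext x; exact deriv_sinB ..
    rw [this]
    ext x
    rw [deriv_const_mul_field, deriv_cosB]
    ring
  unfold md
  rw [← neg_eq_iff_eq_neg] at h1
  rw [← h1, e, ← integral_const_mul, ← integral_neg]
  congr 1; ext x; ring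

/-- Sine modes of a weak solution of the inhomogeneous wave equation with zero initial data. -/
theorem wave_modes {a b T : ℝ} (hab : a < b) (hT : 0 < T) {w wx v F : ℝ → ℝ → ℝ}
    (hw : ContL2 a b (Icc 0 T) w) (hv : ContL2 a b (Icc 0 T) v)
    (iw : IntegrableOn (fun p : ℝ × ℝ => w p.1 p.2) (Ioo a b ×ˢ Ioo 0 T))
    (iwx : IntegrableOn (fun p : ℝ × ℝ => wx p.1 p.2) (Ioo a b ×ˢ Ioo 0 T))
    (iv : IntegrableOn (fun p : ℝ × ℝ => v p.1 p.2) (Ioo a b ×ˢ Ioo 0 T))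
    (iF : IntegrableOn (fun p : ℝ × ℝ => F p.1 p.2) (Ioo a b ×ˢ Ioo 0 T))
    (hD : ∀ t ∈ Icc 0 T, WeakDerivZ a b (fun x => w x t) (fun x => wx x t))
    (H1 : ∀ ψ : ℝ → ℝ, ContDiff ℝ (⊤ : ℕ∞) ψ →
      (∃ K : Set ℝ, IsCompact K ∧ K ⊆ Ioo a b ∧ ∀ x ∉ K, ψ x = 0) → ∀ η, VanishLate T η →
      tpair a b T w ψ (deriv (deriv η)) = - tpair a b T wx (deriv ψ) η - tpair a b T F ψ η)
    (H2 : ∀ ψ : ℝ → ℝ, ContDiff ℝ (⊤ : ℕ∞) ψ →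
      (∃ K : Set ℝ, IsCompact K ∧ K ⊆ Ioo a b ∧ ∀ x ∉ K, ψ x = 0) →
      ∀ ρ : ℝ → ℝ, ContDiff ℝ (⊤ : ℕ∞) ρ → HasCompactSupport ρ → tsupport ρ ⊆ Ioo 0 T →
      tpair a b T w ψ (deriv ρ) = - tpair a b T v ψ ρ) (n : ℕ) :
    ∀ t ∈ Icc 0 T, md a b (sinB a b n) w t = ∫ s in 0..t, md a b (sinB a b n) v s ∧
      md a b (sinB a b n) v t = ∫ s in 0..t,
        -(frq a b n ^ 2 * md a b (sinB a b n) w s + md a b (sinB a b n) F s) := by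
  set s := sinB a b n with hs
  have hsS : ContDiff ℝ (⊤ : ℕ∞) s := contDiff_sinB a b n
  have hsc := hsS.continuous
  have hsc' := hsS.smooth_deriv.continuous
  have hsL := memLp_sinB a b n
  set W := md a b s w with hW
  set Vn := md a b s v with hVn
  set q : ℝ → ℝ := fun t => -(frq a b n ^ 2 * W t + md a b s F t) with hq
  have iW : IntegrableOn W (Ioo 0 T) := integrableOn_md iw hsc
  have iFn : IntegrableOn (md a b s F) (Ioo 0 T) := integrableOn_md iF hsc
  have iq : IntegrableOn q (Ioo 0 T) := ((iW.const_mul _).add iFn).neg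
  have cW : ContinuousOn W (Icc 0 T) := hw.continuousOn_md hsL
  have cV : ContinuousOn Vn (Icc 0 T) := hv.continuousOn_md hsL
  -- the equation tested with the mode
  have E1 : ∀ η, VanishLate T η →
      ∫ t in Ioo 0 T, W t * deriv (deriv η) t = ∫ t in Ioo 0 T, q t * η t := by
    intro η hη
    have c0 := hη.1.continuous
    have c2 := hη.1.smooth_deriv.smooth_deriv.continuous
    have i1 := integrable_space_mul iwx c0
    have i2 := integrable_space_mul iw c2
    have i3 := integrable_space_mul iF c0
    have i23 := (i2.add i3).neg
    have ext := weak_extend hab i1 i23 (s := s) (fun ψ hψ hK => by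
      have e := H1 ψ hψ hK η hη
      rw [tpair_eq_space iw hψ.continuous c2, tpair_eq_space iF hψ.continuous c0,
        tpair_eq_space iwx hψ.smooth_deriv.continuous c0] at e
      have : ∀ x, (-((fun x => ∫ t in Ioo 0 T, w x t * deriv (deriv η) t) +
          fun x => ∫ t in Ioo 0 T, F x t * η t)) x * ψ x
          = -((∫ t in Ioo 0 T, w x t * deriv (deriv η) t) * ψ x
            + (∫ t in Ioo 0 T, F x t * η t) * ψ x) := fun x => by
        simp only [Pi.neg_apply, Pi.add_apply]; ring
      simp only [this]
      rw [integral_neg, integral_add (Integrable.mul_continuous_Ioo i2 hψ.continuous)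
        (Integrable.mul_continuous_Ioo i3 hψ.continuous)]
      linarith) hsS (sinB_left a b n) (sinB_right hab n)
    have : ∀ x, (-((fun x => ∫ t in Ioo 0 T, w x t * deriv (deriv η) t) +
          fun x => ∫ t in Ioo 0 T, F x t * η t)) x * s x
          = -((∫ t in Ioo 0 T, w x t * deriv (deriv η) t) * s x
            + (∫ t in Ioo 0 T, F x t * η t) * s x) := fun x => by
        simp only [Pi.neg_apply, Pi.add_apply]; ring
    simp only [this] at ext
    rw [integral_neg, integral_add (Integrable.mul_continuous_Ioo i2 hsc)
        (Integrable.mul_continuous_Ioo i3 hsc), ← tpair_eq_space iwx hsc' c0,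
      ← tpair_eq_space iw hsc c2, ← tpair_eq_space iF hsc c0, tpair_eq_time iwx hsc' c0,
      tpair_eq_time iw hsc c2, tpair_eq_time iF hsc c0] at ext
    have e1 : ∫ t in Ioo 0 T, md a b (deriv s) wx t * η t
        = ∫ t in Ioo 0 T, frq a b n ^ 2 * W t * η t := by
      apply setIntegral_congr_fun measurableSet_Ioo
      intro t ht
      simp only [hs]
      rw [md_sinB_of_weakDerivZ (hD t (Ioo_subset_Icc_self ht))]
    have e2 : ∫ t in Ioo 0 T, q t * η t
        = -((∫ t in Ioo 0 T, frq a b n ^ 2 * W t * η t) + ∫ t in Ioo 0 T, md a b s F t * η t) := by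
      rw [← integral_add (Integrable.mul_continuous_Ioo (iW.const_mul _) c0)
        (Integrable.mul_continuous_Ioo iFn c0), ← integral_neg]
      congr 1; ext t; simp only [hq]; ring
    rw [e2, ← e1]
    linarith
  set I : ℝ → ℝ := fun t => ∫ r in 0..t, q r with hI
  have cI : ContinuousOn I (Icc 0 T) := continuousOn_primitive hT iq
  have iI : IntegrableOn I (Ioo 0 T) := cI.integrableOn_Ioo
  have E2 : ∀ t ∈ Icc 0 T, W t = ∫ r in 0..t, I r := by
    refine eq_primitive_of_weak hT cW iI fun ρ hρ => ?_
    have h1 := E1 _ hρ.primitive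
    rw [(contDiff_primitive hρ.1 T).2, integral_mul_vanishLate hT iq hρ.primitive,
      (contDiff_primitive hρ.1 T).2] at h1
    exact h1
  have E3 : EqOn Vn I (Icc 0 T) := by
    refine eqOn_of_forall_test hT cV cI fun ρ hρ hc hsupp => ?_
    have c0 := hρ.continuous
    have c1 := hρ.smooth_deriv.continuous
    have hvl := vanishLate_of_compactSupport hT hρ hc hsupp
    have i1 := integrable_space_mul iw c1
    have i2 := integrable_space_mul iv c0
    have ext := weak_extend hab (integrable_zero _ _ _) (i1.add i2) (s := s) (fun ψ hψ hK => by
      have e := H2 ψ hψ hK ρ hρ hc hsupp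
      rw [tpair_eq_space iw hψ.continuous c1, tpair_eq_space iv hψ.continuous c0] at e
      simp only [Pi.zero_apply, zero_mul, integral_zero, Pi.add_apply, add_mul]
      rw [integral_add (Integrable.mul_continuous_Ioo i1 hψ.continuous)
        (Integrable.mul_continuous_Ioo i2 hψ.continuous)]
      linarith) hsS (sinB_left a b n) (sinB_right hab n)
    simp only [Pi.zero_apply, zero_mul, integral_zero, Pi.add_apply, add_mul] at ext
    rw [integral_add (Integrable.mul_continuous_Ioo i1 hsc)
      (Integrable.mul_continuous_Ioo i2 hsc), ← tpair_eq_space iw hsc c1,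
      ← tpair_eq_space iv hsc c0, tpair_eq_time iw hsc c1, tpair_eq_time iv hsc c0] at ext
    rw [integral_mul_vanishLate hT iI hvl]
    have e1 : ∫ t in Ioo 0 T, (∫ r in 0..t, I r) * deriv ρ t
        = ∫ t in Ioo 0 T, W t * deriv ρ t := by
      apply setIntegral_congr_fun measurableSet_Ioo
      intro t ht
      simp only [E2 t (Ioo_subset_Icc_self ht)]
    rw [e1]
    linarith
  intro t ht
  refine ⟨?_, E3 ht⟩
  rw [E2 t ht]
  apply intervalIntegral.integral_congr
  intro r hr
  rw [uIcc_of_le ht.1] at hr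
  exact (E3 ⟨hr.1, hr.2.trans ht.2⟩).symm

/-- Cosine modes of a weak solution of the heat equation with zero initial data. -/
theorem heat_modes {a b T : ℝ} (hT : 0 < T) {z zx G H : ℝ → ℝ → ℝ}
    (hz : ContL2 a b (Icc 0 T) z)
    (iz : IntegrableOn (fun p : ℝ × ℝ => z p.1 p.2) (Ioo a b ×ˢ Ioo 0 T))
    (izx : IntegrableOn (fun p : ℝ × ℝ => zx p.1 p.2) (Ioo a b ×ˢ Ioo 0 T))
    (iG : IntegrableOn (fun p : ℝ × ℝ => G p.1 p.2) (Ioo a b ×ˢ Ioo 0 T))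
    (iH : IntegrableOn (fun p : ℝ × ℝ => H p.1 p.2) (Ioo a b ×ˢ Ioo 0 T))
    (H1 : ∀ ψ : ℝ → ℝ, ContDiff ℝ (⊤ : ℕ∞) ψ → ∀ η, VanishLate T η →
      tpair a b T z ψ (deriv η) = tpair a b T zx (deriv ψ) η - tpair a b T G ψ η
        - tpair a b T H (deriv ψ) η) (n : ℕ) :
    ∀ t ∈ Icc 0 T, md a b (cosB a b n) z t = ∫ s in 0..t,
      (frq a b n * md a b (sinB a b n) zx s + md a b (cosB a b n) G s
        - frq a b n * md a b (sinB a b n) H s) := by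
  have hcS : ContDiff ℝ (⊤ : ℕ∞) (cosB a b n) := contDiff_cosB a b n
  have cc := hcS.continuous
  have cc' := hcS.smooth_deriv.continuous
  have cs := (contDiff_sinB a b n).continuous
  have i1 := integrableOn_md izx cs
  have i2 := integrableOn_md iG cc
  have i3 := integrableOn_md iH cs
  have i12 : IntegrableOn (fun s => frq a b n * md a b (sinB a b n) zx s
    + md a b (cosB a b n) G s) (Ioo 0 T) := (i1.const_mul _).add i2
  refine eq_primitive_of_weak hT (hz.continuousOn_md (memLp_cosB a b n))
    (i12.sub (i3.const_mul _)) fun η hη => ?_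
  have c0 := hη.1.continuous
  have e := H1 _ hcS η hη
  have hd : ∀ h : ℝ → ℝ → ℝ, ∀ t, md a b (deriv (cosB a b n)) h t
      = -(frq a b n * md a b (sinB a b n) h t) := by
    intro h t
    unfold md
    rw [← integral_const_mul, ← integral_neg]
    congr 1; ext x; rw [deriv_cosB]; ring
  rw [tpair_eq_time iz cc hη.1.smooth_deriv.continuous, tpair_eq_time izx cc' c0,
    tpair_eq_time iG cc c0, tpair_eq_time iH cc' c0] at e
  simp only [hd, neg_mul, integral_neg] at e
  simp only [sub_mul, add_mul]
  rw [integral_sub, integral_add, e]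
  · ring
  · exact Integrable.mul_continuous_Ioo (i1.const_mul _) c0
  · exact Integrable.mul_continuous_Ioo i2 c0
  · exact (Integrable.mul_continuous_Ioo (i1.const_mul _) c0).add
      (Integrable.mul_continuous_Ioo i2 c0)
  · exact Integrable.mul_continuous_Ioo (i3.const_mul _) c0

theorem Ioo_restrict_le {T t : ℝ} (ht : t ∈ Icc 0 T) :
    (volume : Measure ℝ).restrict (Ioo 0 t) ≤ volume.restrict (Ioo 0 T) :=
  Measure.restrict_mono (Ioo_subset_Ioo_right ht.2) le_rfl

theorem intervalIntegrable_of_Icc {T t : ℝ} {g : ℝ → ℝ} (ht : t ∈ Icc 0 T)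
    (hg : IntegrableOn g (Ioo 0 T)) : IntervalIntegrable g volume 0 t :=
  intervalIntegrable_of_Ioo ht.1 (hg.mono_set (Ioo_subset_Ioo_right ht.2))

theorem integrableOn_continuousOn_mul {T : ℝ} {y g : ℝ → ℝ} (hy : ContinuousOn y (Icc 0 T))
    (hg : IntegrableOn g (Ioo 0 T)) : IntegrableOn (fun s => y s * g s) (Ioo 0 T) := by
  have hg' : IntegrableOn g (Icc 0 T) := by
    rwa [integrableOn_Icc_iff_integrableOn_Ioo]
  exact (hg'.continuousOn_mul hy isCompact_Icc).mono_set Ioo_subset_Icc_self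

theorem sq_eq_of_primitive {T : ℝ} (hT : 0 < T) {y g : ℝ → ℝ} (hg : IntegrableOn g (Ioo 0 T))
    (h : ∀ t ∈ Icc 0 T, y t = ∫ s in 0..t, g s) :
    IntegrableOn (fun s => y s * g s) (Ioo 0 T) ∧
      ∀ t ∈ Icc 0 T, y t ^ 2 = 2 * ∫ s in 0..t, y s * g s := by
  have hy : ContinuousOn y (Icc 0 T) := (continuousOn_primitive hT hg).congr h
  refine ⟨integrableOn_continuousOn_mul hy hg, fun t ht => ?_⟩
  have := sq_primitive (c := 0) (intervalIntegrable_of_Icc (right_mem_Icc.2 hT.le) hg)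
    (by rwa [uIcc_of_le hT.le] : t ∈ uIcc 0 T)
  simp only [zero_add, ne_eq, OfNat.ofNat_ne_zero, not_false_eq_true, zero_pow] at this
  rw [h t ht, this]
  congr 1
  apply intervalIntegral.integral_congr
  intro s hs
  rw [uIcc_of_le ht.1] at hs
  simp only [h s ⟨hs.1, hs.2.trans ht.2⟩]

theorem tendsto_intervalIntegral {T t : ℝ} (ht : t ∈ Icc 0 T) {S : ℕ → ℝ → ℝ} {L B : ℝ → ℝ}
    (hS : ∀ N, IntegrableOn (S N) (Ioo 0 T)) (hB : IntegrableOn B (Ioo 0 T))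
    (hle : ∀ᵐ s ∂volume.restrict (Ioo 0 T), ∀ N, |S N s| ≤ B s)
    (hlim : ∀ᵐ s ∂volume.restrict (Ioo 0 T), Tendsto (fun N => S N s) atTop (nhds (L s))) :
    Tendsto (fun N => ∫ s in 0..t, S N s) atTop (nhds (∫ s in 0..t, L s)) := by
  simp only [← integral_Ioo_eq ht.1]
  have hm := Ioo_restrict_le ht
  refine tendsto_integral_of_dominated_convergence B
    (fun N => (hS N).1.mono_measure hm) (Integrable.mono_measure hB hm) (fun N => ?_) (ae_mono hm hlim)
  filter_upwards [ae_mono hm hle] with s hs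
  exact hs N

theorem abs_sum_mul_le (s : Finset ℕ) (p q : ℕ → ℝ) {P Q : ℝ} (hP : ∑ n ∈ s, p n ^ 2 ≤ P)
    (hQ : ∑ n ∈ s, q n ^ 2 ≤ Q) : |∑ n ∈ s, p n * q n| ≤ P + Q := by
  refine (Finset.abs_sum_le_sum_abs _ _).trans ?_
  calc _ ≤ ∑ n ∈ s, (p n ^ 2 + q n ^ 2) := by
        refine Finset.sum_le_sum fun n _ => ?_
        rw [abs_mul]
        nlinarith [sq_nonneg (|p n| - |q n|), sq_abs (p n), sq_abs (q n), sq_nonneg (p n),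
          sq_nonneg (q n)]
    _ ≤ _ := by rw [Finset.sum_add_distrib]; linarith

theorem wave_energy {a b T : ℝ} (hab : a < b) (hT : 0 < T) {w v F : ℝ → ℝ → ℝ}
    (hw : ContL2 a b (Icc 0 T) w) (hv : ContL2 a b (Icc 0 T) v)
    (iw : IntegrableOn (fun p : ℝ × ℝ => w p.1 p.2) (Ioo a b ×ˢ Ioo 0 T))
    (Lv : L2T a b T v) (LF : L2T a b T F)
    (hm : ∀ n, ∀ t ∈ Icc 0 T,
      md a b (sinB a b n) w t = ∫ s in 0..t, md a b (sinB a b n) v s ∧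
      md a b (sinB a b n) v t = ∫ s in 0..t,
        -(frq a b n ^ 2 * md a b (sinB a b n) w s + md a b (sinB a b n) F s)) :
    ∀ t ∈ Icc 0 T, ∫ x in Ioo a b, v x t ^ 2
      ≤ 2 * ∫ s in 0..t, -∫ x in Ioo a b, F x s * v x s := by
  have cs : ∀ n, Continuous (sinB a b n) := fun n => (contDiff_sinB a b n).continuous
  have iW := fun n => integrableOn_md iw (cs n)
  have iV := fun n => integrableOn_md Lv.int (cs n)
  have iF := fun n => integrableOn_md LF.int (cs n)
  have cV := fun n => hv.continuousOn_md (memLp_sinB a b n)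
  have cW := fun n => hw.continuousOn_md (memLp_sinB a b n)
  have iFV : ∀ n, IntegrableOn (fun s => md a b (sinB a b n) F s * md a b (sinB a b n) v s)
      (Ioo 0 T) := fun n => by
    simpa only [mul_comm] using integrableOn_continuousOn_mul (cV n) (iF n)
  have iN : ∀ n, IntegrableOn (fun s => -(md a b (sinB a b n) F s * md a b (sinB a b n) v s))
      (Ioo 0 T) := fun n => (iFV n).neg
  have mode : ∀ n, ∀ t ∈ Icc 0 T, md a b (sinB a b n) v t ^ 2 ≤
      2 * ∫ s in 0..t, -(md a b (sinB a b n) F s * md a b (sinB a b n) v s) := by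
    intro n t ht
    have e1 := (sq_eq_of_primitive hT (iV n) fun t ht => (hm n t ht).1).2 t ht
    have e2 := (sq_eq_of_primitive hT (((iW n).const_mul _).add (iF n)).neg
      fun t ht => (hm n t ht).2).2 t ht
    have iWV : IntegrableOn (fun s => md a b (sinB a b n) w s * md a b (sinB a b n) v s)
      (Ioo 0 T) := integrableOn_continuousOn_mul (cW n) (iV n)
    have e3 : ∫ s in 0..t, md a b (sinB a b n) v s *
        (-(frq a b n ^ 2 * md a b (sinB a b n) w s + md a b (sinB a b n) F s))
        = (∫ s in 0..t, -(md a b (sinB a b n) F s * md a b (sinB a b n) v s))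
          - frq a b n ^ 2 * ∫ s in 0..t, md a b (sinB a b n) w s * md a b (sinB a b n) v s := by
      rw [← intervalIntegral.integral_const_mul, ← intervalIntegral.integral_sub
        (intervalIntegrable_of_Icc ht (iN n))
        (intervalIntegrable_of_Icc ht (iWV.const_mul _))]
      congr 1; ext s; ring
    have e2' : md a b (sinB a b n) v t ^ 2 = 2 * ∫ s in 0..t, md a b (sinB a b n) v s *
        (-(frq a b n ^ 2 * md a b (sinB a b n) w s + md a b (sinB a b n) F s)) := e2
    rw [e3] at e2'
    nlinarith [mul_nonneg (sq_nonneg (frq a b n)) (sq_nonneg (md a b (sinB a b n) w t))]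
  intro t ht
  have l1 : Tendsto (fun N => ∑ n ∈ Finset.range N, md a b (sinB a b n) v t ^ 2) atTop
      (nhds (∫ x in Ioo a b, v x t ^ 2)) := by
    have := (parseval_sinB hab (hv.1 t ht).memLp (hv.1 t ht).memLp).tendsto_sum_nat
    simp only [← pow_two] at this
    exact this
  have l2 : Tendsto (fun N => ∫ s in 0..t, ∑ n ∈ Finset.range N,
      -(md a b (sinB a b n) F s * md a b (sinB a b n) v s)) atTop
      (nhds (∫ s in 0..t, -∫ x in Ioo a b, F x s * v x s)) := by
    refine tendsto_intervalIntegral ht (fun N => integrable_finsetSum _ fun n _ => (iN n))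
      (LF.sq.add Lv.sq) ?_ ?_
    · filter_upwards [LF.slice, Lv.slice] with s m1 m2 N
      rw [Finset.sum_neg_distrib, abs_neg]
      exact abs_sum_mul_le _ _ _ (sum_sq_sinB_le hab m1 _) (sum_sq_sinB_le hab m2 _)
    · filter_upwards [LF.slice, Lv.slice] with s m1 m2
      simp only [Finset.sum_neg_distrib]
      exact (parseval_sinB hab m1 m2).tendsto_sum_nat.neg
  refine le_of_tendsto_of_tendsto' l1 (l2.const_mul 2) fun N => ?_
  rw [intervalIntegral.integral_finsetSum fun n _ => intervalIntegrable_of_Icc ht (iN n),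
    Finset.mul_sum]
  exact Finset.sum_le_sum fun n _ => mode n t ht

theorem heat_energy {a b T : ℝ} (hab : a < b) (hT : 0 < T) {z zx G H : ℝ → ℝ → ℝ}
    (hz : ContL2 a b (Icc 0 T) z) (Lz : L2T a b T z) (Lzx : L2T a b T zx) (LH : L2T a b T H)
    (iG : IntegrableOn (fun p : ℝ × ℝ => G p.1 p.2) (Ioo a b ×ˢ Ioo 0 T))
    (iG2 : IntegrableOn (fun t => (∫ x in Ioo a b, |G x t|) ^ 2) (Ioo 0 T))
    (hD : ∀ᵐ t ∂volume.restrict (Ioo 0 T), WeakDerivI a b (fun x => z x t) (fun x => zx x t))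
    (hm : ∀ n, ∀ t ∈ Icc 0 T, md a b (cosB a b n) z t = ∫ s in 0..t,
      (frq a b n * md a b (sinB a b n) zx s + md a b (cosB a b n) G s
        - frq a b n * md a b (sinB a b n) H s)) :
    ∀ t ∈ Icc 0 T, ∫ x in Ioo a b, z x t ^ 2 = 2 * ∫ s in 0..t,
      (-(∫ x in Ioo a b, zx x s ^ 2) + (∫ x in Ioo a b, G x s * z x s)
        + ∫ x in Ioo a b, H x s * zx x s) := by
  have cs : ∀ n, Continuous (sinB a b n) := fun n => (contDiff_sinB a b n).continuous
  have cc : ∀ n, Continuous (cosB a b n) := fun n => (contDiff_cosB a b n).continuous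
  have i1 := fun n => integrableOn_md Lzx.int (cs n)
  have i2 := fun n => integrableOn_md iG (cc n)
  have i3 := fun n => integrableOn_md LH.int (cs n)
  set E : ℕ → ℝ → ℝ := fun n s => -(md a b (sinB a b n) zx s * md a b (sinB a b n) zx s)
    + md a b (cosB a b n) G s * md a b (cosB a b n) z s
    + md a b (sinB a b n) H s * md a b (sinB a b n) zx s with hE
  have hEae : ∀ n, (fun s => md a b (cosB a b n) z s * (frq a b n * md a b (sinB a b n) zx s
      + md a b (cosB a b n) G s - frq a b n * md a b (sinB a b n) H s))
      =ᵐ[volume.restrict (Ioo 0 T)] E n := by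
    intro n
    filter_upwards [hD, Lz.slice, Lzx.slice] with s d m1 m2
    have e : frq a b n * md a b (cosB a b n) z s = - md a b (sinB a b n) zx s :=
      weakDerivI_sinB hab (MemLp.integrable_two m1) (MemLp.integrable_two m2) d n
    simp only [hE]
    linear_combination (md a b (sinB a b n) zx s - md a b (sinB a b n) H s) * e
  have mode : ∀ n, IntegrableOn (E n) (Ioo 0 T) ∧ ∀ t ∈ Icc 0 T,
      md a b (cosB a b n) z t ^ 2 = 2 * ∫ s in 0..t, E n s := by
    intro n
    obtain ⟨j1, j2⟩ := sq_eq_of_primitive hT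
      ((((i1 n).const_mul _).add (i2 n)).sub ((i3 n).const_mul _)) (hm n)
    refine ⟨Integrable.congr j1 (hEae n), fun t ht => ?_⟩
    rw [j2 t ht, ← integral_Ioo_eq ht.1, ← integral_Ioo_eq ht.1]
    congr 1
    exact integral_congr_ae (ae_mono (Ioo_restrict_le ht) (hEae n))
  intro t ht
  have l1 : Tendsto (fun N => ∑ n ∈ Finset.range N, md a b (cosB a b n) z t ^ 2) atTop
      (nhds (∫ x in Ioo a b, z x t ^ 2)) := by
    have := (parseval_cosB hab (hz.1 t ht).memLp (hz.1 t ht).memLp).tendsto_sum_nat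
    simp only [← pow_two] at this
    exact this
  set c := √(2 / (b - a)) * wgt a b with hc
  have hc0 : 0 ≤ c := mul_nonneg (Real.sqrt_nonneg _) (Real.sqrt_nonneg _)
  have iB : IntegrableOn (fun s => (∫ x in Ioo a b, zx x s ^ 2)
      + c * ((∫ x in Ioo a b, |G x s|) ^ 2 + (∫ x in Ioo a b, z x s ^ 2)
        + ∫ x in Ioo a b, zx x s ^ 2)
      + ((∫ x in Ioo a b, H x s ^ 2) + ∫ x in Ioo a b, zx x s ^ 2)) (Ioo 0 T) :=
    (Lzx.sq.add (((iG2.add Lz.sq).add Lzx.sq).const_mul c)).add (LH.sq.add Lzx.sq)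
  have l2 : Tendsto (fun N => ∫ s in 0..t, ∑ n ∈ Finset.range N, E n s) atTop
      (nhds (∫ s in 0..t, (-(∫ x in Ioo a b, zx x s ^ 2) + (∫ x in Ioo a b, G x s * z x s)
        + ∫ x in Ioo a b, H x s * zx x s))) := by
    refine tendsto_intervalIntegral ht (fun N => integrable_finsetSum _ fun n _ => (mode n).1)
      iB ?_ ?_
    · filter_upwards [hD, Lz.slice, Lzx.slice, LH.slice, integrable_time_slice iG]
        with s d m1 m2 m3 g N
      simp only [hE, Finset.sum_add_distrib, Finset.sum_neg_distrib]
      refine (abs_add_le _ _).trans (add_le_add ((abs_add_le _ _).trans (add_le_add ?_ ?_)) ?_)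
      · rw [abs_neg]
        simp only [← pow_two]
        rw [abs_of_nonneg (Finset.sum_nonneg fun _ _ => sq_nonneg _)]
        exact sum_sq_sinB_le hab m2 _
      · refine (abs_sum_cosB_le hab m1 m2 d g _).trans ?_
        rw [← hc, mul_assoc]
        refine mul_le_mul_of_nonneg_left ?_ hc0
        have n1 : 0 ≤ ∫ x in Ioo a b, z x s ^ 2 := integral_nonneg fun _ => sq_nonneg _
        have n2 : 0 ≤ ∫ x in Ioo a b, zx x s ^ 2 := integral_nonneg fun _ => sq_nonneg _
        nlinarith [sq_nonneg ((∫ x in Ioo a b, |G x s|) - √(∫ x in Ioo a b, z x s ^ 2)),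
          sq_nonneg ((∫ x in Ioo a b, |G x s|) - √(∫ x in Ioo a b, zx x s ^ 2)),
          Real.sq_sqrt n1, Real.sq_sqrt n2]
      · exact abs_sum_mul_le _ _ _ (sum_sq_sinB_le hab m3 _) (sum_sq_sinB_le hab m2 _)
    · filter_upwards [hD, Lz.slice, Lzx.slice, LH.slice, integrable_time_slice iG]
        with s d m1 m2 m3 g
      simp only [hE, Finset.sum_add_distrib, Finset.sum_neg_distrib]
      have p1 := (parseval_sinB hab m2 m2).tendsto_sum_nat
      simp only [← pow_two (zx _ _)] at p1
      exact (p1.neg.add (hasSum_cosB_of_weakDerivI hab m1 m2 d g).tendsto_sum_nat).add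
        (parseval_sinB hab m3 m2).tendsto_sum_nat
  refine tendsto_nhds_unique l1 ((l2.const_mul 2).congr fun N => ?_)
  rw [intervalIntegral.integral_finsetSum fun n _ => intervalIntegrable_of_Icc ht (mode n).1,
    Finset.mul_sum]
  exact Finset.sum_congr rfl fun n _ => ((mode n).2 t ht).symm

/-- Grönwall's inequality with an integrable coefficient and zero initial value. -/
theorem gronwall_zero {T : ℝ} (hT : 0 < T) {y A : ℝ → ℝ} (hy : ContinuousOn y (Icc 0 T))
    (hA : IntegrableOn A (Ioo 0 T)) (hy0 : ∀ t ∈ Icc 0 T, 0 ≤ y t) (hA0 : ∀ t, 0 ≤ A t)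
    (h : ∀ t ∈ Icc 0 T, y t ≤ ∫ s in 0..t, A s * y s) : ∀ t ∈ Icc 0 T, y t = 0 := by
  have hAy : IntegrableOn (fun s => A s * y s) (Ioo 0 T) := by
    simpa only [mul_comm] using integrableOn_continuousOn_mul hy hA
  have hcP := continuousOn_primitive hT hAy
  have hcA := continuousOn_primitive hT hA
  set Y : ℝ → ℝ := fun t => ∫ s in 0..t, A s * y s with hY
  have hsub : ∀ r ∈ Icc 0 T, ∀ t ∈ Icc 0 T, r ≤ t →
      Y t - Y r = ∫ s in r..t, A s * y s := fun r hr t ht hrt =>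
    intervalIntegral.integral_interval_sub_left (intervalIntegrable_of_Icc ht hAy)
      (intervalIntegrable_of_Icc hr hAy)
  have hmono : ∀ r ∈ Icc 0 T, ∀ t ∈ Icc 0 T, r ≤ t → Y r ≤ Y t := by
    intro r hr t ht hrt
    rw [← sub_nonneg, hsub r hr t ht hrt]
    exact intervalIntegral.integral_nonneg hrt fun s hs =>
      mul_nonneg (hA0 s) (hy0 s ⟨hr.1.trans hs.1, hs.2.trans ht.2⟩)
  have hcl : IsClosed ({t | Y t = 0} ∩ Icc 0 T) := by
    have := hcP.preimage_isClosed_of_isClosed isClosed_Icc (isClosed_singleton (x := (0 : ℝ)))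
    rwa [inter_comm] at this
  have hall : Icc 0 T ⊆ {t | Y t = 0} := by
    refine hcl.Icc_subset_of_forall_exists_gt (by simp [hY]) ?_
    rintro x ⟨hx, hx0, hxT⟩ t' ht'
    have hxm : x ∈ Icc 0 T := ⟨hx0, hxT.le⟩
    have hev : ∀ᶠ t in nhdsWithin x (Icc 0 T),
        (∫ s in 0..t, A s) < (∫ s in 0..x, A s) + 1 / 2 :=
      (hcA x hxm).eventually_lt_const (by linarith)
    have hle : nhdsWithin x (Ioi x) ≤ nhdsWithin x (Icc 0 T) := by
      rw [← nhdsWithin_Ioo_eq_nhdsGT hxT]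
      exact nhdsWithin_mono _ fun s hs => ⟨hx0.trans hs.1.le, hs.2.le⟩
    have hev2 : ∀ᶠ t in nhdsWithin x (Ioi x), t ∈ Ioc x (min t' T) :=
      Ioc_mem_nhdsGT (lt_min ht' hxT)
    have hev' : ∀ᶠ t in nhdsWithin x (Ioi x),
        (∫ s in 0..t, A s) < (∫ s in 0..x, A s) + 1 / 2 := hle hev
    obtain ⟨t, h1, h2⟩ := (hev'.and hev2).exists
    have htm : t ∈ Icc 0 T := ⟨hx0.trans h2.1.le, h2.2.trans (min_le_right _ _)⟩
    refine ⟨t, ?_, h2.1, h2.2.trans (min_le_left _ _)⟩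
    have hsubI : Icc x t ⊆ Icc 0 T := Icc_subset_Icc hx0 htm.2
    obtain ⟨r, hr, hmax⟩ := isCompact_Icc.exists_isMaxOn (nonempty_Icc.2 h2.1.le)
      (hy.mono hsubI)
    have hrm := hsubI hr
    have hIA : ∀ s ∈ Icc 0 T, IntervalIntegrable A volume 0 s := fun s hs =>
      intervalIntegrable_of_Icc hs hA
    have k1 : Y r ≤ y r * ∫ s in x..r, A s := by
      have := hsub x hxm r hrm hr.1
      rw [show Y x = 0 from hx, sub_zero] at this
      rw [this, ← intervalIntegral.integral_const_mul]
      refine intervalIntegral.integral_mono_on hr.1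
        ((intervalIntegrable_of_Icc hxm hAy).symm.trans (intervalIntegrable_of_Icc hrm hAy))
        (((hIA x hxm).symm.trans (hIA r hrm)).const_mul _) fun s hs => ?_
      rw [mul_comm]
      exact mul_le_mul_of_nonneg_right (hmax ⟨hs.1, hs.2.trans hr.2⟩) (hA0 s)
    have k2 : ∫ s in x..r, A s ≤ 1 / 2 := by
      rw [← intervalIntegral.integral_interval_sub_left (hIA r hrm) (hIA x hxm)]
      have : ∫ s in 0..r, A s ≤ ∫ s in 0..t, A s := by
        rw [← sub_nonneg, intervalIntegral.integral_interval_sub_left (hIA t htm) (hIA r hrm)]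
        exact intervalIntegral.integral_nonneg hr.2 fun s _ => hA0 s
      linarith
    have k3 : y r ≤ 0 := by
      have := (h r hrm).trans k1
      nlinarith [hy0 r hrm]
    have k4 : Y t = ∫ s in x..t, (0 : ℝ) := by
      have := hsub x hxm t htm h2.1.le
      rw [show Y x = 0 from hx, sub_zero] at this
      rw [this]
      apply intervalIntegral.integral_congr
      intro s hs
      rw [uIcc_of_le h2.1.le] at hs
      have : y s = 0 := le_antisymm ((hmax hs).trans k3) (hy0 s (hsubI hs))
      simp [this]
    rw [mem_ofPred_eq, k4]
    simp
  intro t ht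
  exact le_antisymm ((h t ht).trans (hall ht).le) (hy0 t ht)

/-- Lipschitz bounds with constant `M` for `f` and `f'` on `[0,∞)`. -/
structure LipF (f f' : ℝ → ℝ) (M : ℝ) : Prop where
  nonneg : 0 ≤ M
  bdd : ∀ x, 0 ≤ x → |f' x| ≤ M
  lip : ∀ x y, 0 ≤ x → 0 ≤ y → |f x - f y| ≤ M * |x - y|
  lip' : ∀ x y, 0 ≤ x → 0 ≤ y → |f' x - f' y| ≤ M * |x - y|
  le : ∀ x, 0 ≤ x → |f x| ≤ M * x

theorem HypF.exists_lipF {f f' f'' : ℝ → ℝ} (hf : HypF f f' f'') : ∃ M, LipF f f' M := by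
  obtain ⟨M, hM⟩ := hf.bdd
  have lip : ∀ x y, 0 ≤ x → 0 ≤ y → |f x - f y| ≤ M * |x - y| := fun x y hx hy =>
    (convex_Ici (0 : ℝ)).norm_image_sub_le_of_norm_hasDerivWithin_le hf.hasDeriv₁
      (fun z hz => (hM z hz).1) hy hx
  refine ⟨M, (abs_nonneg _).trans (hM 0 (by simp)).1, fun x hx => (hM x hx).1, lip, fun x y hx hy =>
    (convex_Ici (0 : ℝ)).norm_image_sub_le_of_norm_hasDerivWithin_le hf.hasDeriv₂
      (fun z hz => (hM z hz).2) hy hx, fun x hx => ?_⟩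
  have := lip x 0 hx le_rfl
  rwa [hf.zero, sub_zero, sub_zero, abs_of_nonneg hx] at this

/-- Absorption of the highest-order term by repeated use of Young's inequality. -/
theorem exists_absorb {M k L : ℝ} (hM : 0 ≤ M) (hk : 0 ≤ k) (hL : 0 < L) : ∃ C, 0 ≤ C ∧
    ∀ n d y a₀ a₁ a₂ σ τ : ℝ, 0 ≤ n → 0 ≤ d → 0 ≤ y → 0 ≤ a₀ → 0 ≤ a₁ → 0 ≤ a₂ →
    σ ^ 2 = n ^ 2 / L + 2 * (n * d) → τ ^ 2 = a₀ ^ 2 / L + 2 * (a₀ * a₁) →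
    (M * (d * y) + M * σ * (a₂ * y)) + (M * σ * (a₁ * y) + M * σ * (d * k) + M * σ ^ 2 * (a₂ * k))
      + (M * τ * (y * d) + M * σ * (k * d)) - d ^ 2
      ≤ C * (1 + a₀ ^ 2 + a₁ ^ 2 + a₂ ^ 2) * (n ^ 2 + y ^ 2) := by
  obtain ⟨e, he⟩ : ∃ e : ℝ, e = 1 / 2 + 8 * M ^ 2 * k ^ 2 := ⟨_, rfl⟩
  have he0 : 0 ≤ e := by rw [he]; positivity
  obtain ⟨C₁, hC₁⟩ : ∃ c : ℝ, c = M * k / L + 8 * M ^ 2 * k ^ 2 + e / L + 8 * e ^ 2 := ⟨_, rfl⟩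
  obtain ⟨C₂, hC₂⟩ : ∃ c : ℝ, c = 5 * M ^ 2 + 2 * M ^ 2 / L := ⟨_, rfl⟩
  have h1 : 0 ≤ C₁ := by rw [hC₁]; positivity
  have h2 : 0 ≤ C₂ := by rw [hC₂]; positivity
  refine ⟨C₁ + C₂, by positivity, ?_⟩
  intro n d y a₀ a₁ a₂ σ τ hn hd hy h0 ha1 ha2 hσ hτ
  have T1 : M * (d * y) ≤ d ^ 2 / 8 + 2 * M ^ 2 * y ^ 2 := by
    linarith [sq_nonneg (d - 4 * M * y),
      show (d - 4 * M * y) ^ 2 = d ^ 2 - 8 * (M * (d * y)) + 16 * M ^ 2 * y ^ 2 by ring]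
  have T2 : M * σ * (a₂ * y) + M * σ * (a₁ * y)
      ≤ σ ^ 2 / 2 + M ^ 2 * (a₁ ^ 2 + a₂ ^ 2) * y ^ 2 := by
    have := sq_nonneg (σ - M * (a₁ + a₂) * y)
    have := mul_nonneg (mul_nonneg (sq_nonneg M) (sq_nonneg y)) (sq_nonneg (a₁ - a₂))
    nlinarith
  have T4 : M * σ * (d * k) + M * σ * (k * d) ≤ d ^ 2 / 8 + 8 * M ^ 2 * k ^ 2 * σ ^ 2 := by
    linarith [sq_nonneg (d - 8 * M * k * σ), show (d - 8 * M * k * σ) ^ 2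
      = d ^ 2 - 8 * (M * σ * (d * k) + M * σ * (k * d)) + 64 * M ^ 2 * k ^ 2 * σ ^ 2 by ring]
  have T5 : M * σ ^ 2 * (a₂ * k) ≤ M * k / L * (1 + a₂ ^ 2) * n ^ 2
      + d ^ 2 / 8 + 8 * M ^ 2 * k ^ 2 * a₂ ^ 2 * n ^ 2 := by
    rw [hσ]
    have p : 0 ≤ M * k / L * n ^ 2 := by positivity
    have q : a₂ ≤ 1 + a₂ ^ 2 := by nlinarith [sq_nonneg (a₂ - 1)]
    have e1 : M * (n ^ 2 / L + 2 * (n * d)) * (a₂ * k)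
        = (M * k / L * n ^ 2) * a₂ + 2 * M * k * a₂ * n * d := by ring
    rw [e1]
    have := mul_le_mul_of_nonneg_left q p
    linarith [sq_nonneg (d - 8 * M * k * a₂ * n), show (d - 8 * M * k * a₂ * n) ^ 2
      = d ^ 2 - 8 * (2 * M * k * a₂ * n * d) + 64 * M ^ 2 * k ^ 2 * a₂ ^ 2 * n ^ 2 by ring,
      show M * k / L * n ^ 2 * (1 + a₂ ^ 2) = M * k / L * (1 + a₂ ^ 2) * n ^ 2 by ring]
  have T6 : M * τ * (y * d) ≤ d ^ 2 / 8
      + 2 * M ^ 2 * y ^ 2 * (a₀ ^ 2 / L + a₀ ^ 2 + a₁ ^ 2) := by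
    have t1 : M * τ * (y * d) ≤ d ^ 2 / 8 + 2 * M ^ 2 * y ^ 2 * τ ^ 2 := by
      linarith [sq_nonneg (d - 4 * M * y * τ), show (d - 4 * M * y * τ) ^ 2
        = d ^ 2 - 8 * (M * τ * (y * d)) + 16 * M ^ 2 * y ^ 2 * τ ^ 2 by ring]
    have t2 : τ ^ 2 ≤ a₀ ^ 2 / L + a₀ ^ 2 + a₁ ^ 2 := by
      rw [hτ]; nlinarith [sq_nonneg (a₀ - a₁)]
    have : 0 ≤ 2 * M ^ 2 * y ^ 2 := by positivity
    linarith [mul_le_mul_of_nonneg_left t2 this]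
  have T7 : e * σ ^ 2 ≤ e / L * n ^ 2 + d ^ 2 / 8 + 8 * e ^ 2 * n ^ 2 := by
    rw [hσ]
    have e1 : e * (n ^ 2 / L + 2 * (n * d)) = e / L * n ^ 2 + 2 * e * n * d := by ring
    rw [e1]
    linarith [sq_nonneg (d - 8 * e * n), show (d - 8 * e * n) ^ 2
      = d ^ 2 - 8 * (2 * e * n * d) + 64 * e ^ 2 * n ^ 2 by ring]
  obtain ⟨X, hX⟩ : ∃ X : ℝ, X = 1 + a₀ ^ 2 + a₁ ^ 2 + a₂ ^ 2 := ⟨_, rfl⟩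
  rw [← hX]
  have X1 : 1 ≤ X := by linarith [sq_nonneg a₀, sq_nonneg a₁, sq_nonneg a₂]
  have N1 : M * k / L * (1 + a₂ ^ 2) * n ^ 2 + 8 * M ^ 2 * k ^ 2 * a₂ ^ 2 * n ^ 2
      + e / L * n ^ 2 + 8 * e ^ 2 * n ^ 2 ≤ C₁ * X * n ^ 2 := by
    rw [← add_mul, ← add_mul, ← add_mul, hC₁]
    refine mul_le_mul_of_nonneg_right ?_ (sq_nonneg n)
    have q1 : M * k / L * (1 + a₂ ^ 2) ≤ M * k / L * X :=
      mul_le_mul_of_nonneg_left (by linarith [sq_nonneg a₀, sq_nonneg a₁]) (by positivity)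
    have q2 : 8 * M ^ 2 * k ^ 2 * a₂ ^ 2 ≤ 8 * M ^ 2 * k ^ 2 * X :=
      mul_le_mul_of_nonneg_left (by linarith [sq_nonneg a₀, sq_nonneg a₁]) (by positivity)
    have q3 : e / L * 1 ≤ e / L * X := mul_le_mul_of_nonneg_left X1 (by positivity)
    have q4 : 8 * e ^ 2 * 1 ≤ 8 * e ^ 2 * X := mul_le_mul_of_nonneg_left X1 (by positivity)
    linarith
  have N2 : 2 * M ^ 2 * y ^ 2 + M ^ 2 * (a₁ ^ 2 + a₂ ^ 2) * y ^ 2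
      + 2 * M ^ 2 * y ^ 2 * (a₀ ^ 2 / L + a₀ ^ 2 + a₁ ^ 2) ≤ C₂ * X * y ^ 2 := by
    have e1 : 2 * M ^ 2 * y ^ 2 + M ^ 2 * (a₁ ^ 2 + a₂ ^ 2) * y ^ 2
      + 2 * M ^ 2 * y ^ 2 * (a₀ ^ 2 / L + a₀ ^ 2 + a₁ ^ 2)
      = (M ^ 2 * (2 + 2 * a₀ ^ 2 + 3 * a₁ ^ 2 + a₂ ^ 2) + 2 * M ^ 2 / L * a₀ ^ 2) * y ^ 2 := by
      ring
    rw [e1, hC₂]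
    refine mul_le_mul_of_nonneg_right ?_ (sq_nonneg y)
    have q1 : M ^ 2 * (2 + 2 * a₀ ^ 2 + 3 * a₁ ^ 2 + a₂ ^ 2) ≤ M ^ 2 * (5 * X) :=
      mul_le_mul_of_nonneg_left
        (by linarith [sq_nonneg a₀, sq_nonneg a₁, sq_nonneg a₂]) (by positivity)
    have q2 : 2 * M ^ 2 / L * a₀ ^ 2 ≤ 2 * M ^ 2 / L * X :=
      mul_le_mul_of_nonneg_left
        (by linarith [sq_nonneg a₁, sq_nonneg a₂]) (by positivity)
    linarith
  have N3 : (C₁ + C₂) * X * (n ^ 2 + y ^ 2) = C₁ * X * n ^ 2 + C₂ * X * y ^ 2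
      + (C₂ * X * n ^ 2 + C₁ * X * y ^ 2) := by ring
  have N4 : 0 ≤ C₂ * X * n ^ 2 + C₁ * X * y ^ 2 := by positivity
  have N5 : e * σ ^ 2 = σ ^ 2 / 2 + 8 * M ^ 2 * k ^ 2 * σ ^ 2 := by rw [he]; ring
  rw [N3]
  linarith [sq_nonneg d]

theorem abs_integral_le_of_ae {μ : Measure ℝ} {F B : ℝ → ℝ} (hB : Integrable B μ)
    (h : ∀ᵐ x ∂μ, |F x| ≤ B x) : |∫ x, F x ∂μ| ≤ ∫ x, B x ∂μ :=
  norm_integral_le_of_norm_le (f := F) hB h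

theorem MemLp.integrable_abs_mul_abs {μ : Measure ℝ} {p q : ℝ → ℝ} (hp : MemLp p 2 μ)
    (hq : MemLp q 2 μ) : Integrable (fun x => |p x| * |q x|) μ := by
  simpa [abs_mul] using (MemLp.integrable_mul_two hp hq).abs

/-- Pointwise bound of a product of two linearised factors. -/
theorem abs_sub_prod_le {p q x y P D : ℝ} (hp : |p| ≤ P) (hq : |p - q| ≤ D) :
    |p * x - q * y| ≤ P * |x - y| + D * |y| := by
  rw [show p * x - q * y = p * (x - y) + (p - q) * y by ring]
  refine (abs_add_le _ _).trans ?_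
  rw [abs_mul, abs_mul]
  gcongr

/-- The right-hand side of the combined energy identity of two solutions, at a fixed time, is
controlled by the energy of their difference. -/
theorem exists_slice_estimate {a b M k : ℝ} (hab : a < b) {f f' : ℝ → ℝ} (hf : LipF f f' M)
    (hk : 0 ≤ k) : ∃ C, 0 ≤ C ∧ ∀ θ θ' θx θx' v₁ v₂ : ℝ → ℝ,
    MemLp θ 2 (volume.restrict (Ioo a b)) → MemLp θ' 2 (volume.restrict (Ioo a b)) →
    MemLp θx 2 (volume.restrict (Ioo a b)) → MemLp θx' 2 (volume.restrict (Ioo a b)) →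
    MemLp v₁ 2 (volume.restrict (Ioo a b)) → MemLp v₂ 2 (volume.restrict (Ioo a b)) →
    (∀ᵐ x ∂volume.restrict (Ioo a b), 0 ≤ θ x) → (∀ᵐ x ∂volume.restrict (Ioo a b), 0 ≤ θ' x) →
    WeakDerivI a b θ θx → WeakDerivI a b (fun x => θ x - θ' x) (fun x => θx x - θx' x) →
    √(∫ x in Ioo a b, v₂ x ^ 2) ≤ k →
    (-∫ x in Ioo a b, (f' (θ x) * θx x - f' (θ' x) * θx' x) * (v₁ x - v₂ x))
      + (-(∫ x in Ioo a b, (θx x - θx' x) ^ 2)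
      + (∫ x in Ioo a b, (f' (θ x) * θx x * v₁ x - f' (θ' x) * θx' x * v₂ x) * (θ x - θ' x))
      + ∫ x in Ioo a b, (f (θ x) * v₁ x - f (θ' x) * v₂ x) * (θx x - θx' x))
    ≤ C * (1 + (∫ x in Ioo a b, θ x ^ 2) + (∫ x in Ioo a b, θx x ^ 2)
      + ∫ x in Ioo a b, θx' x ^ 2)
      * ((∫ x in Ioo a b, (θ x - θ' x) ^ 2) + ∫ x in Ioo a b, (v₁ x - v₂ x) ^ 2) := by
  have hL : 0 < b - a := sub_pos.2 hab
  have hM := hf.nonneg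
  obtain ⟨C, hC, H⟩ := exists_absorb hM hk hL
  refine ⟨C, hC, ?_⟩
  intro θ θ' θx θx' v₁ v₂ mθ mθ' mθx mθx' mv₁ mv₂ pθ pθ' wθ wz hv₂
  have mz := mθ.sub mθ'
  have mzx := mθx.sub mθx'
  have mv := mv₁.sub mv₂
  have bz := sq_le_of_weakDerivI hab mz mzx wz
  have bθ := sq_le_of_weakDerivI hab mθ mθx wθ
  have sq0 : ∀ g : ℝ → ℝ, 0 ≤ ∫ x in Ioo a b, g x ^ 2 := fun g =>
    integral_nonneg fun x => sq_nonneg _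
  have key := H _ _ _ _ _ _
    (√((∫ x in Ioo a b, (θ x - θ' x) ^ 2) / (b - a) + 2 * (√(∫ x in Ioo a b, (θ x - θ' x) ^ 2)
      * √(∫ x in Ioo a b, (θx x - θx' x) ^ 2))))
    (√((∫ x in Ioo a b, θ x ^ 2) / (b - a) + 2 * (√(∫ x in Ioo a b, θ x ^ 2)
      * √(∫ x in Ioo a b, θx x ^ 2))))
    (Real.sqrt_nonneg (∫ x in Ioo a b, (θ x - θ' x) ^ 2))
    (Real.sqrt_nonneg (∫ x in Ioo a b, (θx x - θx' x) ^ 2))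
    (Real.sqrt_nonneg (∫ x in Ioo a b, (v₁ x - v₂ x) ^ 2))
    (Real.sqrt_nonneg (∫ x in Ioo a b, θ x ^ 2))
    (Real.sqrt_nonneg (∫ x in Ioo a b, θx x ^ 2))
    (Real.sqrt_nonneg (∫ x in Ioo a b, θx' x ^ 2))
    (by
      rw [Real.sq_sqrt (sq0 _), Real.sq_sqrt]
      have := sq0 fun x => θ x - θ' x
      positivity)
    (by
      rw [Real.sq_sqrt (sq0 _), Real.sq_sqrt]
      have := sq0 θ
      positivity)
  have cs1 := cauchySchwarz_abs mzx mv
  have cs2 := cauchySchwarz_abs mθx' mv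
  have cs3 := cauchySchwarz_abs mθx mv
  have cs4 := cauchySchwarz_abs mzx mv₂
  have cs5 := cauchySchwarz_abs mθx' mv₂
  simp only [Pi.sub_apply] at bz cs1 cs2 cs3 cs4 cs5
  have i1 := MemLp.integrable_abs_mul_abs mzx mv
  have i2 := MemLp.integrable_abs_mul_abs mθx' mv
  have i3 := MemLp.integrable_abs_mul_abs mθx mv
  have i4 := MemLp.integrable_abs_mul_abs mzx mv₂
  have i5 := MemLp.integrable_abs_mul_abs mθx' mv₂
  simp only [Pi.sub_apply] at i1 i2 i3 i4 i5
  have hd0 := Real.sqrt_nonneg (∫ x in Ioo a b, (θx x - θx' x) ^ 2)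
  have ha20 := Real.sqrt_nonneg (∫ x in Ioo a b, θx' x ^ 2)
  replace cs4 := cs4.trans (mul_le_mul_of_nonneg_left hv₂ hd0)
  replace cs5 := cs5.trans (mul_le_mul_of_nonneg_left hv₂ ha20)
  generalize hσ : √((∫ x in Ioo a b, (θ x - θ' x) ^ 2) / (b - a)
    + 2 * (√(∫ x in Ioo a b, (θ x - θ' x) ^ 2)
      * √(∫ x in Ioo a b, (θx x - θx' x) ^ 2))) = σ at key
  generalize hτ : √((∫ x in Ioo a b, θ x ^ 2) / (b - a) + 2 * (√(∫ x in Ioo a b, θ x ^ 2)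
      * √(∫ x in Ioo a b, θx x ^ 2))) = τ at key
  have hσ0 : 0 ≤ σ := hσ ▸ Real.sqrt_nonneg _
  have hτ0 : 0 ≤ τ := hτ ▸ Real.sqrt_nonneg _
  replace bz : ∀ᵐ x ∂volume.restrict (Ioo a b), |θ x - θ' x| ≤ σ := by
    filter_upwards [bz] with x hx
    rw [← hσ]
    exact Real.abs_le_sqrt hx
  replace bθ : ∀ᵐ x ∂volume.restrict (Ioo a b), |θ x| ≤ τ := by
    filter_upwards [bθ] with x hx
    rw [← hτ]
    exact Real.abs_le_sqrt hx
  clear hσ hτ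
  have E1 : |∫ x in Ioo a b, (f' (θ x) * θx x - f' (θ' x) * θx' x) * (v₁ x - v₂ x)|
      ≤ ∫ x in Ioo a b, (M * (|θx x - θx' x| * |v₁ x - v₂ x|)
        + M * σ * (|θx' x| * |v₁ x - v₂ x|)) := by
    refine abs_integral_le_of_ae ((i1.const_mul _).add (i2.const_mul _)) ?_
    filter_upwards [bz, pθ, pθ'] with x hz h1 h2
    rw [abs_mul]
    have := abs_sub_prod_le (x := θx x) (y := θx' x) (hf.bdd _ h1)
      ((hf.lip' _ _ h1 h2).trans (mul_le_mul_of_nonneg_left hz hM))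
    calc _ ≤ (M * |θx x - θx' x| + M * σ * |θx' x|) * |v₁ x - v₂ x| := by gcongr
      _ = _ := by ring
  have E2 : |∫ x in Ioo a b, (f' (θ x) * θx x * v₁ x - f' (θ' x) * θx' x * v₂ x)
        * (θ x - θ' x)|
      ≤ ∫ x in Ioo a b, (M * σ * (|θx x| * |v₁ x - v₂ x|) + M * σ * (|θx x - θx' x| * |v₂ x|)
        + M * σ ^ 2 * (|θx' x| * |v₂ x|)) := by
    refine abs_integral_le_of_ae
      (((i3.const_mul _).add (i4.const_mul _)).add (i5.const_mul _)) ?_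
    filter_upwards [bz, pθ, pθ'] with x hz h1 h2
    rw [abs_mul]
    have e1 := abs_sub_prod_le (x := θx x) (y := θx' x) (hf.bdd _ h1)
      ((hf.lip' _ _ h1 h2).trans (mul_le_mul_of_nonneg_left hz hM))
    have e2 : |f' (θ x) * θx x| ≤ M * |θx x| := by
      rw [abs_mul]
      exact mul_le_mul_of_nonneg_right (hf.bdd _ h1) (abs_nonneg _)
    have := abs_sub_prod_le (x := v₁ x) (y := v₂ x) e2 e1
    calc _ ≤ (M * |θx x| * |v₁ x - v₂ x|
          + (M * |θx x - θx' x| + M * σ * |θx' x|) * |v₂ x|) * σ := by gcongr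
      _ = _ := by ring
  have E3 : |∫ x in Ioo a b, (f (θ x) * v₁ x - f (θ' x) * v₂ x) * (θx x - θx' x)|
      ≤ ∫ x in Ioo a b, (M * τ * (|θx x - θx' x| * |v₁ x - v₂ x|)
        + M * σ * (|θx x - θx' x| * |v₂ x|)) := by
    refine abs_integral_le_of_ae ((i1.const_mul _).add (i4.const_mul _)) ?_
    filter_upwards [bz, bθ, pθ, pθ'] with x hz ht h1 h2
    rw [abs_mul]
    have e2 : |f (θ x)| ≤ M * τ := (hf.le _ h1).trans
      (mul_le_mul_of_nonneg_left ((le_abs_self _).trans ht) hM)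
    have := abs_sub_prod_le (x := v₁ x) (y := v₂ x) e2
      ((hf.lip _ _ h1 h2).trans (mul_le_mul_of_nonneg_left hz hM))
    calc _ ≤ (M * τ * |v₁ x - v₂ x| + M * σ * |v₂ x|) * |θx x - θx' x| := by gcongr
      _ = _ := by ring
  rw [integral_add (i1.const_mul _) (i2.const_mul _), integral_const_mul, integral_const_mul] at E1
  have i34 : Integrable (fun x => M * σ * (|θx x| * |v₁ x - v₂ x|)
      + M * σ * (|θx x - θx' x| * |v₂ x|)) (volume.restrict (Ioo a b)) :=
    (i3.const_mul _).add (i4.const_mul _)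
  rw [integral_add i34 (i5.const_mul _), integral_add (i3.const_mul _) (i4.const_mul _),
    integral_const_mul, integral_const_mul, integral_const_mul] at E2
  rw [integral_add (i1.const_mul _) (i4.const_mul _), integral_const_mul, integral_const_mul] at E3
  rw [Real.sq_sqrt (sq0 _), Real.sq_sqrt (sq0 _), Real.sq_sqrt (sq0 _), Real.sq_sqrt (sq0 _),
    Real.sq_sqrt (sq0 fun x => θ x - θ' x), Real.sq_sqrt (sq0 fun x => v₁ x - v₂ x)] at key
  have hMσ : 0 ≤ M * σ := mul_nonneg hM hσ0
  have hMτ : 0 ≤ M * τ := mul_nonneg hM hτ0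
  have hMσ2 : 0 ≤ M * σ ^ 2 := by positivity
  have m1 := mul_le_mul_of_nonneg_left cs1 hM
  have m2 := mul_le_mul_of_nonneg_left cs2 hMσ
  have m3 := mul_le_mul_of_nonneg_left cs3 hMσ
  have m4 := mul_le_mul_of_nonneg_left cs4 hMσ
  have m5 := mul_le_mul_of_nonneg_left cs5 hMσ2
  have m6 := mul_le_mul_of_nonneg_left cs1 hMτ
  have p1 := (neg_abs_le _).trans' (neg_le_neg E1)
  have p2 := (le_abs_self _).trans E2
  have p3 := (le_abs_self _).trans E3
  refine le_trans ?_ key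
  linarith

theorem pdt_tensor (ψ η : ℝ → ℝ) :
    pdt (fun x t => ψ x * η t) = fun x t => ψ x * deriv η t := by
  funext x t
  simp [pdt]

theorem pdx_tensor (ψ η : ℝ → ℝ) :
    pdx (fun x t => ψ x * η t) = fun x t => deriv ψ x * η t := by
  funext x t
  simp [pdx]

theorem contDiff_tensor {ψ η : ℝ → ℝ} (hψ : ContDiff ℝ (⊤ : ℕ∞) ψ) (hη : ContDiff ℝ (⊤ : ℕ∞) η) :
    ContDiff ℝ (⊤ : ℕ∞) (uncurry fun x t => ψ x * η t) :=
  (hψ.comp contDiff_fst).mul (hη.comp contDiff_snd)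

section
variable {a b T : ℝ} {f f' u0 u0t Θ0 : ℝ → ℝ} {u ut ux Θ Θx : ℝ → ℝ → ℝ}

theorem IsWeakSol.wave_tensor (h : IsWeakSol a b T f f' u0 u0t Θ0 u ut ux Θ Θx) {ψ η : ℝ → ℝ}
    (hψ : ContDiff ℝ (⊤ : ℕ∞) ψ) (hK : ∃ K : Set ℝ, IsCompact K ∧ K ⊆ Ioo a b ∧ ∀ x ∉ K, ψ x = 0)
    (hη : VanishLate T η) :
    tpair a b T u ψ (deriv (deriv η)) - intOm a b (fun x => u0t x * (ψ x * η 0))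
      + intOm a b (fun x => u0 x * (ψ x * deriv η 0))
      = -tpair a b T ux (deriv ψ) η - tpair a b T (fun x t => f' (Θ x t) * Θx x t) ψ η := by
  obtain ⟨K, hK1, hK2, hK3⟩ := hK
  obtain ⟨hη1, T', hT', hη2⟩ := hη
  have := h.weak_u (fun x t => ψ x * η t) ⟨contDiff_tensor hψ hη1,
    ⟨K, hK1, hK2, fun x t hx => by simp [hK3 x hx]⟩, T', hT', fun x t ht => by simp [hη2 t ht]⟩
  rw [pdt_tensor, pdt_tensor, pdx_tensor] at this
  exact this

theorem IsWeakSol.heat_tensor (h : IsWeakSol a b T f f' u0 u0t Θ0 u ut ux Θ Θx) {ψ η : ℝ → ℝ}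
    (hψ : ContDiff ℝ (⊤ : ℕ∞) ψ) (hη : VanishLate T η) :
    -tpair a b T Θ ψ (deriv η) - intOm a b (fun x => Θ0 x * (ψ x * η 0))
      = -tpair a b T Θx (deriv ψ) η + tpair a b T (fun x t => f' (Θ x t) * Θx x t * ut x t) ψ η
        + tpair a b T (fun x t => f (Θ x t) * ut x t) (deriv ψ) η := by
  obtain ⟨hη1, T', hT', hη2⟩ := hη
  have := h.weak_Θ (fun x t => ψ x * η t)
    ⟨contDiff_tensor hψ hη1, T', hT', fun x t ht => by simp [hη2 t ht]⟩
  rw [pdt_tensor, pdx_tensor] at this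
  exact this

theorem IsWeakSol.velocity_tensor (h : IsWeakSol a b T f f' u0 u0t Θ0 u ut ux Θ Θx) {ψ ρ : ℝ → ℝ}
    (hψ : ContDiff ℝ (⊤ : ℕ∞) ψ) (hK : ∃ K : Set ℝ, IsCompact K ∧ K ⊆ Ioo a b ∧ ∀ x ∉ K, ψ x = 0)
    (hρ : ContDiff ℝ (⊤ : ℕ∞) ρ) (hc : HasCompactSupport ρ) (hs : tsupport ρ ⊆ Ioo 0 T) :
    tpair a b T u ψ (deriv ρ) = -tpair a b T ut ψ ρ := by
  obtain ⟨K, hK1, hK2, hK3⟩ := hK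
  have := h.ut_weak (fun x t => ψ x * ρ t) ⟨contDiff_tensor hψ hρ,
    ⟨K, hK1, hK2, fun x t hx => by simp [hK3 x hx]⟩, tsupport ρ, hc, hs, fun x t ht => by
      simp [image_eq_zero_of_notMem_tsupport ht]⟩
  rw [pdt_tensor] at this
  exact this

theorem ContL2.exists_bound {w : ℝ → ℝ → ℝ} (hw : ContL2 a b (Icc 0 T) w) :
    ∃ k, 0 ≤ k ∧ ∀ t ∈ Icc 0 T, √(∫ x in Ioo a b, w x t ^ 2) ≤ k := by
  obtain ⟨C, hC⟩ := isCompact_Icc.exists_bound_of_continuousOn hw.continuousOn_sq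
  exact ⟨√C, Real.sqrt_nonneg _, fun t ht => Real.sqrt_le_sqrt ((le_abs_self _).trans (hC t ht))⟩

theorem ae_mem_Ioo_time {P : ℝ → Prop} (h : ∀ t ∈ Icc 0 T, P t) :
    ∀ᵐ t ∂volume.restrict (Ioo 0 T), P t := by
  filter_upwards [ae_restrict_mem measurableSet_Ioo] with t ht using h t (Ioo_subset_Icc_self ht)

theorem IsWeakSol.l2t_flux
    (h : IsWeakSol a b T f f' u0 u0t Θ0 u ut ux Θ Θx) (hr : RegT a b T u ut ux Θ Θx)
    {M : ℝ} (hf : LipF f f' M) :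
    L2T a b T fun x t => f' (Θ x t) * Θx x t := by
  refine L2T.of_sq_int h.g1_int ((hr.Θx_sq_int.const_mul (M ^ 2)).mono'
    (h.g1_int.aestronglyMeasurable.pow 2) ?_)
  filter_upwards [h.Θ_nonneg] with p hp
  rw [Real.norm_eq_abs, abs_of_nonneg (sq_nonneg _), mul_pow]
  exact mul_le_mul_of_nonneg_right (sq_le_sq.2 ((hf.bdd _ hp).trans (le_abs_self _)))
    (sq_nonneg _)

theorem IsWeakSol.integrable_sq_source
    (h : IsWeakSol a b T f f' u0 u0t Θ0 u ut ux Θ Θx) (hr : RegT a b T u ut ux Θ Θx)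
    {M : ℝ} (hf : LipF f f' M) :
    IntegrableOn (fun t => (∫ x in Ioo a b, |f' (Θ x t) * Θx x t * ut x t|) ^ 2) (Ioo 0 T) := by
  obtain ⟨k, hk0, hk⟩ := hr.ut_cont.exists_bound
  have LΘx := L2T.of_sq_int h.Θx_int hr.Θx_sq_int
  refine (LΘx.sq.const_mul ((M * k) ^ 2)).mono'
    ((aesm_time_integral (h := fun x t => |f' (Θ x t) * Θx x t * ut x t|)
      h.g2_int.aestronglyMeasurable.norm).pow 2) ?_
  filter_upwards [LΘx.slice, ae_time_of_ae (P := fun x t => 0 ≤ Θ x t) h.Θ_nonneg,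
    ae_mem_Ioo_time hr.ut_cont.1, ae_mem_Ioo_time hk] with t m1 p m2 k1
  have hM := hf.nonneg
  have m2 := m2.memLp
  rw [Real.norm_eq_abs, abs_pow]
  have : |∫ x in Ioo a b, (|f' (Θ x t) * Θx x t * ut x t|)|
      ≤ ∫ x in Ioo a b, M * (|Θx x t| * |ut x t|) := by
    refine abs_integral_le_of_ae ((MemLp.integrable_abs_mul_abs m1 m2).const_mul _) ?_
    filter_upwards [p] with x hx
    rw [abs_abs, abs_mul, abs_mul, mul_assoc]
    exact mul_le_mul_of_nonneg_right (hf.bdd _ hx) (by positivity)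
  rw [integral_const_mul] at this
  have c := (cauchySchwarz_abs m1 m2).trans
    (mul_le_mul_of_nonneg_left k1 (Real.sqrt_nonneg _))
  have := this.trans (mul_le_mul_of_nonneg_left c hM)
  refine (pow_le_pow_left₀ (abs_nonneg _) this 2).trans_eq ?_
  rw [mul_pow, mul_pow, Real.sq_sqrt (integral_nonneg fun x => sq_nonneg _)]
  ring

theorem IsWeakSol.l2t_heat_flux (hab : a < b)
    (h : IsWeakSol a b T f f' u0 u0t Θ0 u ut ux Θ Θx) (hr : RegT a b T u ut ux Θ Θx)
    {M : ℝ} (hf : LipF f f' M) :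
    L2T a b T fun x t => f (Θ x t) * ut x t := by
  obtain ⟨k, hk0, hk⟩ := hr.ut_cont.exists_bound
  have LΘx := L2T.of_sq_int h.Θx_int hr.Θx_sq_int
  have LΘ := L2T.of_contL2 hr.Θ_cont h.Θ_int
  have hL : 0 < b - a := sub_pos.2 hab
  have hM := hf.nonneg
  have key : ∀ᵐ t ∂volume.restrict (Ioo 0 T),
      MemLp (fun x => f (Θ x t) * ut x t) 2 (volume.restrict (Ioo a b)) ∧
      ∫ x in Ioo a b, (f (Θ x t) * ut x t) ^ 2 ≤ (M * k) ^ 2 *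
        ((1 / (b - a) + 1) * (∫ x in Ioo a b, Θ x t ^ 2) + ∫ x in Ioo a b, Θx x t ^ 2) := by
    filter_upwards [LΘx.slice, LΘ.slice, ae_time_of_ae (P := fun x t => 0 ≤ Θ x t) h.Θ_nonneg,
      ae_mem_Ioo_time hr.ut_cont.1, ae_mem_Ioo_time hk, h.Θ_W,
      aesm_time (h := fun x t => f (Θ x t) * ut x t) h.g3_int.aestronglyMeasurable]
      with t m1 m0 p m2 k1 hW ms
    have m2 := m2.memLp
    have A0 : 0 ≤ ∫ x in Ioo a b, Θ x t ^ 2 := integral_nonneg fun x => sq_nonneg _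
    have B0 : 0 ≤ ∫ x in Ioo a b, Θx x t ^ 2 := integral_nonneg fun x => sq_nonneg _
    have D0 : 0 ≤ ∫ x in Ioo a b, ut x t ^ 2 := integral_nonneg fun x => sq_nonneg _
    have hs := sq_le_of_weakDerivI hab m0 m1 hW
    have b1 : (∫ x in Ioo a b, Θ x t ^ 2) / (b - a)
        + 2 * (√(∫ x in Ioo a b, Θ x t ^ 2) * √(∫ x in Ioo a b, Θx x t ^ 2))
        ≤ (1 / (b - a) + 1) * (∫ x in Ioo a b, Θ x t ^ 2) + ∫ x in Ioo a b, Θx x t ^ 2 := by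
      have e := two_mul_le_add_sq (√(∫ x in Ioo a b, Θ x t ^ 2)) (√(∫ x in Ioo a b, Θx x t ^ 2))
      rw [Real.sq_sqrt A0, Real.sq_sqrt B0] at e
      have : (∫ x in Ioo a b, Θ x t ^ 2) / (b - a) = 1 / (b - a) * ∫ x in Ioo a b, Θ x t ^ 2 := by
        ring
      linarith
    generalize (1 / (b - a) + 1) * (∫ x in Ioo a b, Θ x t ^ 2) + ∫ x in Ioo a b, Θx x t ^ 2
      = τ at b1
    have hτ : 0 ≤ τ := le_trans (by positivity) b1
    have hle : ∀ᵐ x ∂volume.restrict (Ioo a b), |f (Θ x t) * ut x t| ≤ M * √τ * |ut x t| := by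
      filter_upwards [hs, p] with x hx px
      rw [abs_mul]
      have : Θ x t ≤ √τ := Real.le_sqrt_of_sq_le (hx.trans b1)
      have := (hf.le _ px).trans (mul_le_mul_of_nonneg_left this hM)
      gcongr
    refine ⟨MemLp.of_le_mul m2 ms hle, ?_⟩
    have : ∫ x in Ioo a b, (f (Θ x t) * ut x t) ^ 2
        ≤ ∫ x in Ioo a b, (M * √τ) ^ 2 * ut x t ^ 2 := by
      refine (le_abs_self _).trans (abs_integral_le_of_ae (m2.integrable_sq.const_mul _) ?_)
      filter_upwards [hle] with x hx
      rw [abs_pow, ← sq_abs (ut x t), ← mul_pow]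
      exact pow_le_pow_left₀ (abs_nonneg _) hx 2
    refine this.trans ?_
    rw [integral_const_mul, mul_pow, Real.sq_sqrt hτ]
    have k2 : ∫ x in Ioo a b, ut x t ^ 2 ≤ k ^ 2 := (Real.sqrt_le_left hk0).1 k1
    calc M ^ 2 * τ * ∫ x in Ioo a b, ut x t ^ 2 ≤ M ^ 2 * τ * k ^ 2 := by gcongr
      _ = _ := by ring
  exact L2T.of_le h.g3_int (key.mono fun t ht => ht.1)
    (((LΘ.sq.const_mul _).add LΘx.sq).const_mul _) (key.mono fun t ht => ht.2)

end

theorem WeakDerivZ.sub {a b : ℝ} {g g' h h' : ℝ → ℝ}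
    (ig : Integrable g (volume.restrict (Ioo a b))) (ig' : Integrable g' (volume.restrict (Ioo a b)))
    (ih : Integrable h (volume.restrict (Ioo a b))) (ih' : Integrable h' (volume.restrict (Ioo a b)))
    (hg : WeakDerivZ a b g g') (hh : WeakDerivZ a b h h') :
    WeakDerivZ a b (fun x => g x - h x) fun x => g' x - h' x := by
  intro ψ hψ
  have c := hψ.continuous
  have c' := hψ.smooth_deriv.continuous
  simp only [sub_mul]
  rw [integral_sub (Integrable.mul_continuous_Ioo ig c') (Integrable.mul_continuous_Ioo ih c'),
    integral_sub (Integrable.mul_continuous_Ioo ig' c) (Integrable.mul_continuous_Ioo ih' c),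
    hg ψ hψ, hh ψ hψ]
  ring

theorem WeakDerivI.sub {a b : ℝ} {g g' h h' : ℝ → ℝ}
    (ig : Integrable g (volume.restrict (Ioo a b))) (ig' : Integrable g' (volume.restrict (Ioo a b)))
    (ih : Integrable h (volume.restrict (Ioo a b))) (ih' : Integrable h' (volume.restrict (Ioo a b)))
    (hg : WeakDerivI a b g g') (hh : WeakDerivI a b h h') :
    WeakDerivI a b (fun x => g x - h x) fun x => g' x - h' x := by
  intro ψ hψ hs
  have c := hψ.continuous
  have c' := hψ.smooth_deriv.continuous
  simp only [sub_mul]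
  rw [integral_sub (Integrable.mul_continuous_Ioo ig c') (Integrable.mul_continuous_Ioo ih c'),
    integral_sub (Integrable.mul_continuous_Ioo ig' c) (Integrable.mul_continuous_Ioo ih' c),
    hg ψ hψ hs, hh ψ hψ hs]
  ring

/-- Two space-time functions with almost everywhere equal time slices agree almost everywhere. -/
theorem ae_eq_of_slices {a b T : ℝ} {w w' : ℝ → ℝ → ℝ}
    (iw : IntegrableOn (fun p : ℝ × ℝ => w p.1 p.2) (Ioo a b ×ˢ Ioo 0 T))
    (iw' : IntegrableOn (fun p : ℝ × ℝ => w' p.1 p.2) (Ioo a b ×ˢ Ioo 0 T))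
    (h : ∀ t ∈ Icc 0 T, ∀ᵐ x ∂volume.restrict (Ioo a b), w x t = w' x t) :
    ∀ᵐ p ∂volume.restrict (Ioo a b ×ˢ Ioo 0 T), w p.1 p.2 = w' p.1 p.2 := by
  have i := (iw.sub iw').abs
  have h0 : ∫ p in Ioo a b ×ˢ Ioo 0 T, |w p.1 p.2 - w' p.1 p.2| = 0 := by
    have i2 := i
    rw [restrict_prod_Ioo] at i2 ⊢
    refine (integral_prod_symm _ i2).trans ?_
    refine integral_eq_zero_of_ae ?_
    filter_upwards [ae_mem_Ioo_time h] with t ht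
    refine integral_eq_zero_of_ae ?_
    filter_upwards [ht] with x hx
    simp [hx]
  have := (integral_eq_zero_iff_of_nonneg (fun p => abs_nonneg _) i).1 h0
  filter_upwards [this] with p hp
  simpa [sub_eq_zero] using hp

theorem ae_eq_of_integral_sq {μ : Measure ℝ} {p q : ℝ → ℝ} (hp : MemLp p 2 μ) (hq : MemLp q 2 μ)
    (h : ∫ x, (p x - q x) ^ 2 ∂μ = 0) : ∀ᵐ x ∂μ, p x = q x := by
  have := (integral_eq_zero_iff_of_nonneg (fun x => sq_nonneg _) (hp.sub hq).integrable_sq).1 h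
  filter_upwards [this] with x hx
  simpa [sub_eq_zero] using hx

section
variable {a b T : ℝ} {f f' u0 u0t Θ0 : ℝ → ℝ} {u ut ux Θ Θx u' ut' ux' Θ' Θx' : ℝ → ℝ → ℝ}

theorem IsWeakSol.wave_modes_sub (hab : a < b) (hT : 0 < T)
    (h1 : IsWeakSol a b T f f' u0 u0t Θ0 u ut ux Θ Θx) (h1r : RegT a b T u ut ux Θ Θx)
    (h2 : IsWeakSol a b T f f' u0 u0t Θ0 u' ut' ux' Θ' Θx')
    (h2r : RegT a b T u' ut' ux' Θ' Θx') (n : ℕ) :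
    ∀ t ∈ Icc 0 T, md a b (sinB a b n) (fun x t => u x t - u' x t) t
        = ∫ s in 0..t, md a b (sinB a b n) (fun x t => ut x t - ut' x t) s ∧
      md a b (sinB a b n) (fun x t => ut x t - ut' x t) t = ∫ s in 0..t,
        -(frq a b n ^ 2 * md a b (sinB a b n) (fun x t => u x t - u' x t) s
          + md a b (sinB a b n)
            (fun x t => f' (Θ x t) * Θx x t - f' (Θ' x t) * Θx' x t) s) := by
  refine wave_modes hab hT (h1r.u_cont.sub h2r.u_cont) (h1r.ut_cont.sub h2r.ut_cont)
    (wx := fun x t => ux x t - ux' x t)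
    (h1.u_int.sub h2.u_int) (h1.ux_int.sub h2.ux_int) (h1.ut_int.sub h2.ut_int)
    (h1.g1_int.sub h2.g1_int) (fun t ht => WeakDerivZ.sub
      (MemLp.integrable_two (h1r.u_cont.1 t ht).memLp)
      (MemLp.integrable_two (h1r.ux_cont.1 t ht).memLp)
      (MemLp.integrable_two (h2r.u_cont.1 t ht).memLp)
      (MemLp.integrable_two (h2r.ux_cont.1 t ht).memLp) (h1r.u_W0 t ht) (h2r.u_W0 t ht)) ?_ ?_ n
  · intro ψ hψ hK η hη
    have c := hψ.continuous
    have c' := hψ.smooth_deriv.continuous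
    have d := hη.1.continuous
    have d'' := hη.1.smooth_deriv.smooth_deriv.continuous
    rw [tpair_sub h1.u_int h2.u_int c d'', tpair_sub h1.ux_int h2.ux_int c' d,
      tpair_sub (h := fun x t => f' (Θ x t) * Θx x t) (h' := fun x t => f' (Θ' x t) * Θx' x t)
        h1.g1_int h2.g1_int c d]
    linarith [h1.wave_tensor hψ hK hη, h2.wave_tensor hψ hK hη]
  · intro ψ hψ hK ρ hρ hc hs
    rw [tpair_sub h1.u_int h2.u_int hψ.continuous hρ.smooth_deriv.continuous,
      tpair_sub h1.ut_int h2.ut_int hψ.continuous hρ.continuous]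
    linarith [h1.velocity_tensor hψ hK hρ hc hs, h2.velocity_tensor hψ hK hρ hc hs]

theorem IsWeakSol.heat_modes_sub (hT : 0 < T)
    (h1 : IsWeakSol a b T f f' u0 u0t Θ0 u ut ux Θ Θx) (h1r : RegT a b T u ut ux Θ Θx)
    (h2 : IsWeakSol a b T f f' u0 u0t Θ0 u' ut' ux' Θ' Θx')
    (h2r : RegT a b T u' ut' ux' Θ' Θx') (n : ℕ) :
    ∀ t ∈ Icc 0 T, md a b (cosB a b n) (fun x t => Θ x t - Θ' x t) t = ∫ s in 0..t,
      (frq a b n * md a b (sinB a b n) (fun x t => Θx x t - Θx' x t) s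
        + md a b (cosB a b n) (fun x t => f' (Θ x t) * Θx x t * ut x t
          - f' (Θ' x t) * Θx' x t * ut' x t) s
        - frq a b n * md a b (sinB a b n)
          (fun x t => f (Θ x t) * ut x t - f (Θ' x t) * ut' x t) s) := by
  refine heat_modes hT (h1r.Θ_cont.sub h2r.Θ_cont) (h1.Θ_int.sub h2.Θ_int)
    (h1.Θx_int.sub h2.Θx_int) (h1.g2_int.sub h2.g2_int) (h1.g3_int.sub h2.g3_int) ?_ n
  intro ψ hψ η hη
  have c := hψ.continuous
  have c' := hψ.smooth_deriv.continuous
  have d := hη.1.continuous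
  rw [tpair_sub h1.Θ_int h2.Θ_int c hη.1.smooth_deriv.continuous,
    tpair_sub h1.Θx_int h2.Θx_int c' d,
    tpair_sub (h := fun x t => f' (Θ x t) * Θx x t * ut x t)
      (h' := fun x t => f' (Θ' x t) * Θx' x t * ut' x t) h1.g2_int h2.g2_int c d,
    tpair_sub (h := fun x t => f (Θ x t) * ut x t)
      (h' := fun x t => f (Θ' x t) * ut' x t) h1.g3_int h2.g3_int c' d]
  linarith [h1.heat_tensor hψ hη, h2.heat_tensor hψ hη]

theorem integrable_sq_source_sub
    {G G' : ℝ → ℝ → ℝ}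
    (iG : IntegrableOn (fun p : ℝ × ℝ => G p.1 p.2) (Ioo a b ×ˢ Ioo 0 T))
    (iG' : IntegrableOn (fun p : ℝ × ℝ => G' p.1 p.2) (Ioo a b ×ˢ Ioo 0 T))
    (h : IntegrableOn (fun t => (∫ x in Ioo a b, |G x t|) ^ 2) (Ioo 0 T))
    (h' : IntegrableOn (fun t => (∫ x in Ioo a b, |G' x t|) ^ 2) (Ioo 0 T)) :
    IntegrableOn (fun t => (∫ x in Ioo a b, |G x t - G' x t|) ^ 2) (Ioo 0 T) := by
  refine ((h.add h').const_mul 2).mono'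
    ((aesm_time_integral (h := fun x t => |G x t - G' x t|)
      (iG.sub iG').aestronglyMeasurable.norm).pow 2) ?_
  filter_upwards [integrable_time_slice iG, integrable_time_slice iG'] with t i i'
  have : ∫ x in Ioo a b, |G x t - G' x t|
      ≤ (∫ x in Ioo a b, |G x t|) + ∫ x in Ioo a b, |G' x t| := by
    rw [← integral_add i.abs i'.abs]
    exact integral_mono (i.sub i').abs (i.abs.add i'.abs) fun x => abs_sub _ _
  rw [Real.norm_eq_abs, abs_of_nonneg (sq_nonneg _)]
  have h0 : 0 ≤ ∫ x in Ioo a b, |G x t - G' x t| := integral_nonneg fun x => abs_nonneg _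
  refine (pow_le_pow_left₀ h0 this 2).trans ?_
  exact add_sq_le

end

section
variable {a b T : ℝ} {f f' f'' u0 u0t Θ0 : ℝ → ℝ} {u ut ux Θ Θx u' ut' ux' Θ' Θx' : ℝ → ℝ → ℝ}

theorem L2T.integrableOn_pair {h h' : ℝ → ℝ → ℝ} (hh : L2T a b T h) (hh' : L2T a b T h') :
    IntegrableOn (fun t => ∫ x in Ioo a b, h x t * h' x t) (Ioo 0 T) := by
  refine (hh.sq.add hh'.sq).mono' (aesm_time_integral (h := fun x t => h x t * h' x t)
    (hh.int.aestronglyMeasurable.mul hh'.int.aestronglyMeasurable)) ?_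
  filter_upwards [hh.slice, hh'.slice] with t m m'
  have A0 : 0 ≤ ∫ x in Ioo a b, h x t ^ 2 := integral_nonneg fun _ => sq_nonneg _
  have B0 : 0 ≤ ∫ x in Ioo a b, h' x t ^ 2 := integral_nonneg fun _ => sq_nonneg _
  have e := two_mul_le_add_sq (√(∫ x in Ioo a b, h x t ^ 2)) (√(∫ x in Ioo a b, h' x t ^ 2))
  rw [Real.sq_sqrt A0, Real.sq_sqrt B0] at e
  have := cauchySchwarz m m'
  have p := mul_nonneg (Real.sqrt_nonneg (∫ x in Ioo a b, h x t ^ 2))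
    (Real.sqrt_nonneg (∫ x in Ioo a b, h' x t ^ 2))
  rw [Real.norm_eq_abs]
  simp only [Pi.add_apply]
  linarith

theorem integrableOn_source_pair (hab : a < b) {z zx G : ℝ → ℝ → ℝ} (Lz : L2T a b T z)
    (Lzx : L2T a b T zx)
    (iG : IntegrableOn (fun p : ℝ × ℝ => G p.1 p.2) (Ioo a b ×ˢ Ioo 0 T))
    (iG2 : IntegrableOn (fun t => (∫ x in Ioo a b, |G x t|) ^ 2) (Ioo 0 T))
    (hD : ∀ᵐ t ∂volume.restrict (Ioo 0 T), WeakDerivI a b (fun x => z x t) (fun x => zx x t)) :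
    IntegrableOn (fun t => ∫ x in Ioo a b, G x t * z x t) (Ioo 0 T) := by
  refine (iG2.add ((Lz.sq.const_mul (1 / (b - a) + 1)).add Lzx.sq)).mono'
    (aesm_time_integral (h := fun x t => G x t * z x t)
      (iG.aestronglyMeasurable.mul Lz.int.aestronglyMeasurable)) ?_
  filter_upwards [Lz.slice, Lzx.slice, hD, integrable_time_slice iG] with t m0 m1 d g
  have hL : 0 < b - a := sub_pos.2 hab
  have A0 : 0 ≤ ∫ x in Ioo a b, z x t ^ 2 := integral_nonneg fun x => sq_nonneg _
  have B0 : 0 ≤ ∫ x in Ioo a b, zx x t ^ 2 := integral_nonneg fun x => sq_nonneg _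
  have b1 := le_trans
    (le_of_eq (by ring : (∫ x in Ioo a b, z x t ^ 2) / (b - a)
        + 2 * (√(∫ x in Ioo a b, z x t ^ 2) * √(∫ x in Ioo a b, zx x t ^ 2))
        = 1 / (b - a) * (∫ x in Ioo a b, z x t ^ 2)
        + 2 * √(∫ x in Ioo a b, z x t ^ 2) * √(∫ x in Ioo a b, zx x t ^ 2)))
    (add_le_add_right (two_mul_le_add_sq (√(∫ x in Ioo a b, z x t ^ 2))
      (√(∫ x in Ioo a b, zx x t ^ 2))) _)
  rw [Real.sq_sqrt A0, Real.sq_sqrt B0] at b1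
  have hs := sq_le_of_weakDerivI hab m0 m1 d
  simp only [Pi.add_apply]
  obtain ⟨σ, hσ⟩ : ∃ σ, σ = 1 / (b - a) * (∫ x in Ioo a b, z x t ^ 2)
    + ((∫ x in Ioo a b, z x t ^ 2) + ∫ x in Ioo a b, zx x t ^ 2) := ⟨_, rfl⟩
  rw [← hσ] at b1
  have hσ0 : 0 ≤ σ := by rw [hσ]; positivity
  have : |∫ x in Ioo a b, G x t * z x t| ≤ ∫ x in Ioo a b, √σ * |G x t| := by
    refine abs_integral_le_of_ae (g.abs.const_mul _) ?_
    filter_upwards [hs] with x hx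
    rw [abs_mul, mul_comm]
    exact mul_le_mul_of_nonneg_right (Real.abs_le_sqrt (hx.trans b1)) (abs_nonneg _)
  rw [integral_const_mul] at this
  rw [Real.norm_eq_abs]
  have e := two_mul_le_add_sq (√σ) (∫ x in Ioo a b, |G x t|)
  rw [Real.sq_sqrt hσ0] at e
  have p := mul_nonneg (Real.sqrt_nonneg σ)
    (integral_nonneg (μ := volume.restrict (Ioo a b)) fun x => abs_nonneg (G x t))
  linarith

/-- The energy of the difference of two weak solutions vanishes at all times. -/
theorem IsWeakSol.energy_sub_eq_zero (hab : a < b) (hT : 0 < T) (hf : HypF f f' f'')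
    (h1 : IsWeakSol a b T f f' u0 u0t Θ0 u ut ux Θ Θx) (h1r : RegT a b T u ut ux Θ Θx)
    (h2 : IsWeakSol a b T f f' u0 u0t Θ0 u' ut' ux' Θ' Θx')
    (h2r : RegT a b T u' ut' ux' Θ' Θx') :
    ∀ t ∈ Icc 0 T, (∫ x in Ioo a b, (Θ x t - Θ' x t) ^ 2)
      + ∫ x in Ioo a b, (ut x t - ut' x t) ^ 2 = 0 := by
  obtain ⟨M, hM⟩ := hf.exists_lipF
  obtain ⟨k, hk0, hk⟩ := h2r.ut_cont.exists_bound
  obtain ⟨C, hC, hslice⟩ := exists_slice_estimate hab hM hk0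
  have Lv := (L2T.of_contL2 h1r.ut_cont h1.ut_int).sub (L2T.of_contL2 h2r.ut_cont h2.ut_int)
  have LΘ := L2T.of_contL2 h1r.Θ_cont h1.Θ_int
  have LΘ' := L2T.of_contL2 h2r.Θ_cont h2.Θ_int
  have LΘx := L2T.of_sq_int h1.Θx_int h1r.Θx_sq_int
  have LΘx' := L2T.of_sq_int h2.Θx_int h2r.Θx_sq_int
  have Lz := LΘ.sub LΘ'
  have Lzx := LΘx.sub LΘx'
  have LF := (h1.l2t_flux h1r hM).sub (h2.l2t_flux h2r hM)
  have LH := (h1.l2t_heat_flux hab h1r hM).sub (h2.l2t_heat_flux hab h2r hM)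
  have cz := h1r.Θ_cont.sub h2r.Θ_cont
  have cv := h1r.ut_cont.sub h2r.ut_cont
  have iG : IntegrableOn (fun p : ℝ × ℝ => f' (Θ p.1 p.2) * Θx p.1 p.2 * ut p.1 p.2
      - f' (Θ' p.1 p.2) * Θx' p.1 p.2 * ut' p.1 p.2) (Ioo a b ×ˢ Ioo 0 T) :=
    h1.g2_int.sub h2.g2_int
  have iG2 := integrable_sq_source_sub (G := fun x t => f' (Θ x t) * Θx x t * ut x t)
    (G' := fun x t => f' (Θ' x t) * Θx' x t * ut' x t) h1.g2_int h2.g2_int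
    (h1.integrable_sq_source h1r hM) (h2.integrable_sq_source h2r hM)
  have hD : ∀ᵐ t ∂volume.restrict (Ioo 0 T),
      WeakDerivI a b (fun x => Θ x t - Θ' x t) (fun x => Θx x t - Θx' x t) := by
    filter_upwards [h1.Θ_W, h2.Θ_W, LΘ.slice, LΘ'.slice, LΘx.slice, LΘx'.slice]
      with t d d' m m' mx mx'
    exact WeakDerivI.sub (MemLp.integrable_two m) (MemLp.integrable_two mx)
      (MemLp.integrable_two m') (MemLp.integrable_two mx') d d'
  have EW := wave_energy hab hT (h1r.u_cont.sub h2r.u_cont) cv (h1.u_int.sub h2.u_int) Lv LF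
    (IsWeakSol.wave_modes_sub hab hT h1 h1r h2 h2r)
  have EH := heat_energy hab hT cz Lz Lzx LH iG iG2 hD
    (IsWeakSol.heat_modes_sub hT h1 h1r h2 h2r)
  have iP := (LF.integrableOn_pair Lv).neg
  have iQ := (Lzx.sq.neg.add (integrableOn_source_pair hab Lz Lzx iG iG2 hD)).add
    (LH.integrableOn_pair Lzx)
  have iA : IntegrableOn (fun t => 2 * C * (1 + (∫ x in Ioo a b, Θ x t ^ 2)
      + (∫ x in Ioo a b, Θx x t ^ 2) + ∫ x in Ioo a b, Θx' x t ^ 2)) (Ioo 0 T) := by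
    have i1 : IntegrableOn (fun _ : ℝ => (1 : ℝ)) (Ioo 0 T) := by simp
    exact (((i1.add LΘ.sq).add LΘx.sq).add LΘx'.sq).const_mul _
  have cy := cz.continuousOn_sq.add cv.continuousOn_sq
  refine gronwall_zero hT cy iA (fun t _ => ?_) (fun t => ?_) fun t ht => ?_
  · exact add_nonneg (integral_nonneg fun _ => sq_nonneg _) (integral_nonneg fun _ => sq_nonneg _)
  · have n0 : 0 ≤ ∫ x in Ioo a b, Θ x t ^ 2 := integral_nonneg fun _ => sq_nonneg _
    have n1 : 0 ≤ ∫ x in Ioo a b, Θx x t ^ 2 := integral_nonneg fun _ => sq_nonneg _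
    have n2 : 0 ≤ ∫ x in Ioo a b, Θx' x t ^ 2 := integral_nonneg fun _ => sq_nonneg _
    positivity
  · have iAy := integrableOn_continuousOn_mul cy iA
    have jP := intervalIntegrable_of_Icc ht iP
    have jQ := intervalIntegrable_of_Icc ht iQ
    refine (add_le_add (EH t ht).le (EW t ht)).trans ?_
    rw [← mul_add, add_comm]
    refine (congrArg (2 * ·) (intervalIntegral.integral_add jP jQ)).symm.le.trans ?_
    rw [← intervalIntegral.integral_const_mul, ← integral_Ioo_eq ht.1, ← integral_Ioo_eq ht.1]
    have hsub := Ioo_restrict_le ht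
    refine integral_mono_ae (((iP.add iQ).const_mul 2).mono_measure hsub)
      (Integrable.mono_measure (by simpa only [mul_comm, Pi.add_apply, IntegrableOn] using iAy) hsub)
      (ae_mono hsub ?_)
    filter_upwards [hD, h1.Θ_W, LΘ.slice, LΘ'.slice, LΘx.slice, LΘx'.slice,
      ae_mem_Ioo_time h1r.ut_cont.1, ae_mem_Ioo_time h2r.ut_cont.1, ae_mem_Ioo_time hk,
      ae_time_of_ae (P := fun x t => 0 ≤ Θ x t) h1.Θ_nonneg,
      ae_time_of_ae (P := fun x t => 0 ≤ Θ' x t) h2.Θ_nonneg]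
      with s d d1 m m' mx mx' mv mv' ks p p'
    have := hslice _ _ _ _ _ _ m m' mx mx' mv.memLp mv'.memLp p p' d1 d ks
    refine (mul_le_mul_of_nonneg_left this zero_le_two).trans_eq ?_
    ring

end

/-- Proposition 3.4: uniqueness of weak solutions in the class (R_T). -/
theorem statement6
    (a b : ℝ) (hab : a < b)
    (f f' f'' : ℝ → ℝ) (hf : HypF f f' f'')
    (u0 u0x u0t Θ0 : ℝ → ℝ) (hdata : DataI a b u0 u0x u0t Θ0)
    (T : ℝ) (hT : 0 < T)
    (u ut ux Θ Θx u' ut' ux' Θ' Θx' : ℝ → ℝ → ℝ)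
    (h1 : IsWeakSol a b T f f' u0 u0t Θ0 u ut ux Θ Θx)
    (h1r : RegT a b T u ut ux Θ Θx)
    (h2 : IsWeakSol a b T f f' u0 u0t Θ0 u' ut' ux' Θ' Θx')
    (h2r : RegT a b T u' ut' ux' Θ' Θx') :
    (∀ᵐ p ∂volume.restrict ((Ioo a b) ×ˢ (Ioo 0 T)), u p.1 p.2 = u' p.1 p.2) ∧
    (∀ᵐ p ∂volume.restrict ((Ioo a b) ×ˢ (Ioo 0 T)), Θ p.1 p.2 = Θ' p.1 p.2) := by
  have hE := IsWeakSol.energy_sub_eq_zero hab hT hf h1 h1r h2 h2r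
  have hsq : ∀ g : ℝ → ℝ, 0 ≤ ∫ x in Ioo a b, g x ^ 2 := fun g =>
    integral_nonneg fun _ => sq_nonneg _
  have hΘ : ∀ t ∈ Icc 0 T, ∫ x in Ioo a b, (Θ x t - Θ' x t) ^ 2 = 0 := fun t ht =>
    le_antisymm (by linarith [hE t ht, hsq fun x => ut x t - ut' x t]) (hsq _)
  have hv : ∀ t ∈ Icc 0 T, ∫ x in Ioo a b, (ut x t - ut' x t) ^ 2 = 0 := fun t ht =>
    le_antisymm (by linarith [hE t ht, hsq fun x => Θ x t - Θ' x t]) (hsq _)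
  refine ⟨ae_eq_of_slices h1.u_int h2.u_int fun t ht => ?_, ae_eq_of_slices h1.Θ_int h2.Θ_int
    fun t ht => ae_eq_of_integral_sq (h1r.Θ_cont.1 t ht).memLp (h2r.Θ_cont.1 t ht).memLp (hΘ t ht)⟩
  have mw := (h1r.u_cont.1 t ht).memLp.sub (h2r.u_cont.1 t ht).memLp
  have := complete_sinB hab (MemLp.integrable_two mw) fun n => by
    have e := (IsWeakSol.wave_modes_sub hab hT h1 h1r h2 h2r (n + 1) t ht).1
    refine e.trans ?_
    rw [intervalIntegral.integral_congr (g := fun _ => (0 : ℝ)), intervalIntegral.integral_zero]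
    intro s hs
    rw [uIcc_of_le ht.1] at hs
    have hs' : s ∈ Icc 0 T := ⟨hs.1, hs.2.trans ht.2⟩
    refine integral_eq_zero_of_ae ?_
    filter_upwards [ae_eq_of_integral_sq (h1r.ut_cont.1 s hs').memLp (h2r.ut_cont.1 s hs').memLp
      (hv s hs')] with x hx
    simp [hx]
  filter_upwards [this] with x hx
  simpa [sub_eq_zero] using hx
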